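/- arXiv:1601.02320 — 5 statements merged into one kernel-verified Lean document; each statement's English description precedes it below -/
import Mathlib

section
/- Suppose m ≥ 3 is odd. Then the weight distribution of C_D is: #{a ∈ F_r : wt(c_a) = (p−1)²p^{m−2}/2} = p^{m−1} − 1; #{a ∈ F_r : wt(c_a) = ((p−1)/2)((p−1)p^{m−2} + p^{(m−3)/2})} = ((p−1)/2)(p^{m−1} + p^{(m−1)/2}); #{a ∈ F_r : wt(c_a) = ((p−1)/2)((p−1)p^{m−2} − p^{(m−3)/2})} = ((p−1)/2)(p^{m−1} − p^{(m−1)/2}); #{a ∈ F_r : wt(c_a) = 0} = 1; and no other Hamming weight occurs. -/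
/-- The Hamming weight `wt(c_a) = #{x ∈ D : Tr(a x²) ≠ 0}` of the codeword of `C_D`
indexed by `a`, where `D = {x ∈ F_r^* : Tr(x) ∈ Sq}`. -/
noncomputable def wtD (p : ℕ) (F : Type) [Field F] [Algebra (ZMod p) F] (a : F) : ℕ :=
  Set.ncard {x : F | (x ≠ 0 ∧ IsSquare (Algebra.trace (ZMod p) F x) ∧
    Algebra.trace (ZMod p) F x ≠ 0) ∧ Algebra.trace (ZMod p) F (a * x ^ 2) ≠ 0}

set_option linter.all false

open Finset in
theorem quad_sum_aux {K : Type} [Field K] [Fintype K] [DecidableEq K] (hK : ringChar K ≠ 2)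
    (ψ : AddChar K ℂ) (hψ : ψ.IsPrimitive) (b : K) (hb : b ≠ 0) :
    ∑ x, ψ (b * x ^ 2) = (quadraticChar K b : ℂ) *
      gaussSum ((quadraticChar K).ringHomComp (Int.castRingHom ℂ)) ψ := by
  have h1 : ∑ x, ψ (b * x ^ 2) = ∑ t : K, ((quadraticChar K t : ℂ) + 1) * ψ (b * t) := by
    rw [← Finset.sum_fiberwise (s := Finset.univ) (g := fun x : K => x ^ 2)]
    refine Finset.sum_congr rfl fun t _ => ?_
    have h2 := quadraticChar_card_sqrts hK t
    have h3 : ((#{x : K | x ^ 2 = t} : ℕ) : ℂ) = (quadraticChar K t : ℂ) + 1 := by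
      rw [Set.toFinset_ofPred] at h2
      exact_mod_cast congrArg (Int.cast : ℤ → ℂ) h2
    rw [← h3, Finset.sum_congr rfl (g := fun _ => ψ (b * t))]
    · simp
    · intro x hx
      simp at hx
      rw [hx]
  have h4 : ∑ t : K, ψ (b * t) = 0 := by
    have := AddChar.sum_mulShift b hψ
    simp only [hb, if_false, Nat.cast_zero] at this
    rw [← this]
    simp [mul_comm]
  have h5 := gaussSum_mulShift ((quadraticChar K).ringHomComp (Int.castRingHom ℂ)) ψ (Units.mk0 b hb)
  have h6 : (quadraticChar K b : ℂ) ^ 2 = 1 := by exact_mod_cast quadraticChar_sq_one hb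
  rw [h1, ← h5]
  simp only [add_mul, one_mul, Finset.sum_add_distrib, h4, add_zero]
  simp only [gaussSum, MulChar.ringHomComp_apply, AddChar.mulShift_apply, Units.val_mk0]
  simp only [eq_intCast]
  rw [← mul_assoc, ← sq, h6, one_mul]

theorem quad_gauss_sq {K : Type} [Field K] [Fintype K] [DecidableEq K] (hK : ringChar K ≠ 2)
    (ψ : AddChar K ℂ) (hψ : ψ.IsPrimitive) :
    (gaussSum ((quadraticChar K).ringHomComp (Int.castRingHom ℂ)) ψ) ^ 2
      = (quadraticChar K (-1) : ℂ) * (Fintype.card K : ℂ) := by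
  rw [gaussSum_sq _ _ hψ]
  · simp
  · rw [MulChar.ringHomComp_ne_one_iff (RingHom.injective_int _)]
    exact quadraticChar_ne_one hK
  · exact (quadraticChar_isQuadratic K).comp _

section
variable (p m : ℕ) [Fact p.Prime] (F : Type) [Field F] [Fintype F] [Algebra (ZMod p) F]

theorem ringChar_aux (hp2 : p ≠ 2) : ringChar F ≠ 2 := by
  have : CharP F p := charP_of_injective_algebraMap (algebraMap (ZMod p) F).injective p
  rw [ringChar.eq F p]
  exact hp2

theorem ringChar_aux' (hp2 : p ≠ 2) : ringChar (ZMod p) ≠ 2 := by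
  rw [ZMod.ringChar_zmod_n]
  exact hp2

theorem char_base [DecidableEq F] (hp2 : p ≠ 2) (hmo : Odd m) (hcard : Fintype.card F = p ^ m)
    (y : ZMod p) : quadraticChar F (algebraMap (ZMod p) F y) = quadraticChar (ZMod p) y := by
  by_cases hy : y = 0
  · simp [hy]
  have hp : Odd p := (Fact.out : p.Prime).odd_of_ne_two hp2
  have hodd : Odd (∑ i ∈ Finset.range m, p ^ i) := by
    rw [Finset.odd_sum_iff_odd_card_odd]
    rw [Finset.filter_true_of_mem (fun i _ => hp.pow)]
    simpa using hmo
  have hdiv : p ^ m / 2 = p / 2 * ∑ i ∈ Finset.range m, p ^ i := by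
    obtain ⟨h, rfl⟩ := hp
    have := Nat.geomSum_eq (m := 2 * h + 1) (by have := (Fact.out : (2*h+1).Prime).two_le; omega) m
    have h1 := geom_sum_mul_add (2 * h) m
    have e : (2 * h + 1) / 2 = h := by omega
    rw [e]
    rw [← h1]
    have : (∑ i ∈ Finset.range m, (2 * h + 1) ^ i) * (2 * h) = 2 * (h * (∑ i ∈ Finset.range m, (2 * h + 1) ^ i)) := by ring
    rw [this]
    omega
  have e1 := quadraticChar_eq_pow_of_char_ne_two' (ringChar_aux p F hp2) (algebraMap (ZMod p) F y)
  have e2 := quadraticChar_eq_pow_of_char_ne_two' (ringChar_aux' p hp2) y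
  rw [hcard, hdiv, pow_mul, ← map_pow] at e1
  rw [ZMod.card] at e2
  rw [← e2] at e1
  have hne : algebraMap (ZMod p) F y ≠ 0 := by simpa using hy
  have h2 : (1 : F) ≠ -1 := by
    intro h
    exact Ring.neg_one_ne_one_of_char_ne_two (ringChar_aux p F hp2) h.symm
  rcases quadraticChar_dichotomy hne with h | h <;> rcases quadraticChar_dichotomy hy with h' | h' <;>
    rw [h, h'] at e1 ⊢ <;> simp [hodd.neg_one_pow] at e1
  · exact absurd e1 h2
  · exact absurd e1.symm h2

/-- the canonical additive character of `F` -/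
noncomputable def psiF : AddChar F ℂ :=
  (ZMod.stdAddChar (N := p)).compAddMonoidHom (Algebra.trace (ZMod p) F).toAddMonoidHom

theorem psiF_apply (x : F) : psiF p F x = ZMod.stdAddChar (Algebra.trace (ZMod p) F x) := rfl

theorem psiF_prim : (psiF p F).IsPrimitive := by
  apply AddChar.IsPrimitive.of_ne_one
  obtain ⟨x, hx⟩ := Algebra.trace_surjective (ZMod p) F 1
  intro h
  have h1 := DFunLike.congr_fun h x
  rw [psiF_apply, hx, AddChar.one_apply, ← AddChar.map_zero_eq_one (ZMod.stdAddChar (N := p))] at h1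
  exact one_ne_zero (ZMod.injective_stdAddChar h1)

theorem ind_sum (t : ZMod p) :
    ∑ y : ZMod p, (ZMod.stdAddChar (y * t) : ℂ) = if t = 0 then (p : ℂ) else 0 := by
  have := AddChar.sum_mulShift t (ZMod.isPrimitive_stdAddChar p)
  rw [this, ZMod.card]
  split_ifs <;> simp

theorem psiF_smul (y : ZMod p) (x : F) :
    psiF p F (algebraMap (ZMod p) F y * x) = ZMod.stdAddChar (y * Algebra.trace (ZMod p) F x) := by
  rw [psiF_apply, ← Algebra.smul_def, map_smul, smul_eq_mul]

open Finset in
theorem card_tr_zero (hm : 1 ≤ m) [DecidableEq F] (hcard : Fintype.card F = p ^ m) (b : F) (hb : b ≠ 0) :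
    #{x : F | Algebra.trace (ZMod p) F (x * b) = 0} = p ^ (m - 1) := by
  have hp0 : (p : ℂ) ≠ 0 := by exact_mod_cast (Fact.out : p.Prime).ne_zero
  have h : (p : ℂ) * (#{x : F | Algebra.trace (ZMod p) F (x * b) = 0} : ℕ) = (p : ℂ) ^ m := by
    calc _ = ∑ x : F, ∑ y : ZMod p, psiF p F (algebraMap (ZMod p) F y * (x * b)) := by
            simp_rw [psiF_smul, ind_sum]
            rw [Finset.sum_ite]
            simp [mul_comm]
      _ = ∑ y : ZMod p, ∑ x : F, psiF p F (x * (algebraMap (ZMod p) F y * b)) := by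
            rw [Finset.sum_comm]
            refine Finset.sum_congr rfl fun y _ => Finset.sum_congr rfl fun x _ => ?_
            congr 1; ring
      _ = ∑ y : ZMod p, if y = 0 then (p : ℂ) ^ m else 0 := by
            refine Finset.sum_congr rfl fun y _ => ?_
            rw [AddChar.sum_mulShift _ (psiF_prim p F), hcard]
            by_cases hy : y = 0 <;> simp [hy, hb]
      _ = _ := by simp
  obtain ⟨n, rfl⟩ : ∃ n, m = n + 1 := ⟨m - 1, by omega⟩
  rw [pow_succ', mul_right_inj' hp0] at h
  exact_mod_cast h

open Finset in
theorem card_Q_zero (hp2 : p ≠ 2) (hmo : Odd m) [DecidableEq F] (hcard : Fintype.card F = p ^ m)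
    (a : F) (ha : a ≠ 0) :
    #{x : F | Algebra.trace (ZMod p) F (a * x ^ 2) = 0} = p ^ (m - 1) := by
  have hm : 1 ≤ m := hmo.pos
  have hp0 : (p : ℂ) ≠ 0 := by exact_mod_cast (Fact.out : p.Prime).ne_zero
  have h : (p : ℂ) * (#{x : F | Algebra.trace (ZMod p) F (a * x ^ 2) = 0} : ℕ) = (p : ℂ) ^ m := by
    set G := gaussSum ((quadraticChar F).ringHomComp (Int.castRingHom ℂ)) (psiF p F)
    calc _ = ∑ x : F, ∑ y : ZMod p, psiF p F (algebraMap (ZMod p) F y * (a * x ^ 2)) := by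
            simp_rw [psiF_smul, ind_sum]
            rw [Finset.sum_ite]
            simp [mul_comm]
      _ = ∑ y : ZMod p, ∑ x : F, psiF p F ((algebraMap (ZMod p) F y * a) * x ^ 2) := by
            rw [Finset.sum_comm]
            simp_rw [mul_assoc]
      _ = ∑ y : ZMod p, ((if y = 0 then (p : ℂ) ^ m else 0)
            + (quadraticChar (ZMod p) y : ℂ) * ((quadraticChar F a : ℂ) * G)) := by
            refine Finset.sum_congr rfl fun y _ => ?_
            by_cases hy : y = 0
            · simp [hy, hcard]
            · rw [quad_sum_aux (ringChar_aux p F hp2) _ (psiF_prim p F) _ (by simp [hy, ha]),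
                map_mul, char_base p m F hp2 hmo hcard]
              simp [hy, G, mul_assoc]
      _ = _ := by
            rw [Finset.sum_add_distrib, ← Finset.sum_mul]
            have := quadraticChar_sum_zero (ringChar_aux' p hp2)
            have h2 : ∑ y : ZMod p, (quadraticChar (ZMod p) y : ℂ) = 0 := by exact_mod_cast this
            rw [h2]; simp
  obtain ⟨n, rfl⟩ : ∃ n, m = n + 1 := ⟨m - 1, by omega⟩
  rw [pow_succ', mul_right_inj' hp0] at h
  exact_mod_cast h

/-- number of `x` with `Tr x = 0` and `Tr (a x^2) = 0` -/
noncomputable def Z0 (a : F) : ℕ :=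
  Set.ncard {x : F | Algebra.trace (ZMod p) F x = 0 ∧ Algebra.trace (ZMod p) F (a * x ^ 2) = 0}

theorem S_eval (hp2 : p ≠ 2) (hmo : Odd m) [DecidableEq F] (hcard : Fintype.card F = p ^ m)
    (a : F) (ha : a ≠ 0) (y z : ZMod p) (hy : y ≠ 0) :
    ∑ x : F, psiF p F (algebraMap (ZMod p) F y * (a * x ^ 2) + algebraMap (ZMod p) F z * x)
     = (quadraticChar (ZMod p) y : ℂ) * ((quadraticChar F a : ℂ) *
      gaussSum ((quadraticChar F).ringHomComp (Int.castRingHom ℂ)) (psiF p F)) *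
      ZMod.stdAddChar ((- Algebra.trace (ZMod p) F a⁻¹ * (4 * y)⁻¹) * z ^ 2) := by
  have h2 : (2 : F) ≠ 0 := Ring.two_ne_zero (ringChar_aux p F hp2)
  have h2' : (2 : ZMod p) ≠ 0 := Ring.two_ne_zero (ringChar_aux' p hp2)
  have h4' : (4 : ZMod p) ≠ 0 := by
    have : (4 : ZMod p) = 2 * 2 := by norm_num
    rw [this]; exact mul_ne_zero h2' h2'
  set Y := algebraMap (ZMod p) F y with hY
  set W := algebraMap (ZMod p) F z with hW
  have hY0 : Y ≠ 0 := by simpa [hY] using hy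
  have key : ∀ x : F, psiF p F (Y * (a * x ^ 2) + W * x) =
      psiF p F ((Y * a) * (x + W * (2 * (Y * a))⁻¹) ^ 2) *
      ZMod.stdAddChar ((- Algebra.trace (ZMod p) F a⁻¹ * (4 * y)⁻¹) * z ^ 2) := by
    intro x
    have : (- Algebra.trace (ZMod p) F a⁻¹ * (4 * y)⁻¹) * z ^ 2
        = (-(4 * y)⁻¹ * z ^ 2) * Algebra.trace (ZMod p) F a⁻¹ := by ring
    rw [this, ← psiF_smul, ← AddChar.map_add_eq_mul]
    congr 1
    have h4 : (4 : F) ≠ 0 := by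
      have : (4 : F) = 2 * 2 := by norm_num
      rw [this]; exact mul_ne_zero h2 h2
    simp only [map_mul, map_neg, map_inv₀, map_pow, ← hY, ← hW, map_ofNat]
    field_simp
    ring
  simp_rw [key]
  rw [← Finset.sum_mul]
  rw [Fintype.sum_bijective (fun x => x + W * (2 * (Y * a))⁻¹) (AddGroup.addRight_bijective _) _
    (fun x => psiF p F ((Y * a) * x ^ 2)) (fun x => rfl)]
  rw [quad_sum_aux (ringChar_aux p F hp2) _ (psiF_prim p F) _ (mul_ne_zero hY0 ha),
                map_mul, hY, char_base p m F hp2 hmo hcard]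
  push_cast
  ring

theorem Z0_sum (hp2 : p ≠ 2) (hmo : Odd m) [DecidableEq F] (hcard : Fintype.card F = p ^ m)
    (a : F) (ha : a ≠ 0) :
    (p : ℂ) ^ 2 * (Z0 p F a : ℂ) = (p : ℂ) ^ m + 
      ∑ y : ZMod p, ∑ z : ZMod p, (quadraticChar (ZMod p) y : ℂ) * ((quadraticChar F a : ℂ) *
      gaussSum ((quadraticChar F).ringHomComp (Int.castRingHom ℂ)) (psiF p F)) *
      ZMod.stdAddChar ((- Algebra.trace (ZMod p) F a⁻¹ * (4 * y)⁻¹) * z ^ 2) := by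
  calc _ = ∑ x : F, ∑ y : ZMod p, ∑ z : ZMod p,
        psiF p F (algebraMap (ZMod p) F y * (a * x ^ 2) + algebraMap (ZMod p) F z * x) := by
          simp_rw [AddChar.map_add_eq_mul, ← Finset.mul_sum, ← Finset.sum_mul, psiF_smul, ind_sum]
          rw [Z0, Set.ncard_eq_toFinset_card', Set.toFinset_ofPred]
          simp_rw [ite_mul, zero_mul, mul_ite, mul_zero, ← ite_and]
          rw [Finset.sum_ite]
          simp only [Finset.sum_const, Finset.sum_const_zero, add_zero, nsmul_eq_mul]
          simp_rw [and_comm]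
          ring
    _ = ∑ y : ZMod p, ∑ z : ZMod p, ∑ x : F,
        psiF p F (algebraMap (ZMod p) F y * (a * x ^ 2) + algebraMap (ZMod p) F z * x) := by
          rw [Finset.sum_comm]
          refine Finset.sum_congr rfl fun y _ => Finset.sum_comm
    _ = ∑ y : ZMod p, ∑ z : ZMod p, ((if y = 0 then (if z = 0 then (p : ℂ) ^ m else 0) else 0) + (quadraticChar (ZMod p) y : ℂ) * ((quadraticChar F a : ℂ) *
      gaussSum ((quadraticChar F).ringHomComp (Int.castRingHom ℂ)) (psiF p F)) *
      ZMod.stdAddChar ((- Algebra.trace (ZMod p) F a⁻¹ * (4 * y)⁻¹) * z ^ 2)) := by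
          refine Finset.sum_congr rfl fun y _ => Finset.sum_congr rfl fun z _ => ?_
          by_cases hy : y = 0
          · simp only [hy, map_zero, zero_mul, zero_add, if_true, Int.cast_zero, add_zero]
            simp_rw [mul_comm _ (_ : F)]
            rw [AddChar.sum_mulShift _ (psiF_prim p F), hcard]
            by_cases hz : z = 0 <;> simp [hz]
          · rw [S_eval p m F hp2 hmo hcard a ha y z hy]
            simp [hy]
    _ = _ := by
          simp_rw [Finset.sum_add_distrib]
          congr 1
          simp

theorem Z0_T0 (hp2 : p ≠ 2) (hmo : Odd m) (hm : 3 ≤ m) (hcard : Fintype.card F = p ^ m)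
    (a : F) (ha : a ≠ 0) (hT : Algebra.trace (ZMod p) F a⁻¹ = 0) : Z0 p F a = p ^ (m - 2) := by
  classical
  have hp0 : (p : ℂ) ≠ 0 := by exact_mod_cast (Fact.out : p.Prime).ne_zero
  have h := Z0_sum p m F hp2 hmo hcard a ha
  simp only [hT, neg_zero, zero_mul, AddChar.map_zero_eq_one, mul_one, Finset.sum_const] at h
  rw [← Finset.smul_sum, ← Finset.sum_mul] at h
  have h2 : ∑ y : ZMod p, (quadraticChar (ZMod p) y : ℂ) = 0 := by
    exact_mod_cast quadraticChar_sum_zero (ringChar_aux' p hp2)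
  rw [h2] at h
  obtain ⟨n, rfl⟩ : ∃ n, m = n + 2 := ⟨m - 2, by omega⟩
  simp only [zero_mul, smul_zero, add_zero] at h
  rw [pow_add, mul_comm, mul_left_inj' (pow_ne_zero _ hp0)] at h
  exact_mod_cast h

theorem Z0_T1 (hp2 : p ≠ 2) (k : ℕ) (hcard : Fintype.card F = p ^ (2 * k + 3))
    (a : F) (ha : a ≠ 0) (hT : Algebra.trace (ZMod p) F a⁻¹ ≠ 0) :
    (Z0 p F a : ℤ) = p * (p ^ k) ^ 2 + (p - 1) * p ^ k ∨
    (Z0 p F a : ℤ) = p * (p ^ k) ^ 2 - (p - 1) * p ^ k := by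
  classical
  have hmo : Odd (2 * k + 3) := ⟨k + 1, by ring⟩
  have hp0 : (p : ℂ) ≠ 0 := by exact_mod_cast (Fact.out : p.Prime).ne_zero
  have h2' : (2 : ZMod p) ≠ 0 := Ring.two_ne_zero (ringChar_aux' p hp2)
  have h4' : (4 : ZMod p) ≠ 0 := by
    have : (4 : ZMod p) = 2 * 2 := by norm_num
    rw [this]; exact mul_ne_zero h2' h2'
  have h := Z0_sum p _ F hp2 hmo hcard a ha
  set T := Algebra.trace (ZMod p) F a⁻¹
  set G := gaussSum ((quadraticChar F).ringHomComp (Int.castRingHom ℂ)) (psiF p F) with hG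
  set g := gaussSum ((quadraticChar (ZMod p)).ringHomComp (Int.castRingHom ℂ))
    (ZMod.stdAddChar (N := p)) with hg
  have hG2 : G ^ 2 = _ := quad_gauss_sq (ringChar_aux p F hp2) _ (psiF_prim p F)
  have hg2 : g ^ 2 = _ := quad_gauss_sq (ringChar_aux' p hp2) _ (ZMod.isPrimitive_stdAddChar p)
  have hm1 := char_base p _ F hp2 hmo hcard (-1)
  rw [map_neg, map_one] at hm1
  rw [hm1, hcard] at hG2
  rw [ZMod.card] at hg2
  have hs : ∀ y : ZMod p, ∑ z : ZMod p, (quadraticChar (ZMod p) y : ℂ) * ((quadraticChar F a : ℂ) * G) *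
      ZMod.stdAddChar ((- T * (4 * y)⁻¹) * z ^ 2) =
      if y = 0 then 0 else (quadraticChar F a : ℂ) * (quadraticChar (ZMod p) (-T) : ℂ) * (G * g) := by
    intro y
    by_cases hy : y = 0
    · simp [hy]
    · rw [← Finset.mul_sum, quad_sum_aux (ringChar_aux' p hp2) _ (ZMod.isPrimitive_stdAddChar p) _
        (by simp [hT, hy, h4']), ← hg]
      have e : quadraticChar (ZMod p) (-T * (4 * y)⁻¹)
          = quadraticChar (ZMod p) (-T) * quadraticChar (ZMod p) y := by
        have : -T * (4 * y)⁻¹ = (-T * y) * ((2 * y)⁻¹) ^ 2 := by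
          field_simp
          norm_num
        rw [this, map_mul, map_mul, quadraticChar_sq_one' (by simp [h2', hy]), mul_one]
      rw [e]
      have e6 : (quadraticChar (ZMod p) y : ℂ) ^ 2 = 1 := by exact_mod_cast quadraticChar_sq_one hy
      simp only [hy, if_false]
      push_cast
      linear_combination ((quadraticChar F a : ℂ) * (quadraticChar (ZMod p) (-T) : ℂ) * (G * g)) * e6
  simp_rw [hs] at h
  set E := (quadraticChar F a : ℂ) * (quadraticChar (ZMod p) (-T) : ℂ) * (G * g) with hE
  have hE2 : E ^ 2 = ((p : ℂ) ^ (k + 2)) ^ 2 := by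
    have e1 : (quadraticChar F a : ℂ) ^ 2 = 1 := by exact_mod_cast quadraticChar_sq_one ha
    have e2 : (quadraticChar (ZMod p) (-T) : ℂ) ^ 2 = 1 := by
      exact_mod_cast quadraticChar_sq_one (neg_ne_zero.mpr hT)
    have e3 : (quadraticChar (ZMod p) (-1) : ℂ) ^ 2 = 1 := by
      have h3 := quadraticChar_sq_one (F := ZMod p) (a := -1) (neg_ne_zero.mpr one_ne_zero)
      rw [← Int.cast_pow, h3, Int.cast_one]
    rw [hE, mul_pow, mul_pow, mul_pow, e1, e2, hG2, hg2]
    push_cast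
    linear_combination ((p : ℂ) ^ (2 * k + 3) * p) * e3
  have hsum : ∑ y : ZMod p, (if y = 0 then 0 else E) = ((p : ℂ) - 1) * E := by
    have : ∀ y : ZMod p, (if y = 0 then 0 else E) = E - (if y = 0 then E else 0) := by
      intro y; split_ifs <;> simp
    simp_rw [this, Finset.sum_sub_distrib]
    simp
    ring
  rw [hsum] at h
  have hpp : (p : ℂ) ^ 2 ≠ 0 := pow_ne_zero _ hp0
  rcases sq_eq_sq_iff_eq_or_eq_neg.mp hE2 with e | e <;> rw [e] at h
  · left
    have : (Z0 p F a : ℂ) = p * (p ^ k) ^ 2 + (p - 1) * p ^ k := by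
      apply mul_left_cancel₀ hpp
      rw [h]; ring
    exact_mod_cast this
  · right
    have : (Z0 p F a : ℂ) = p * (p ^ k) ^ 2 - (p - 1) * p ^ k := by
      apply mul_left_cancel₀ hpp
      rw [h]; ring
    exact_mod_cast this
open Finset in
theorem two_wt (hp2 : p ≠ 2) (hmo : Odd m) (hcard : Fintype.card F = p ^ m) (a : F) (ha : a ≠ 0) :
    2 * wtD p F a + 2 * p ^ (m - 1) = p ^ m + Z0 p F a := by
  classical
  obtain ⟨c, hc⟩ := FiniteField.exists_nonsquare (ringChar_aux' p hp2)
  have hc0 : c ≠ 0 := by rintro rfl; exact hc IsSquare.zero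
  set C := algebraMap (ZMod p) F c with hC
  have hC0 : C ≠ 0 := by simpa [hC] using hc0
  set tr := Algebra.trace (ZMod p) F with htr
  have trC : ∀ x, tr (C * x) = c * tr x := by
    intro x
    rw [hC, ← Algebra.smul_def, map_smul, smul_eq_mul]
  have trC2 : ∀ x, tr (a * (C * x) ^ 2) = c ^ 2 * tr (a * x ^ 2) := by
    intro x
    have : a * (C * x) ^ 2 = (c ^ 2) • (a * x ^ 2) := by
      rw [Algebra.smul_def, map_pow, ← hC]; ring
    rw [this, map_smul, smul_eq_mul]
  have hw : wtD p F a = #{x : F | (IsSquare (tr x) ∧ tr x ≠ 0) ∧ tr (a * x ^ 2) ≠ 0} := by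
    rw [wtD, Set.ncard_eq_toFinset_card', Set.toFinset_ofPred]
    congr 1
    ext x
    simp only [mem_filter, mem_univ, true_and]
    constructor
    · rintro ⟨⟨_, h1, h2⟩, h3⟩
      exact ⟨⟨h1, h2⟩, h3⟩
    · rintro ⟨⟨h1, h2⟩, h3⟩
      refine ⟨⟨?_, h1, h2⟩, h3⟩
      rintro rfl
      simp at h2
  have hw' : #{x : F | (IsSquare (tr x) ∧ tr x ≠ 0) ∧ tr (a * x ^ 2) ≠ 0} =
      #{x : F | (¬ IsSquare (tr x)) ∧ tr (a * x ^ 2) ≠ 0} := by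
    refine Finset.card_bijective (fun x => C * x) (mulLeft_bijective₀ C hC0) ?_
    intro x
    simp only [mem_filter, mem_univ, true_and, trC, trC2]
    have hsq : (IsSquare (tr x) ∧ tr x ≠ 0) ↔ ¬ IsSquare (c * tr x) := by
      by_cases h0 : tr x = 0
      · simp [h0]
      · rw [← quadraticChar_neg_one_iff_not_isSquare, map_mul,
          quadraticChar_neg_one_iff_not_isSquare.mpr hc, ← quadraticChar_one_iff_isSquare h0]
        simp [h0]
    rw [hsq]
    simp [hc0]
  have hU : #{x : F | (IsSquare (tr x) ∧ tr x ≠ 0) ∧ tr (a * x ^ 2) ≠ 0} +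
      #{x : F | (¬ IsSquare (tr x)) ∧ tr (a * x ^ 2) ≠ 0} =
      #{x : F | tr x ≠ 0 ∧ tr (a * x ^ 2) ≠ 0} := by
    rw [← Finset.card_union_of_disjoint]
    · congr 1
      ext x
      simp only [mem_union, mem_filter, mem_univ, true_and]
      have : tr x = 0 → IsSquare (tr x) := fun h => h ▸ IsSquare.zero
      tauto
    · rw [Finset.disjoint_filter]
      intro x _
      tauto
  have e1 : #{x : F | tr x = 0} = p ^ (m - 1) := by
    have := card_tr_zero p m F hmo.pos hcard 1 one_ne_zero
    simpa using this
  have e2 := card_Q_zero p m F hp2 hmo hcard a ha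
  have e3 : Z0 p F a = #{x : F | tr x = 0 ∧ tr (a * x ^ 2) = 0} := by
    rw [Z0, Set.ncard_eq_toFinset_card', Set.toFinset_ofPred]
  have e4 := Finset.card_union_add_card_inter ({x : F | tr x = 0} : Finset F) {x : F | tr (a * x ^ 2) = 0}
  have e5 := Finset.card_filter_add_card_filter_not (s := (univ : Finset F)) (fun x => tr x = 0 ∨ tr (a * x ^ 2) = 0)
  rw [← Finset.filter_or, ← Finset.filter_and] at e4
  simp only [not_or, Finset.card_univ, hcard] at e5
  simp only [ne_eq] at *
  rw [e1, e2, ← e3] at e4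
  omega

open Finset in
theorem Z0_total (hmo : Odd m) (hcard : Fintype.card F = p ^ m) :
    ((∑ a : F, Z0 p F a : ℕ) : ℤ) = p ^ m + (p ^ (m - 1) - 1) * p ^ (m - 1) := by
  classical
  set tr := Algebra.trace (ZMod p) F with htr
  have e1 : #{x : F | tr x = 0} = p ^ (m - 1) := by
    have := card_tr_zero p m F hmo.pos hcard 1 one_ne_zero
    simpa using this
  have h1 : ∑ a : F, Z0 p F a = ∑ x ∈ {x : F | tr x = 0}, #{a : F | tr (a * x ^ 2) = 0} := by
    simp_rw [Finset.card_filter]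
    rw [Finset.sum_comm]
    refine Finset.sum_congr rfl fun a _ => ?_
    rw [← Finset.card_filter, Finset.filter_filter, Z0, Set.ncard_eq_toFinset_card',
      Set.toFinset_ofPred]
  have h0 : (0 : F) ∈ ({x : F | tr x = 0} : Finset F) := by simp
  rw [h1, ← Finset.add_sum_erase _ _ h0, Finset.sum_congr rfl (g := fun _ => p ^ (m - 1))]
  · rw [Finset.sum_const, Finset.card_erase_of_mem h0, e1]
    have : 1 ≤ p ^ (m - 1) := Nat.one_le_pow _ _ (Fact.out : p.Prime).pos
    simp [hcard, Nat.cast_sub this]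
  · intro x hx
    simp only [mem_erase] at hx
    exact card_tr_zero p m F hmo.pos hcard _ (pow_ne_zero 2 hx.1)

theorem wt_cases (hp2 : p ≠ 2) (k h : ℕ) (hp : p = 2 * h + 1)
    (hcard : Fintype.card F = p ^ (2 * k + 3)) (a : F) :
    (a = 0 ∧ Algebra.trace (ZMod p) F a⁻¹ = 0 ∧ (wtD p F a : ℤ) = 0 ∧ (Z0 p F a : ℤ) = p ^ 2 * (p ^ k) ^ 2) ∨
    (a ≠ 0 ∧ Algebra.trace (ZMod p) F a⁻¹ = 0 ∧ (wtD p F a : ℤ) = 2 * h ^ 2 * p * (p ^ k) ^ 2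
      ∧ (Z0 p F a : ℤ) = p * (p ^ k) ^ 2) ∨
    (a ≠ 0 ∧ Algebra.trace (ZMod p) F a⁻¹ ≠ 0 ∧ (wtD p F a : ℤ) = h * (2 * h * p * (p ^ k) ^ 2 + p ^ k)
      ∧ (Z0 p F a : ℤ) = p * (p ^ k) ^ 2 + 2 * h * p ^ k) ∨
    (a ≠ 0 ∧ Algebra.trace (ZMod p) F a⁻¹ ≠ 0 ∧ (wtD p F a : ℤ) = h * (2 * h * p * (p ^ k) ^ 2 - p ^ k)
      ∧ (Z0 p F a : ℤ) = p * (p ^ k) ^ 2 - 2 * h * p ^ k) := by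
  classical
  have hmo : Odd (2 * k + 3) := ⟨k + 1, by ring⟩
  have hpZ : (p : ℤ) = 2 * h + 1 := by exact_mod_cast hp
  by_cases ha : a = 0
  · left
    subst ha
    refine ⟨rfl, by simp, by simp [wtD], ?_⟩
    have := card_tr_zero p _ F hmo.pos hcard 1 one_ne_zero
    rw [Z0, Set.ncard_eq_toFinset_card', Set.toFinset_ofPred]
    simp only [mul_one] at this
    simp only [zero_mul, map_zero, and_true, this]
    push_cast
    ring
  right
  have hw := two_wt p _ F hp2 hmo hcard a ha
  rw [show 2 * k + 3 - 1 = 2 * k + 2 by omega] at hw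
  have hw' : 2 * (wtD p F a : ℤ) + 2 * p ^ (2 * k + 2) = p ^ (2 * k + 3) + Z0 p F a := by
    exact_mod_cast hw
  have e1 : (p : ℤ) ^ (2 * k + 2) = p ^ 2 * (p ^ k) ^ 2 := by ring
  have e2 : (p : ℤ) ^ (2 * k + 3) = p ^ 3 * (p ^ k) ^ 2 := by ring
  rw [e1, e2] at hw'
  by_cases hT : Algebra.trace (ZMod p) F a⁻¹ = 0
  · left
    have hz := Z0_T0 p _ F hp2 hmo (by omega) hcard a ha hT
    have hz' : (Z0 p F a : ℤ) = p * (p ^ k) ^ 2 := by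
      rw [hz, show 2 * k + 3 - 2 = 2 * k + 1 by omega]; push_cast; ring
    refine ⟨ha, hT, ?_, hz'⟩
    rw [hz'] at hw'
    generalize (p : ℤ) ^ k = P at *
    rw [hpZ] at hw' ⊢
    linarith
  · right
    rcases Z0_T1 p F hp2 k hcard a ha hT with hz | hz
    · left
      refine ⟨ha, hT, ?_, ?_⟩
      · rw [hz] at hw'
        generalize (p : ℤ) ^ k = P at *
        rw [hpZ] at hw' ⊢
        linarith
      · rw [hz, show (p : ℤ) - 1 = 2 * h by linarith]
    · right
      refine ⟨ha, hT, ?_, ?_⟩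
      · rw [hz] at hw'
        generalize (p : ℤ) ^ k = P at *
        rw [hpZ] at hw' ⊢
        linarith
      · rw [hz, show (p : ℤ) - 1 = 2 * h by linarith]

end

set_option maxHeartbeats 1000000 in
/-- the weight distribution of `C_D` for `m ≥ 3` odd. -/
theorem stmt_8 (p m : ℕ) [Fact p.Prime] (hp2 : p ≠ 2) (hm : 3 ≤ m) (hmo : Odd m)
    (F : Type) [Field F] [Fintype F] [Algebra (ZMod p) F]
    (hcard : Fintype.card F = p ^ m) :
    Set.ncard {a : F | wtD p F a = (p - 1) ^ 2 * p ^ (m - 2) / 2} = p ^ (m - 1) - 1 ∧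
    Set.ncard {a : F | wtD p F a = (p - 1) / 2 * ((p - 1) * p ^ (m - 2) + p ^ ((m - 3) / 2))}
      = (p - 1) / 2 * (p ^ (m - 1) + p ^ ((m - 1) / 2)) ∧
    Set.ncard {a : F | wtD p F a = (p - 1) / 2 * ((p - 1) * p ^ (m - 2) - p ^ ((m - 3) / 2))}
      = (p - 1) / 2 * (p ^ (m - 1) - p ^ ((m - 1) / 2)) ∧
    Set.ncard {a : F | wtD p F a = 0} = 1 ∧
    (∀ a : F, wtD p F a = 0 ∨
      wtD p F a = (p - 1) ^ 2 * p ^ (m - 2) / 2 ∨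
      wtD p F a = (p - 1) / 2 * ((p - 1) * p ^ (m - 2) + p ^ ((m - 3) / 2)) ∨
      wtD p F a = (p - 1) / 2 * ((p - 1) * p ^ (m - 2) - p ^ ((m - 3) / 2))) := by
  classical
  obtain ⟨k, rfl⟩ : ∃ k, m = 2 * k + 3 := by
    obtain ⟨j, rfl⟩ := hmo
    exact ⟨j - 1, by omega⟩
  obtain ⟨h, hp⟩ := (Fact.out : p.Prime).odd_of_ne_two hp2
  have hp3 : 2 ≤ p := (Fact.out : p.Prime).two_le
  have hh : 1 ≤ h := by omega
  have hP1 : 1 ≤ p ^ k := Nat.one_le_pow _ _ (by omega)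
  have hc := wt_cases p F hp2 k h hp hcard
  have htot := Z0_total p _ F hmo hcard
  have htr : Finset.card {a : F | Algebra.trace (ZMod p) F a⁻¹ = 0} = p ^ (2 * k + 2) := by
    have h1 := card_tr_zero p _ F hmo.pos hcard 1 one_ne_zero
    rw [show 2 * k + 3 - 1 = 2 * k + 2 by omega] at h1
    simp only [mul_one] at h1
    rw [← h1]
    refine Finset.card_bijective (fun x => x⁻¹) inv_involutive.bijective ?_
    intro x
    simp
  rw [show 2 * k + 3 - 1 = 2 * k + 2 by omega] at *
  rw [show 2 * k + 3 - 2 = 2 * k + 1 by omega, show (2 * k + 3 - 3) / 2 = k by omega,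
    show (2 * k + 2) / 2 = k + 1 by omega, show p - 1 = 2 * h by omega,
    show 2 * h / 2 = h by omega]
  have hle : p ^ k ≤ 2 * h * p ^ (2 * k + 1) := by
    have : p ^ k ≤ p ^ (2 * k + 1) := Nat.pow_le_pow_right (by omega) (by omega)
    nlinarith
  have hle2 : p ^ (k + 1) ≤ p ^ (2 * k + 2) := Nat.pow_le_pow_right (by omega) (by omega)
  have hle3 : 1 ≤ p ^ (2 * k + 2) := Nat.one_le_pow _ _ (by omega)
  have hw0 : (2 * h) ^ 2 * p ^ (2 * k + 1) / 2 = 2 * h ^ 2 * p ^ (2 * k + 1) := by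
    rw [show (2 * h) ^ 2 * p ^ (2 * k + 1) = 2 * (2 * h ^ 2 * p ^ (2 * k + 1)) by ring]
    omega
  rw [hw0]
  set w0 := 2 * h ^ 2 * p ^ (2 * k + 1) with ew0
  set w1 := h * (2 * h * p ^ (2 * k + 1) + p ^ k) with ew1
  set w2 := h * (2 * h * p ^ (2 * k + 1) - p ^ k) with ew2
  have zw0 : (w0 : ℤ) = 2 * h ^ 2 * p * (p ^ k) ^ 2 := by rw [ew0]; push_cast; ring
  have zw1 : (w1 : ℤ) = h * (2 * h * p * (p ^ k) ^ 2 + p ^ k) := by rw [ew1]; push_cast; ring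
  have zw2 : (w2 : ℤ) = h * (2 * h * p * (p ^ k) ^ 2 - p ^ k) := by
    rw [ew2]; push_cast [Nat.cast_sub hle]; ring
  have zP1 : (1 : ℤ) ≤ (p : ℤ) ^ k := by exact_mod_cast hP1
  have zh : (1 : ℤ) ≤ (h : ℤ) := by exact_mod_cast hh
  have zp : (p : ℤ) = 2 * h + 1 := by exact_mod_cast hp
  have hhP : (1 : ℤ) ≤ h * (p : ℤ) ^ k := by nlinarith
  have hw2pos : 0 < w2 := by
    have : (0 : ℤ) < w2 := by
      rw [zw2, zp]
      have : (p : ℤ) ^ k < 2 * h * p * (p ^ k) ^ 2 := by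
        have h1 : (1 : ℤ) < 2 * h * p := by nlinarith
        have h2 : (p : ℤ) ^ k ≤ (p ^ k) ^ 2 := by nlinarith
        nlinarith
      rw [zp] at this
      apply mul_pos (by linarith) (by linarith)
    exact_mod_cast this
  have h20 : w2 < w0 := by
    zify; rw [zw2, zw0]; linear_combination hhP
  have h01 : w0 < w1 := by
    zify; rw [zw1, zw0]; linear_combination hhP
  -- restate the case distinction with natural-number weights
  have hc' : ∀ a : F,
      (a = 0 ∧ Algebra.trace (ZMod p) F a⁻¹ = 0 ∧ wtD p F a = 0 ∧
        (Z0 p F a : ℤ) = p ^ 2 * (p ^ k) ^ 2) ∨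
      (a ≠ 0 ∧ Algebra.trace (ZMod p) F a⁻¹ = 0 ∧ wtD p F a = w0 ∧
        (Z0 p F a : ℤ) = p * (p ^ k) ^ 2) ∨
      (a ≠ 0 ∧ Algebra.trace (ZMod p) F a⁻¹ ≠ 0 ∧ wtD p F a = w1 ∧
        (Z0 p F a : ℤ) = p * (p ^ k) ^ 2 + 2 * h * p ^ k) ∨
      (a ≠ 0 ∧ Algebra.trace (ZMod p) F a⁻¹ ≠ 0 ∧ wtD p F a = w2 ∧
        (Z0 p F a : ℤ) = p * (p ^ k) ^ 2 - 2 * h * p ^ k) := by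
    intro a
    have := hc a
    rw [← zw0, ← zw1, ← zw2] at this
    exact_mod_cast this
  clear hc
  clear_value w0 w1 w2
  have conv : ∀ w, Set.ncard {a : F | wtD p F a = w} = Finset.card {a : F | wtD p F a = w} := by
    intro w
    rw [Set.ncard_eq_toFinset_card', Set.toFinset_ofPred]
  simp only [conv]
  have f0 : Finset.card {a : F | wtD p F a = 0} = 1 := by
    rw [Finset.card_eq_one]
    refine ⟨0, ?_⟩
    ext a
    simp only [Finset.mem_filter, Finset.mem_univ, true_and, Finset.mem_singleton]
    have h0' : w0 ≠ 0 := by omega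
    have h1' : w1 ≠ 0 := by omega
    have h2' : w2 ≠ 0 := by omega
    rcases hc' a with h | h | h | h
    · exact iff_of_true h.2.2.1 h.1
    · rw [h.2.2.1]; exact iff_of_false h0' h.1
    · rw [h.2.2.1]; exact iff_of_false h1' h.1
    · rw [h.2.2.1]; exact iff_of_false h2' h.1
  have cardsum : ∀ w, ((Finset.card {a : F | wtD p F a = w} : ℕ) : ℤ) = ∑ a : F, if wtD p F a = w then 1 else 0 := by
    intro w; simp
  have g1 : ((Finset.card {a : F | Algebra.trace (ZMod p) F a⁻¹ = 0} : ℕ) : ℤ) =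
      Finset.card {a : F | wtD p F a = 0} + Finset.card {a : F | wtD p F a = w0} := by
    rw [cardsum, cardsum, ← Finset.sum_add_distrib, Finset.card_filter]
    push_cast
    refine Finset.sum_congr rfl fun a _ => ?_
    rcases hc' a with h | h | h | h <;> simp only [h.2.1, h.2.2.1] <;> split_ifs <;> first | omega | simp_all
  have g2 : (Fintype.card F : ℤ) =
      Finset.card {a : F | wtD p F a = 0} + Finset.card {a : F | wtD p F a = w0}
      + Finset.card {a : F | wtD p F a = w1} + Finset.card {a : F | wtD p F a = w2} := by
    simp only [cardsum, ← Finset.sum_add_distrib]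
    rw [Fintype.card_eq_sum_ones]
    push_cast
    refine Finset.sum_congr rfl fun a _ => ?_
    rcases hc' a with h | h | h | h <;> simp only [h.2.2.1] <;> split_ifs <;> omega
  have g3 : ((∑ a : F, Z0 p F a : ℕ) : ℤ) =
      p ^ 2 * (p ^ k) ^ 2 * Finset.card {a : F | wtD p F a = 0}
      + p * (p ^ k) ^ 2 * Finset.card {a : F | wtD p F a = w0}
      + (p * (p ^ k) ^ 2 + 2 * h * p ^ k) * Finset.card {a : F | wtD p F a = w1}
      + (p * (p ^ k) ^ 2 - 2 * h * p ^ k) * Finset.card {a : F | wtD p F a = w2} := by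
    simp only [cardsum, Finset.mul_sum, ← Finset.sum_add_distrib]
    push_cast
    refine Finset.sum_congr rfl fun a _ => ?_
    rcases hc' a with h | h | h | h <;> rw [h.2.2.1, h.2.2.2] <;> split_ifs <;> first | omega | ring
  rw [htr, f0] at g1
  rw [hcard, f0] at g2
  rw [htot, f0] at g3
  generalize Finset.card {a : F | wtD p F a = w0} = n0 at *
  generalize Finset.card {a : F | wtD p F a = w1} = n1 at *
  generalize Finset.card {a : F | wtD p F a = w2} = n2 at *
  have zn0 : (n0 : ℤ) = p ^ 2 * (p ^ k) ^ 2 - 1 := by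
    push_cast at g1; linear_combination -g1
  have zs : (n1 : ℤ) + n2 = 2 * h * p ^ 2 * (p ^ k) ^ 2 := by
    push_cast at g2
    rw [zn0] at g2
    have : (p : ℤ) ^ (2 * k + 3) = (2 * h + 1) * (p ^ 2 * (p ^ k) ^ 2) := by rw [← zp]; ring
    linear_combination this - g2
  have zd : (n1 : ℤ) - n2 = 2 * h * p * p ^ k := by
    have hne : (2 * h * (p : ℤ) ^ k) ≠ 0 := by positivity
    apply mul_left_cancel₀ hne
    push_cast at g3
    rw [zn0] at g3
    have e1 : (p : ℤ) ^ (2 * k + 3) = p ^ 3 * (p ^ k) ^ 2 := by ring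
    have e2 : (p : ℤ) ^ (2 * k + 2) = p ^ 2 * (p ^ k) ^ 2 := by ring
    rw [e1, e2] at g3
    generalize (p : ℤ) ^ k = P at *
    have hp' : 2 * (h : ℤ) = p - 1 := by linarith
    rw [hp'] at g3 zs ⊢
    linear_combination -g3 - p * P ^ 2 * zs
  refine ⟨?_, ?_, ?_, f0, ?_⟩
  · zify [hle3]; rw [zn0]; ring
  · zify
    have : 2 * (n1 : ℤ) = 2 * (h * (p ^ (2 * k + 2) + p ^ (k + 1))) := by
      linear_combination zs + zd
    linarith
  · zify [hle2]
    have : 2 * (n2 : ℤ) = 2 * (h * (p ^ (2 * k + 2) - p ^ (k + 1))) := by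
      linear_combination zs - zd
    linarith
  · intro a
    rcases hc' a with h | h | h | h
    · exact Or.inl h.2.2.1
    · exact Or.inr (Or.inl h.2.2.1)
    · exact Or.inr (Or.inr (Or.inl h.2.2.1))
    · exact Or.inr (Or.inr (Or.inr h.2.2.1))
end

section
/- Suppose m ≥ 2 is even. Then |D̃| = p^{m−1}, and the weight distribution of the punctured code C_{D̃} is: #{a ∈ F_r : wt̃(a) = (p−1)p^{m−2}} = p^{m−1} − 1; #{a ∈ F_r : wt̃(a) = (p−1)p^{m−2} + p^{(m−2)/2}} = ((p−1)/2)(p^{m−1} + p^{(m−2)/2}); #{a ∈ F_r : wt̃(a) = (p−1)p^{m−2} − p^{(m−2)/2}} = ((p−1)/2)(p^{m−1} − p^{(m−2)/2}); #{a ∈ F_r : wt̃(a) = 0} = 1; and no other weight occurs. In particular C_{D̃} is a [p^{m−1}, m] three-weight linear code. -/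
/-- The Hamming weight `wt̃(a) = #{x ∈ D̃ : Tr(a x²) ≠ 0}` of the codeword of the
punctured code `C_{D̃}` indexed by `a`. -/
noncomputable def wtT (p : ℕ) (F : Type) [Field F] [Algebra (ZMod p) F]
    (Dt : Set F) (a : F) : ℕ :=
  Set.ncard {x : F | x ∈ Dt ∧ Algebra.trace (ZMod p) F (a * x ^ 2) ≠ 0}


open Finset in
lemma indP (p : ℕ) [Fact p.Prime] (t : ZMod p) :
    ∑ z : ZMod p, (ZMod.stdAddChar (z * t) : ℂ) = if t = 0 then (p : ℂ) else 0 := by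
  have := AddChar.sum_mulShift t (ZMod.isPrimitive_stdAddChar p)
  rw [this]; simp [ZMod.card]

/-- the additive character of `F`. -/
noncomputable def EE (p : ℕ) [Fact p.Prime] (F : Type) [Field F] [Algebra (ZMod p) F] (x : F) : ℂ :=
  ZMod.stdAddChar (Algebra.trace (ZMod p) F x)

section
set_option linter.unusedSectionVars false
variable (p : ℕ) [Fact p.Prime] (F : Type) [Field F] [Fintype F] [Algebra (ZMod p) F]

lemma EE_add (x y : F) : EE p F (x + y) = EE p F x * EE p F y := by
  simp [EE, AddChar.map_add_eq_mul]

lemma trace_smul' (y : ZMod p) (x : F) : Algebra.trace (ZMod p) F (algebraMap (ZMod p) F y * x)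
    = y * Algebra.trace (ZMod p) F x := by
  rw [← Algebra.smul_def, map_smul, smul_eq_mul]

lemma trace_nd {a : F} (ha : a ≠ 0) : ∃ b : F, Algebra.trace (ZMod p) F (a * b) ≠ 0 := by
  have : Algebra.IsSeparable (ZMod p) F := inferInstance
  have htr := (traceForm_nondegenerate (ZMod p) F).1 a
  simp_rw [Algebra.traceForm_apply] at htr
  by_contra! hf
  exact ha (htr hf)

lemma sumEE [DecidableEq F] (b : F) :
    ∑ x : F, EE p F (b * x) = if b = 0 then (Fintype.card F : ℂ) else 0 := by
  split_ifs with h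
  · simp [h, EE]
  · let φ : AddChar F ℂ := (ZMod.stdAddChar (N := p)).compAddMonoidHom
      ((Algebra.trace (ZMod p) F).toAddMonoidHom.comp (AddMonoidHom.mulLeft b))
    have hφ : φ ≠ 1 := by
      rw [AddChar.ne_one_iff]
      obtain ⟨c, hc⟩ := trace_nd p F h
      refine ⟨c, fun h1 => hc ?_⟩
      have h2 : (ZMod.stdAddChar (Algebra.trace (ZMod p) F (b * c)) : ℂ) = 1 := h1
      rwa [← (ZMod.stdAddChar (N := p)).map_zero_eq_one, ZMod.injective_stdAddChar.eq_iff] at h2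
    exact AddChar.sum_eq_zero_of_ne_one hφ

/-- quadratic Gauss sum -/
noncomputable def GG (a : F) : ℂ := ∑ x : F, EE p F (a * x ^ 2)

lemma GG_sq (h2 : (2 : F) ≠ 0) (i : F) (hi : i ^ 2 = -1) (a : F) (ha : a ≠ 0) :
    GG p F a ^ 2 = Fintype.card F := by
  classical
  have hi0 : i ≠ 0 := by rintro rfl; simp at hi
  have hinj : Function.Injective (fun q : F × F => (q.1 + i * q.2, q.1 - i * q.2)) := by
    rintro ⟨x, y⟩ ⟨x', y'⟩ h
    simp only [Prod.mk.injEq] at h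
    have e1 : 2 * x = 2 * x' := by linear_combination h.1 + h.2
    have e2 : 2 * i * y = 2 * i * y' := by linear_combination h.1 - h.2
    exact Prod.ext (mul_left_cancel₀ h2 e1) (mul_left_cancel₀ (mul_ne_zero h2 hi0) e2)
  have hbij := Finite.injective_iff_bijective.1 hinj
  calc GG p F a ^ 2 = ∑ q : F × F, EE p F (a * (q.1 + i * q.2) * (q.1 - i * q.2)) := by
        rw [sq, GG, Finset.sum_mul_sum, Fintype.sum_prod_type]
        refine Finset.sum_congr rfl fun x _ => Finset.sum_congr rfl fun y _ => ?_
        rw [← EE_add]; congr 1; linear_combination (a * y ^ 2) * hi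
    _ = ∑ q : F × F, EE p F (a * q.1 * q.2) :=
        Fintype.sum_bijective _ hbij _ _ (fun _ => rfl)
    _ = Fintype.card F := by
        rw [Fintype.sum_prod_type]
        simp_rw [sumEE]
        simp [ha]

lemma GG_mul_sq (a s : F) (hs : s ≠ 0) : GG p F (s ^ 2 * a) = GG p F a := by
  refine Fintype.sum_bijective (fun x => s * x) (mulLeft_bijective₀ s hs) _ _ fun x => ?_
  congr 1; ring

lemma GG_quad (h2 : (2 : F) ≠ 0) (a b : F) (ha : a ≠ 0) :
    ∑ x : F, EE p F (a * x ^ 2 + b * x) = EE p F (-(b ^ 2 / (4 * a))) * GG p F a := by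
  rw [GG, Finset.mul_sum]
  refine Fintype.sum_bijective (fun x => x + b / (2 * a)) (AddGroup.addRight_bijective _)
    _ _ fun x => ?_
  rw [← EE_add]; congr 1
  have h4 : (4 : F) ≠ 0 := by
    have : (4 : F) = 2 * 2 := by norm_num
    rw [this]; exact mul_ne_zero h2 h2
  have : (4 : F) = 2 * 2 := by norm_num
  rw [this]
  field_simp
  ring

lemma inner_chsum [DecidableEq (ZMod p)] (h2 : (2 : ZMod p) ≠ 0) (T : ZMod p) :
    ∑ y ∈ (Finset.univ : Finset (ZMod p)).erase 0, ∑ z : ZMod p,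
      (ZMod.stdAddChar (-z) * ZMod.stdAddChar (-(z ^ 2 / (4 * y)) * T) : ℂ)
      = if T = 0 then 0 else (p : ℂ) := by
  have h0 : ∑ z : ZMod p, (ZMod.stdAddChar (-z) : ℂ) = 0 := by
    have := indP p (-1)
    simpa using this
  split_ifs with hT
  · subst hT
    simp [h0]
  · have h4 : (4 : ZMod p) ≠ 0 := by
      have : (4 : ZMod p) = 2 * 2 := by norm_num
      rw [this]; exact mul_ne_zero h2 h2
    have step : ∑ y ∈ (Finset.univ : Finset (ZMod p)).erase 0, ∑ z : ZMod p,
      (ZMod.stdAddChar (-z) * ZMod.stdAddChar (-(z ^ 2 / (4 * y)) * T) : ℂ)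
      = ∑ u ∈ (Finset.univ : Finset (ZMod p)).erase 0, ∑ z : ZMod p,
      (ZMod.stdAddChar (-z) * ZMod.stdAddChar (u * z ^ 2) : ℂ) := by
      refine Finset.sum_nbij' (fun y => - T / (4 * y)) (fun u => - T / (4 * u)) ?_ ?_ ?_ ?_ ?_
      · intro y hy; simp at hy ⊢; exact ⟨hT, h4, hy⟩
      · intro y hy; simp at hy ⊢; exact ⟨hT, h4, hy⟩
      · intro y hy; simp at hy; field_simp
      · intro y hy; simp at hy; field_simp
      · intro y hy; simp at hy
        refine Finset.sum_congr rfl fun z _ => ?_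
        congr 2; field_simp
    rw [step, Finset.sum_comm]
    have e : ∀ z : ZMod p, ∑ u ∈ (Finset.univ : Finset (ZMod p)).erase 0,
        (ZMod.stdAddChar (-z) * ZMod.stdAddChar (u * z ^ 2) : ℂ)
        = (if z = 0 then (p : ℂ) else 0) - ZMod.stdAddChar (-z) := by
      intro z
      rw [← Finset.mul_sum]
      have h := indP p (z ^ 2)
      rw [← Finset.add_sum_erase _ _ (Finset.mem_univ 0)] at h
      simp only [zero_mul, AddChar.map_zero_eq_one] at h
      rw [← eq_sub_iff_add_eq'] at h
      rw [h]
      by_cases hz : z = 0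
      · simp [hz]
      · simp [hz]
    simp_rw [e]
    rw [Finset.sum_sub_distrib, h0]
    simp

/-- number of trace-one solutions -/
noncomputable def NN (a : F) : ℕ :=
  Set.ncard {x : F | Algebra.trace (ZMod p) F x = 1 ∧ Algebra.trace (ZMod p) F (a * x ^ 2) = 0}

open Classical in
lemma NN_formula (h2 : (2 : ZMod p) ≠ 0) (hsq : ∀ y : ZMod p, IsSquare (algebraMap (ZMod p) F y))
    (a : F) (ha : a ≠ 0) :
    (p : ℂ) ^ 2 * NN p F a = Fintype.card F +
      (if Algebra.trace (ZMod p) F a⁻¹ = 0 then 0 else (p : ℂ)) * GG p F a := by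
  have h2F : (2 : F) ≠ 0 := by
    have := (map_ne_zero (algebraMap (ZMod p) F)).2 h2
    rwa [map_ofNat] at this
  have h4F : (4 : F) ≠ 0 := by
    have : (4 : F) = 2 * 2 := by norm_num
    rw [this]; exact mul_ne_zero h2F h2F
  have hN : (NN p F a : ℂ) = ∑ x : F, if (Algebra.trace (ZMod p) F x = 1 ∧
      Algebra.trace (ZMod p) F (a * x ^ 2) = 0) then (1 : ℂ) else 0 := by
    rw [Finset.sum_boole, NN, Set.ncard_eq_toFinset_card']
    simp
  rw [hN, Finset.mul_sum]
  have e1 : ∀ x : F, (p : ℂ) ^ 2 * (if (Algebra.trace (ZMod p) F x = 1 ∧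
      Algebra.trace (ZMod p) F (a * x ^ 2) = 0) then (1 : ℂ) else 0)
      = ∑ y : ZMod p, ∑ z : ZMod p, ZMod.stdAddChar (-z) *
        EE p F (algebraMap (ZMod p) F y * a * x ^ 2 + algebraMap (ZMod p) F z * x) := by
    intro x
    trans (∑ y : ZMod p, (ZMod.stdAddChar (y * Algebra.trace (ZMod p) F (a * x ^ 2)) : ℂ)) *
      (∑ z : ZMod p, (ZMod.stdAddChar (z * (Algebra.trace (ZMod p) F x - 1)) : ℂ))
    · rw [indP, indP]
      simp only [sub_eq_zero]
      split_ifs <;> first | tauto | simp [sq]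
    · rw [Finset.sum_mul_sum]
      refine Finset.sum_congr rfl fun y _ => Finset.sum_congr rfl fun z _ => ?_
      rw [EE, ← AddChar.map_add_eq_mul, ← AddChar.map_add_eq_mul, (Algebra.trace (ZMod p) F).map_add, mul_assoc, trace_smul',
        trace_smul']
      congr 1; ring
  rw [Finset.sum_congr rfl fun x _ => e1 x, Finset.sum_comm]
  simp_rw [Finset.sum_comm (s := (Finset.univ : Finset F)), ← Finset.mul_sum]
  rw [← Finset.add_sum_erase _ _ (Finset.mem_univ 0)]
  congr 1
  · simp only [map_zero, zero_mul, zero_add, sumEE]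
    simp
  · rw [← inner_chsum p h2, Finset.sum_mul]
    refine Finset.sum_congr rfl fun y hy => ?_
    rw [Finset.sum_mul]
    refine Finset.sum_congr rfl fun z _ => ?_
    have hy0 : y ≠ 0 := by simpa using hy
    have hy1 : algebraMap (ZMod p) F y ≠ 0 := by simpa using hy0
    rw [GG_quad p F h2F _ _ (mul_ne_zero hy1 ha), mul_assoc]
    congr 1
    obtain ⟨s, hs⟩ := hsq y
    have hs0 : s ≠ 0 := by rintro rfl; simp at hs; exact hy0 hs
    have : GG p F (algebraMap (ZMod p) F y * a) = GG p F a := by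
      rw [hs, ← sq, GG_mul_sq p F a s hs0]
    rw [this, EE, ← trace_smul']
    congr 4
    simp only [map_neg, map_div₀, map_mul, map_pow, map_ofNat]
    field_simp

end
section
set_option linter.unusedSectionVars false
variable (p : ℕ) [Fact p.Prime] (F : Type) [Field F] [Fintype F] [Algebra (ZMod p) F]

lemma fibre_card (b : F) (hb : b ≠ 0) (c : ZMod p) :
    p * Set.ncard {x : F | Algebra.trace (ZMod p) F (b * x) = c} = Fintype.card F := by
  classical
  have : (p : ℂ) * Set.ncard {x : F | Algebra.trace (ZMod p) F (b * x) = c} = Fintype.card F := by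
    have hN : (Set.ncard {x : F | Algebra.trace (ZMod p) F (b * x) = c} : ℂ) =
        ∑ x : F, if Algebra.trace (ZMod p) F (b * x) = c then (1 : ℂ) else 0 := by
      rw [Finset.sum_boole, Set.ncard_eq_toFinset_card']
      simp
    rw [hN, Finset.mul_sum]
    have e1 : ∀ x : F, (p : ℂ) * (if Algebra.trace (ZMod p) F (b * x) = c then (1 : ℂ) else 0)
        = ∑ z : ZMod p, ZMod.stdAddChar (-(z * c)) * EE p F (algebraMap (ZMod p) F z * b * x) := by
      intro x
      trans ∑ z : ZMod p, (ZMod.stdAddChar (z * (Algebra.trace (ZMod p) F (b * x) - c)) : ℂ)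
      · rw [indP]
        simp only [sub_eq_zero]
        split_ifs <;> simp
      · refine Finset.sum_congr rfl fun z _ => ?_
        rw [EE, ← AddChar.map_add_eq_mul, mul_assoc, trace_smul']
        congr 1; ring
    rw [Finset.sum_congr rfl fun x _ => e1 x, Finset.sum_comm]
    simp_rw [← Finset.mul_sum, sumEE]
    simp [hb]
  exact_mod_cast this

lemma isSq_all (hp2 : p ≠ 2) (m : ℕ) (hme : Even m)
    (hcard : Fintype.card F = p ^ m) (y : ZMod p) : IsSquare (algebraMap (ZMod p) F y) := by
  by_cases hy : y = 0
  · simp [hy]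
  have hpr : p.Prime := Fact.out
  have : CharP F p := charP_of_injective_algebraMap (algebraMap (ZMod p) F).injective p
  have hr : ringChar F ≠ 2 := by rw [ringChar.eq F p]; exact hp2
  rw [FiniteField.isSquare_iff hr (by simpa using hy), hcard, ← map_pow]
  obtain ⟨n, rfl⟩ := hme
  have hodd : Odd p := hpr.odd_of_ne_two hp2
  obtain ⟨u, hu⟩ : Odd (p ^ n) := hodd.pow
  obtain ⟨v, hv⟩ : p - 1 ∣ p ^ n - 1 := by simpa using Nat.sub_dvd_pow_sub_pow p 1 n
  have : p ^ (n + n) / 2 = (p - 1) * (v * (u + 1)) := by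
    rw [← mul_assoc, ← hv, pow_add, hu]
    have : (2 * u + 1) * (2 * u + 1) = 2 * (2 * u * (u + 1)) + 1 := by ring
    rw [this]; simp; omega
  rw [this, pow_mul, ZMod.pow_card_sub_one_eq_one hy]; simp

lemma two_ne (hp2 : p ≠ 2) : (2 : ZMod p) ≠ 0 := by
  have hpr : p.Prime := Fact.out
  have := (ZMod.natCast_eq_zero_iff 2 p).not.2
    (fun h => hp2 ((Nat.prime_dvd_prime_iff_eq hpr Nat.prime_two).1 h))
  simpa using this

lemma NN_vals (hp2 : p ≠ 2) (k : ℕ) (hcard : Fintype.card F = p ^ (2 * k + 2)) (a : F)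
    (ha : a ≠ 0) :
    (Algebra.trace (ZMod p) F a⁻¹ = 0 → NN p F a = p ^ (2 * k)) ∧
    (Algebra.trace (ZMod p) F a⁻¹ ≠ 0 →
      NN p F a = p ^ (2 * k) + p ^ k ∨ NN p F a + p ^ k = p ^ (2 * k)) := by
  have hpr : p.Prime := Fact.out
  have hp0 : (p : ℂ) ≠ 0 := by exact_mod_cast hpr.ne_zero
  have hsq := isSq_all p F hp2 (2 * k + 2) ⟨k + 1, by ring⟩ hcard
  have h2 := two_ne p hp2
  have hf := NN_formula p F h2 hsq a ha
  have h2F : (2 : F) ≠ 0 := by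
    have := (map_ne_zero (algebraMap (ZMod p) F)).2 h2
    rwa [map_ofNat] at this
  obtain ⟨i, hi⟩ := hsq (-1)
  have hG := GG_sq p F h2F i (by rw [sq, ← hi]; simp) a ha
  rw [hcard] at hf hG
  push_cast at hf hG
  constructor
  · intro hT
    rw [if_pos hT] at hf
    have : (NN p F a : ℂ) = p ^ (2 * k) := by
      apply mul_left_cancel₀ (pow_ne_zero 2 hp0)
      rw [hf]; ring
    exact_mod_cast this
  · intro hT
    rw [if_neg hT] at hf
    have hG' : GG p F a = p ^ (k + 1) ∨ GG p F a = - p ^ (k + 1) := by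
      apply sq_eq_sq_iff_eq_or_eq_neg.1
      rw [hG]; ring
    rcases hG' with h | h
    · left
      have : (NN p F a : ℂ) = p ^ (2 * k) + p ^ k := by
        apply mul_left_cancel₀ (pow_ne_zero 2 hp0)
        rw [hf, h]; ring
      exact_mod_cast this
    · right
      have : (NN p F a : ℂ) + p ^ k = p ^ (2 * k) := by
        apply mul_left_cancel₀ (pow_ne_zero 2 hp0)
        rw [mul_add, hf, h]; ring
      exact_mod_cast this

lemma fibre_card' (k : ℕ) (hcard : Fintype.card F = p ^ (2 * k + 2)) (b : F) (hb : b ≠ 0)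
    (c : ZMod p) : Set.ncard {x : F | Algebra.trace (ZMod p) F (b * x) = c} = p ^ (2 * k + 1) := by
  have hpr : p.Prime := Fact.out
  have := fibre_card p F b hb c
  rw [hcard, pow_succ' p (2 * k + 1)] at this
  exact Nat.eq_of_mul_eq_mul_left hpr.pos this

lemma NN_zero (k : ℕ) (hcard : Fintype.card F = p ^ (2 * k + 2)) :
    NN p F 0 = p ^ (2 * k + 1) := by
  rw [← fibre_card' p F k hcard 1 one_ne_zero 1, NN]
  simp

lemma NN_sum (k : ℕ) (hcard : Fintype.card F = p ^ (2 * k + 2)) :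
    ∑ a : F, NN p F a = p ^ (2 * k + 1) * p ^ (2 * k + 1) := by
  classical
  have h1 : ∀ a : F, NN p F a = ∑ x : F, if (Algebra.trace (ZMod p) F x = 1 ∧
      Algebra.trace (ZMod p) F (a * x ^ 2) = 0) then 1 else 0 := by
    intro a
    rw [Finset.sum_boole, NN, Set.ncard_eq_toFinset_card']
    simp
  simp_rw [h1]
  rw [Finset.sum_comm]
  have h2 : ∀ x : F, (∑ a : F, if (Algebra.trace (ZMod p) F x = 1 ∧
      Algebra.trace (ZMod p) F (a * x ^ 2) = 0) then 1 else 0)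
      = (if Algebra.trace (ZMod p) F x = 1 then 1 else 0) * p ^ (2 * k + 1) := by
    intro x
    by_cases hx : Algebra.trace (ZMod p) F x = 1
    · have hx0 : x ≠ 0 := by rintro rfl; simp at hx
      rw [← fibre_card' p F k hcard (x ^ 2) (pow_ne_zero 2 hx0) 0, Set.ncard_eq_toFinset_card']
      simp [hx, mul_comm]
    · simp [hx]
  simp_rw [h2]
  rw [← Finset.sum_mul]
  congr 1
  rw [← fibre_card' p F k hcard 1 one_ne_zero 1, Set.ncard_eq_toFinset_card']
  simp

lemma card_T0 (k : ℕ) (hcard : Fintype.card F = p ^ (2 * k + 2)) :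
    Set.ncard {a : F | a ≠ 0 ∧ Algebra.trace (ZMod p) F a⁻¹ = 0} = p ^ (2 * k + 1) - 1 := by
  rw [← fibre_card' p F k hcard 1 one_ne_zero 0]
  rw [← Set.ncard_sdiff_singleton_of_mem (a := (0 : F)) (by simp)]
  refine Set.ncard_congr (fun a _ => a⁻¹) ?_ ?_ ?_
  · rintro a ⟨h0, h⟩; simp [h0, h]
  · intro a b _ _ h; exact inv_injective h
  · rintro b ⟨hb, hb0⟩
    refine ⟨b⁻¹, ⟨?_, ?_⟩, by simp⟩
    · simpa using hb0
    · simpa using hb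

lemma transfer (Dt : Set F) (hDt0 : ∀ d ∈ Dt, d ≠ (0 : F))
    (hcover : {x : F | x ≠ 0 ∧ IsSquare (Algebra.trace (ZMod p) F x) ∧
        Algebra.trace (ZMod p) F x ≠ 0}
      = {x : F | ∃ y : ZMod p, (IsSquare y ∧ y ≠ 0) ∧
          ∃ d ∈ Dt, x = algebraMap (ZMod p) F y * d})
    (hdistinct : ∀ d ∈ Dt, ∀ d' ∈ Dt, d ≠ d' →
      ¬ ∃ y : ZMod p, (IsSquare y ∧ y ≠ 0) ∧ d / d' = algebraMap (ZMod p) F y)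
    (P : F → Prop) (hP : ∀ y : ZMod p, y ≠ 0 → ∀ x, P (algebraMap (ZMod p) F y * x) ↔ P x) :
    Set.ncard {x | x ∈ Dt ∧ P x} =
      Set.ncard {x : F | Algebra.trace (ZMod p) F x = 1 ∧ P x} := by
  have hD : ∀ d ∈ Dt, IsSquare (Algebra.trace (ZMod p) F d) ∧ Algebra.trace (ZMod p) F d ≠ 0 := by
    intro d hd
    have : d ∈ {x : F | x ≠ 0 ∧ IsSquare (Algebra.trace (ZMod p) F x) ∧
        Algebra.trace (ZMod p) F x ≠ 0} := by
      rw [hcover]; exact ⟨1, ⟨⟨1, by simp⟩, one_ne_zero⟩, d, hd, by simp⟩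
    exact this.2
  refine Set.ncard_congr
    (fun d _ => algebraMap (ZMod p) F (Algebra.trace (ZMod p) F d)⁻¹ * d) ?_ ?_ ?_
  · rintro d ⟨hd, h⟩
    have := (hD d hd).2
    refine ⟨?_, (hP _ (inv_ne_zero this) d).2 h⟩
    rw [trace_smul', inv_mul_cancel₀ this]
  · rintro d d' ⟨hd, h⟩ ⟨hd', h'⟩ heq
    by_contra hne
    apply hdistinct d hd d' hd' hne
    have t := hD d hd
    have t' := hD d' hd'
    refine ⟨Algebra.trace (ZMod p) F d / Algebra.trace (ZMod p) F d',
      ⟨t.1.div t'.1, div_ne_zero t.2 t'.2⟩, ?_⟩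
    have a1 : algebraMap (ZMod p) F (Algebra.trace (ZMod p) F d) ≠ 0 := by simpa using t.2
    have a2 : algebraMap (ZMod p) F (Algebra.trace (ZMod p) F d') ≠ 0 := by simpa using t'.2
    have a3 := hDt0 d' hd'
    simp only [map_inv₀] at heq
    rw [map_div₀]
    field_simp at heq ⊢
    linear_combination heq
  · rintro x ⟨hx, hPx⟩
    have hx0 : x ≠ 0 := by rintro rfl; simp at hx
    have : x ∈ {x : F | x ≠ 0 ∧ IsSquare (Algebra.trace (ZMod p) F x) ∧
        Algebra.trace (ZMod p) F x ≠ 0} := ⟨hx0, by simp [hx], by simp [hx]⟩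
    rw [hcover] at this
    obtain ⟨y, ⟨hy, hy0⟩, d, hd, rfl⟩ := this
    refine ⟨d, ⟨hd, (hP y hy0 d).1 hPx⟩, ?_⟩
    rw [trace_smul'] at hx
    rw [← eq_inv_of_mul_eq_one_left hx]

end
/-- `m` even.  If `D̃ ⊆ F_r^*` satisfies `D = Sq·D̃` with `d/d' ∉ Sq` for
distinct `d, d' ∈ D̃`, then `|D̃| = p^{m-1}`, the punctured code `C_{D̃}` has the stated
weight distribution, no other weight occurs, and `C_{D̃}` has `p^m` codewords (so it is a
`[p^{m-1}, m]` three-weight linear code). -/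
theorem stmt_9 (p m : ℕ) [Fact p.Prime] (hp2 : p ≠ 2) (hm : 2 ≤ m) (hme : Even m)
    (F : Type) [Field F] [Fintype F] [Algebra (ZMod p) F]
    (hcard : Fintype.card F = p ^ m)
    (Dt : Set F) (hDt0 : ∀ d ∈ Dt, d ≠ (0 : F))
    (hcover : {x : F | x ≠ 0 ∧ IsSquare (Algebra.trace (ZMod p) F x) ∧
        Algebra.trace (ZMod p) F x ≠ 0}
      = {x : F | ∃ y : ZMod p, (IsSquare y ∧ y ≠ 0) ∧
          ∃ d ∈ Dt, x = algebraMap (ZMod p) F y * d})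
    (hdistinct : ∀ d ∈ Dt, ∀ d' ∈ Dt, d ≠ d' →
      ¬ ∃ y : ZMod p, (IsSquare y ∧ y ≠ 0) ∧ d / d' = algebraMap (ZMod p) F y) :
    Set.ncard Dt = p ^ (m - 1) ∧
    Set.ncard {a : F | wtT p F Dt a = (p - 1) * p ^ (m - 2)} = p ^ (m - 1) - 1 ∧
    Set.ncard {a : F | wtT p F Dt a = (p - 1) * p ^ (m - 2) + p ^ ((m - 2) / 2)}
      = (p - 1) / 2 * (p ^ (m - 1) + p ^ ((m - 2) / 2)) ∧
    Set.ncard {a : F | wtT p F Dt a = (p - 1) * p ^ (m - 2) - p ^ ((m - 2) / 2)}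
      = (p - 1) / 2 * (p ^ (m - 1) - p ^ ((m - 2) / 2)) ∧
    Set.ncard {a : F | wtT p F Dt a = 0} = 1 ∧
    (∀ a : F, wtT p F Dt a = 0 ∨
      wtT p F Dt a = (p - 1) * p ^ (m - 2) ∨
      wtT p F Dt a = (p - 1) * p ^ (m - 2) + p ^ ((m - 2) / 2) ∨
      wtT p F Dt a = (p - 1) * p ^ (m - 2) - p ^ ((m - 2) / 2)) ∧
    Set.ncard (Set.range (fun a : F => fun x : Dt =>
      Algebra.trace (ZMod p) F (a * (x : F) ^ 2))) = p ^ m := by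
  classical
  obtain ⟨k, rfl⟩ : ∃ k, m = 2 * k + 2 := by
    obtain ⟨n, rfl⟩ := hme
    exact ⟨n - 1, by omega⟩
  have hpr : p.Prime := Fact.out
  have hp3 : 3 ≤ p := by have := hpr.two_le; omega
  obtain ⟨t, ht⟩ : Odd p := hpr.odd_of_ne_two hp2
  have e1 : 2 * k + 2 - 1 = 2 * k + 1 := by omega
  have e2 : 2 * k + 2 - 2 = 2 * k := by omega
  have e3 : 2 * k / 2 = k := by omega
  rw [e1, e2, e3]
  have hH : Set.ncard {x : F | Algebra.trace (ZMod p) F x = 1} = p ^ (2 * k + 1) := by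
    have := fibre_card' p F k hcard 1 one_ne_zero 1
    simpa using this
  have hDcard : Set.ncard Dt = p ^ (2 * k + 1) := by
    have := transfer p F Dt hDt0 hcover hdistinct (fun _ => True) (by simp)
    simp only [and_true, Set.ofPred_mem_eq] at this
    rw [this, hH]
  have hwt : ∀ a, wtT p F Dt a + NN p F a = p ^ (2 * k + 1) := by
    intro a
    have h := transfer p F Dt hDt0 hcover hdistinct
      (fun x => Algebra.trace (ZMod p) F (a * x ^ 2) ≠ 0) (by
        intro y hy x
        have : a * (algebraMap (ZMod p) F y * x) ^ 2 = algebraMap (ZMod p) F (y ^ 2) * (a * x ^ 2) := by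
          rw [map_pow]; ring
        rw [this, trace_smul']
        simp [hy])
    rw [wtT, h, NN, ← hH, ← Set.ncard_union_eq]
    · congr 1
      ext x
      simp only [Set.mem_union, Set.mem_ofPred_eq]
      tauto
    · rw [Set.disjoint_left]
      rintro x ⟨_, h1⟩ ⟨_, h2⟩
      exact h1 h2
  have hN0 := NN_zero p F k hcard
  have hNs := NN_sum p F k hcard
  have hT0 := card_T0 p F k hcard
  have hv := NN_vals p F hp2 k hcard
  have hq : 0 < p ^ k := pow_pos hpr.pos k
  have hPq : p ^ (2 * k) = p ^ k * p ^ k := by rw [two_mul, pow_add]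
  have hP1 : p ^ (2 * k + 1) = p * p ^ (2 * k) := pow_succ' _ _
  have hP2 : p ^ (2 * k + 2) = p * (p * p ^ (2 * k)) := by ring
  have hle : p ^ k ≤ p ^ (2 * k) := by rw [hPq]; exact Nat.le_mul_of_pos_left _ hq
  have h3P : 3 * p ^ (2 * k) ≤ p * p ^ (2 * k) := Nat.mul_le_mul_right _ hp3
  have hsub : (p - 1) * p ^ (2 * k) = p * p ^ (2 * k) - p ^ (2 * k) := by
    rw [Nat.sub_mul, one_mul]
  have ht2 : (p - 1) / 2 = t := by omega
  rw [ht2]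
  rw [hP1] at hN0 hNs hT0 hwt hDcard ⊢
  rw [hP2] at hcard ⊢
  rw [hsub]
  generalize hPP : p ^ (2 * k) = P at *
  generalize hqq : p ^ k = q at *
  generalize hR : p * P = R at *
  have hcl : ∀ a, a = 0 ∨ NN p F a = P ∨ NN p F a = P + q ∨ NN p F a + q = P := by
    intro a
    by_cases ha : a = 0
    · exact Or.inl ha
    · by_cases hT : Algebra.trace (ZMod p) F a⁻¹ = 0
      · exact Or.inr (Or.inl ((hv a ha).1 hT))
      · exact Or.inr (Or.inr ((hv a ha).2 hT))
  have hz : ∀ a, wtT p F Dt a = 0 ↔ a = 0 := by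
    intro a
    constructor
    · intro h
      have := hwt a
      rcases hcl a with h' | h' | h' | h'
      · exact h'
      all_goals omega
    · rintro rfl
      have := hwt 0
      omega
  have s0 : {a : F | wtT p F Dt a = R - P} =
      {a : F | a ≠ 0 ∧ Algebra.trace (ZMod p) F a⁻¹ = 0} := by
    ext a
    simp only [Set.mem_ofPred_eq]
    have := hwt a
    constructor
    · intro h
      have ha : a ≠ 0 := by
        rintro rfl
        omega
      refine ⟨ha, ?_⟩
      by_contra hT
      rcases (hv a ha).2 hT with h' | h' <;> omega
    · rintro ⟨ha, hT⟩
      have := (hv a ha).1 hT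
      omega
  have sp : {a : F | wtT p F Dt a = R - P - q} = {a : F | NN p F a = P + q} := by
    ext a
    simp only [Set.mem_ofPred_eq]
    have := hwt a
    omega
  have sm : {a : F | wtT p F Dt a = R - P + q} = {a : F | NN p F a + q = P} := by
    ext a
    simp only [Set.mem_ofPred_eq]
    have := hwt a
    omega
  have s0' : {a : F | wtT p F Dt a = R - P} = {a : F | NN p F a = P} := by
    ext a
    simp only [Set.mem_ofPred_eq]
    have := hwt a
    omega
  have c0 : (Finset.univ.filter fun a : F => NN p F a = P).card = R - 1 := by
    rw [← hT0, ← s0, s0', Set.ncard_eq_toFinset_card']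
    simp
  have hcnt1 : ∀ a : F, (1 : ℤ) = (if a = 0 then 1 else 0) + (if NN p F a = P then 1 else 0)
      + (if NN p F a = P + q then 1 else 0) + (if NN p F a + q = P then 1 else 0) := by
    intro a
    rcases hcl a with h' | h' | h' | h'
    · subst h'
      rw [if_pos rfl, if_neg (by omega), if_neg (by omega), if_neg (by omega)]; simp
    all_goals
      have ha : a ≠ 0 := by
        rintro rfl
        omega
      rw [if_neg ha]
      split_ifs <;> omega
  have hcnt2 : ∀ a : F, (NN p F a : ℤ) = P + (R - P) * (if a = 0 then 1 else 0)
      + q * (if NN p F a = P + q then 1 else 0) - q * (if NN p F a + q = P then 1 else 0) := by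
    intro a
    rcases hcl a with h' | h' | h' | h'
    · subst h'
      rw [if_pos rfl, if_neg (by omega), if_neg (by omega)]; rw [hN0]; ring
    all_goals
      have ha : a ≠ 0 := by
        rintro rfl
        omega
      rw [if_neg ha]
      split_ifs <;> omega
  have hS1 := Finset.sum_congr rfl (fun a (_ : a ∈ (Finset.univ : Finset F)) => hcnt1 a)
  have hS2 := Finset.sum_congr rfl (fun a (_ : a ∈ (Finset.univ : Finset F)) => hcnt2 a)
  simp only [Finset.sum_add_distrib, Finset.sum_sub_distrib, ← Finset.mul_sum, Finset.sum_boole,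
    c0, Finset.sum_const, Finset.card_univ, hcard, ← Nat.cast_sum, hNs] at hS1 hS2
  rw [Finset.filter_eq' Finset.univ (0 : F)] at hS1 hS2
  simp only [Finset.mem_univ, if_true, Finset.card_singleton] at hS1 hS2
  have hRpos : 1 ≤ R := by omega
  rw [sp, sm, Set.ncard_eq_toFinset_card', Set.ncard_eq_toFinset_card' {a : F | NN p F a = P + q},
    Set.ncard_eq_toFinset_card' {a : F | NN p F a + q = P}]
  rw [← Set.ncard_eq_toFinset_card', s0, hT0]
  simp only [Set.toFinset_ofPred]
  generalize (Finset.univ.filter fun a : F => NN p F a = P + q).card = A at *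
  generalize (Finset.univ.filter fun a : F => NN p F a + q = P).card = B at *
  have hqR : q ≤ R := by omega
  push_cast [Nat.cast_sub hRpos] at hS1 hS2
  simp only [nsmul_eq_mul, mul_one] at hS1 hS2
  push_cast at hS1 hS2
  have htz : (p : ℤ) = 2 * t + 1 := by exact_mod_cast ht
  have hRz : (R : ℤ) = p * P := by rw [← hR]; push_cast; ring
  have hPz : (P : ℤ) = q * q := by rw [hPq]; push_cast; ring
  have hq0 : (q : ℤ) ≠ 0 := by exact_mod_cast hq.ne'
  have hdiff : (B : ℤ) - A = 2 * t * q := by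
    apply mul_left_cancel₀ hq0
    rw [hRz, htz, hPz] at hS2
    linear_combination hS2
  have hsum : (A : ℤ) + B = 2 * t * R := by
    rw [htz] at hS1
    linear_combination -hS1
  refine ⟨hDcard, trivial, ?_, ?_, ?_, ?_, ?_⟩
  · have : (B : ℤ) = t * (R + q) := by linarith
    exact_mod_cast this
  · zify [hqR]
    linarith
  · have : {a : F | wtT p F Dt a = 0} = {0} := by
      ext a; simp [hz]
    rw [this, Set.ncard_singleton]
  · intro a
    have := hwt a
    rcases hcl a with h' | h' | h' | h'
    · exact Or.inl ((hz a).2 h')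
    all_goals omega
  · rw [← Set.image_univ, Set.ncard_image_of_injective, Set.ncard_univ, Nat.card_eq_fintype_card,
      hcard]
    intro a b hab
    rw [← sub_eq_zero, ← hz, wtT]
    have : {x : F | x ∈ Dt ∧ Algebra.trace (ZMod p) F ((a - b) * x ^ 2) ≠ 0} = ∅ := by
      rw [Set.eq_empty_iff_forall_notMem]
      rintro x ⟨hx, h⟩
      apply h
      have := congrFun hab ⟨x, hx⟩
      simp only at this
      rw [sub_mul, map_sub, this, sub_self]
    rw [this, Set.ncard_empty]
end

section
/- Suppose m ≥ 3 is odd. Then |D̃| = p^{m−1}, and the weight distribution of the punctured code C_{D̃} is: #{a ∈ F_r : wt̃(a) = (p−1)p^{m−2}} = p^{m−1} − 1; #{a ∈ F_r : wt̃(a) = (p−1)p^{m−2} + p^{(m−3)/2}} = ((p−1)/2)(p^{m−1} + p^{(m−1)/2}); #{a ∈ F_r : wt̃(a) = (p−1)p^{m−2} − p^{(m−3)/2}} = ((p−1)/2)(p^{m−1} − p^{(m−1)/2}); #{a ∈ F_r : wt̃(a) = 0} = 1; and no other weight occurs. In particular C_{D̃} is a [p^{m−1}, m] three-weight linear code. 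-/
section auxlemmas
open Finset

section aux
variable {K : Type} [Field K] [Fintype K] [DecidableEq K]

lemma aux_sqsum (hK : ringChar K ≠ 2) (ψ : AddChar K ℂ) (hψ : ψ.IsPrimitive) {b : K} (hb : b ≠ 0) :
    ∑ x : K, ψ (b * x ^ 2) = ((quadraticChar K b : ℤ) : ℂ) *
      gaussSum ((quadraticChar K).ringHomComp (Int.castRingHom ℂ)) ψ := by
  have h1 : ∑ x : K, ψ (b * x ^ 2) = ∑ t : K, ((quadraticChar K t : ℤ) + 1 : ℂ) * ψ (b * t) := by
    rw [← Finset.sum_fiberwise (s := (Finset.univ : Finset K)) (g := fun x : K => x ^ 2)]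
    refine Finset.sum_congr rfl fun t _ => ?_
    have h2 := quadraticChar_card_sqrts hK t
    have h3 : ((#{x : K | x ^ 2 = t} : ℕ) : ℂ) = ((quadraticChar K t : ℤ) + 1 : ℂ) := by
      rw [Set.toFinset_ofPred] at h2
      exact_mod_cast congrArg (Int.cast : ℤ → ℂ) h2
    rw [← h3, ← nsmul_eq_mul, ← Finset.sum_const]
    refine Finset.sum_congr rfl fun x hx => ?_
    rw [(Finset.mem_filter.1 hx).2]
  have h4 : ∑ t : K, ψ (b * t) = 0 := by
    have := AddChar.sum_mulShift b hψ
    rw [if_neg hb] at this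
    simpa [mul_comm] using this
  have h5 := gaussSum_mulShift ((quadraticChar K).ringHomComp (Int.castRingHom ℂ)) ψ (Units.mk0 b hb)
  have h6 : ((quadraticChar K b : ℤ) : ℂ) * ((quadraticChar K b : ℤ) : ℂ) = 1 := by
    have := quadraticChar_sq_one hb
    rw [← sq]; exact_mod_cast this
  rw [← h5]
  simp only [MulChar.ringHomComp_apply, Units.val_mk0, eq_intCast]
  rw [← mul_assoc, h6, one_mul, h1]
  simp only [add_mul, one_mul, Finset.sum_add_distrib, h4, add_zero, gaussSum,
    MulChar.ringHomComp_apply, eq_intCast, AddChar.mulShift_apply]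

lemma aux_gauss_sq (hK : ringChar K ≠ 2) (ψ : AddChar K ℂ) (hψ : ψ.IsPrimitive) :
    gaussSum ((quadraticChar K).ringHomComp (Int.castRingHom ℂ)) ψ ^ 2
      = ((quadraticChar K (-1) : ℤ) : ℂ) * Fintype.card K := by
  refine gaussSum_sq ?_ ((quadraticChar_isQuadratic K).comp _) hψ
  rw [MulChar.ringHomComp_ne_one_iff (Int.cast_injective)]
  exact quadraticChar_ne_one hK

lemma aux_complete (hK : ringChar K ≠ 2) (ψ : AddChar K ℂ) {b : K} (hb : b ≠ 0) (z : K) :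
    ∑ x : K, ψ (b * x ^ 2 + z * x) = ψ (- z ^ 2 / (4 * b)) * ∑ x : K, ψ (b * x ^ 2) := by
  have h2 : (2 : K) ≠ 0 := Ring.two_ne_zero hK
  have h4 : (4 : K) ≠ 0 := by
    have : (4 : K) = 2 * 2 := by norm_num
    rw [this]; exact mul_ne_zero h2 h2
  rw [Finset.mul_sum, ← Equiv.sum_comp (Equiv.subRight (z / (2 * b)))]
  refine Finset.sum_congr rfl fun x _ => ?_
  rw [← AddChar.map_add_eq_mul]
  congr 1
  simp only [Equiv.subRight_apply]
  field_simp
  ring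
end aux

lemma aux_odd (q k : ℕ) : ∃ S, Odd S ∧ (2 * q + 1) ^ (2 * k + 1) = 2 * (q * S) + 1 := by
  induction k with
  | zero => exact ⟨1, odd_one, by ring⟩
  | succ k ih =>
    obtain ⟨S, hS, h⟩ := ih
    refine ⟨S * (2 * q + 1) ^ 2 + 2 * q + 2, ?_, ?_⟩
    · obtain ⟨s, rfl⟩ := hS
      exact ⟨(s * (2*q+1)^2 + 2*q^2+2*q) + q + 1, by ring⟩
    · have : (2 * q + 1) ^ (2 * (k + 1) + 1) = (2 * q + 1) ^ (2 * k + 1) * (2*q+1)^2 := by ring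
      rw [this, h]; ring

lemma aux_char (p m : ℕ) [Fact p.Prime] (hp2 : p ≠ 2) (hmo : Odd m)
    (F : Type) [Field F] [Fintype F] [DecidableEq F] [Algebra (ZMod p) F]
    (hcard : Fintype.card F = p ^ m) (y : ZMod p) :
    quadraticChar F (algebraMap (ZMod p) F y) = quadraticChar (ZMod p) y := by
  have hF : ringChar F ≠ 2 := by
    rw [← Algebra.ringChar_eq (ZMod p) F, ZMod.ringChar_zmod_n]; exact hp2
  have hZ : ringChar (ZMod p) ≠ 2 := by rw [ZMod.ringChar_zmod_n]; exact hp2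
  by_cases hy : y = 0
  · simp [hy]
  have hy' : algebraMap (ZMod p) F y ≠ 0 := by simpa using hy
  obtain ⟨q, hq⟩ := (Fact.out : p.Prime).odd_of_ne_two hp2
  obtain ⟨k, hk⟩ := hmo
  obtain ⟨S, hS, h⟩ := aux_odd q k
  have h1 : Fintype.card F / 2 = q * S := by rw [hcard, hq, hk, h]; omega
  have h2 : Fintype.card (ZMod p) / 2 = q := by rw [ZMod.card]; omega
  have e1 := quadraticChar_eq_pow_of_char_ne_two' hF (algebraMap (ZMod p) F y)
  have e2 := quadraticChar_eq_pow_of_char_ne_two' hZ y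
  rw [h1, ← map_pow, pow_mul] at e1
  rw [h2] at e2
  rw [← e2] at e1
  rcases quadraticChar_dichotomy hy with h3 | h3 <;> rcases quadraticChar_dichotomy hy' with h4 | h4 <;>
    rw [h3, h4] <;> exfalso <;> rw [h3, h4] at e1 <;> simp [hS.neg_one_pow] at e1
  · exact Ring.neg_one_ne_one_of_char_ne_two hF e1
  · exact Ring.neg_one_ne_one_of_char_ne_two hF e1.symm

/-- number of trace-one `x` with `Tr (a x^2) = 0`. -/
noncomputable def auxN (p : ℕ) [Fact p.Prime] (F : Type) [Field F] [Fintype F] [Algebra (ZMod p) F] (a : F) : ℕ :=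
  #{x : F | Algebra.trace (ZMod p) F x = 1 ∧ Algebra.trace (ZMod p) F (a * x ^ 2) = 0}

lemma aux_main (p m : ℕ) [Fact p.Prime] (hp2 : p ≠ 2) (hmo : Odd m)
    (F : Type) [Field F] [Fintype F] [DecidableEq F] [Algebra (ZMod p) F]
    (hcard : Fintype.card F = p ^ m) (a : F) (ha : a ≠ 0) :
    (Algebra.trace (ZMod p) F a⁻¹ = 0 → (p : ℤ) ^ 2 * auxN p F a = p ^ m) ∧
    (Algebra.trace (ZMod p) F a⁻¹ ≠ 0 → ((p : ℤ) ^ 2 * auxN p F a - p ^ m) ^ 2 = p ^ (m + 1)) := by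
  have hF : ringChar F ≠ 2 := by
    rw [← Algebra.ringChar_eq (ZMod p) F, ZMod.ringChar_zmod_n]; exact hp2
  have hZ : ringChar (ZMod p) ≠ 2 := by rw [ZMod.ringChar_zmod_n]; exact hp2
  set tr := Algebra.trace (ZMod p) F with htr
  set ψ0 : AddChar (ZMod p) ℂ := ZMod.stdAddChar with hψ0
  have P0 : ψ0.IsPrimitive := ZMod.isPrimitive_stdAddChar p
  set ψ : AddChar F ℂ := ψ0.compAddMonoidHom tr.toAddMonoidHom with hψ
  have ψap : ∀ x, ψ x = ψ0 (tr x) := fun x => rfl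
  have P : ψ.IsPrimitive := by
    apply AddChar.IsPrimitive.of_ne_one
    rw [AddChar.ne_one_iff]
    obtain ⟨x, hx⟩ := Algebra.trace_surjective (ZMod p) F 1
    refine ⟨x, ?_⟩
    rw [ψap, htr, hx]
    intro h
    exact one_ne_zero ((P0.zmod_char_eq_one_iff p 1).1 h)
  set G := gaussSum ((quadraticChar F).ringHomComp (Int.castRingHom ℂ)) ψ with hG
  set g := gaussSum ((quadraticChar (ZMod p)).ringHomComp (Int.castRingHom ℂ)) ψ0 with hg
  have trm : ∀ (y : ZMod p) (x : F), tr (algebraMap (ZMod p) F y * x) = y * tr x := by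
    intro y x
    rw [← Algebra.smul_def, map_smul, smul_eq_mul]
  set T : ZMod p → ZMod p → ℂ := fun y z => ψ0 (-z) *
    ∑ x : F, ψ (algebraMap (ZMod p) F y * a * x ^ 2 + algebraMap (ZMod p) F z * x) with hT
  have hN : ((p : ℂ) ^ 2 * auxN p F a) = ∑ y, ∑ z, T y z := by
    have h1 : ∀ x : F, (∑ y : ZMod p, ψ0 (y * tr (a * x ^ 2))) * (∑ z : ZMod p, ψ0 (z * (tr x - 1)))
        = if tr x = 1 ∧ tr (a * x ^ 2) = 0 then (p : ℂ) ^ 2 else 0 := by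
      intro x
      rw [AddChar.sum_mulShift _ P0, AddChar.sum_mulShift _ P0, ZMod.card]
      have h3 : tr x - 1 = 0 ↔ tr x = 1 := sub_eq_zero
      by_cases h1 : tr x = 1 <;> by_cases h2 : tr (a * x ^ 2) = 0 <;> simp [h1, h2, h3, sq]
    have h2 : ((p : ℂ) ^ 2 * auxN p F a) = ∑ x : F,
        (∑ y : ZMod p, ψ0 (y * tr (a * x ^ 2))) * (∑ z : ZMod p, ψ0 (z * (tr x - 1))) := by
      simp_rw [h1]
      rw [← Finset.sum_filter, Finset.sum_const, nsmul_eq_mul, mul_comm]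
      rfl
    rw [h2]
    simp_rw [Finset.sum_mul_sum, hT, Finset.mul_sum]
    rw [Finset.sum_comm]
    refine Finset.sum_congr rfl fun y _ => ?_
    rw [Finset.sum_comm]
    refine Finset.sum_congr rfl fun z _ => ?_
    refine Finset.sum_congr rfl fun x _ => ?_
    rw [ψap, ← AddChar.map_add_eq_mul, ← AddChar.map_add_eq_mul, map_add tr, mul_assoc, trm, trm]
    congr 1
    ring
  have hT0 : ∑ z, T 0 z = (p : ℂ) ^ m := by
    rw [Finset.sum_eq_single 0]
    · simp [hT, hcard]
    · intro z _ hz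
      have : ∑ x : F, ψ (x * algebraMap (ZMod p) F z) = 0 := by
        rw [AddChar.sum_mulShift _ P, if_neg (by simpa using hz)]; simp
      simp only [hT, map_zero, zero_mul, zero_add]
      simp_rw [mul_comm (algebraMap (ZMod p) F z), this, mul_zero]
    · simp
  set c := tr a⁻¹ with hc
  have four : (4 : ZMod p) ≠ 0 := by
    have : (4 : ZMod p) = 2 * 2 := by norm_num
    rw [this]; exact mul_ne_zero (Ring.two_ne_zero hZ) (Ring.two_ne_zero hZ)
  have hTy : ∀ y : ZMod p, y ≠ 0 → ∑ z, T y z =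
      ((quadraticChar (ZMod p) y : ℤ) : ℂ) * ((quadraticChar F a : ℤ) : ℂ) * G *
        ∑ z : ZMod p, ψ0 ((- c / (4 * y)) * z ^ 2 + (-1) * z) := by
    intro y hy
    have hy' : algebraMap (ZMod p) F y ≠ 0 := by simpa using hy
    rw [Finset.mul_sum]
    refine Finset.sum_congr rfl fun z _ => ?_
    simp only [hT]
    rw [aux_complete hF ψ (mul_ne_zero hy' ha), aux_sqsum hF ψ P (mul_ne_zero hy' ha), map_mul,
      aux_char p m hp2 hmo F hcard, ← hG, ψap]
    have : - (algebraMap (ZMod p) F z) ^ 2 / (4 * (algebraMap (ZMod p) F y * a)) =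
        algebraMap (ZMod p) F (- z ^ 2 / (4 * y)) * a⁻¹ := by
      have : (4 : F) = algebraMap (ZMod p) F 4 := (map_ofNat (algebraMap (ZMod p) F) 4).symm
      rw [map_div₀, map_mul, map_neg, map_pow, ← this]
      have : (4 : F) ≠ 0 := by rw [this]; exact (map_ne_zero _).2 four
      field_simp
    rw [this, trm, ← hc, AddChar.map_add_eq_mul]
    have e1 : -c / (4 * y) * z ^ 2 = - z ^ 2 / (4 * y) * c := by ring
    rw [e1, neg_one_mul]
    push_cast
    ring
  have hsplit : ((p : ℂ) ^ 2 * auxN p F a) = p ^ m + ∑ y ∈ univ.erase (0 : ZMod p), ∑ z, T y z := by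
    rw [hN, ← hT0, Finset.add_sum_erase _ (fun y => ∑ z, T y z) (mem_univ _)]
  constructor
  · intro h0
    have : ∑ y ∈ univ.erase (0 : ZMod p), ∑ z, T y z = 0 := by
      refine Finset.sum_eq_zero fun y hy => ?_
      rw [hTy y (Finset.ne_of_mem_erase hy), h0]
      have := AddChar.sum_mulShift (-1 : ZMod p) P0
      rw [if_neg (by simp)] at this
      simp only [neg_zero, zero_div, zero_mul, zero_add]
      simp_rw [mul_comm (-1 : ZMod p), this]
      simp
    rw [this, add_zero] at hsplit
    exact_mod_cast hsplit
  · intro h0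
    have key : ∀ y ∈ univ.erase (0 : ZMod p), ∑ z, T y z =
        ((quadraticChar (ZMod p) (-c) : ℤ) : ℂ) * ((quadraticChar F a : ℤ) : ℂ) * G * g * ψ0 (y * c⁻¹) := by
      intro y hy
      have hy := Finset.ne_of_mem_erase hy
      have hb : - c / (4 * y) ≠ 0 := div_ne_zero (neg_ne_zero.2 h0) (mul_ne_zero four hy)
      rw [hTy y hy, aux_complete hZ ψ0 hb, aux_sqsum hZ ψ0 P0 hb, ← hg]
      have e1 : - (-1) ^ 2 / (4 * (- c / (4 * y))) = y * c⁻¹ := by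
        field_simp
      have e2 : quadraticChar (ZMod p) y * quadraticChar (ZMod p) (- c / (4 * y)) =
          quadraticChar (ZMod p) (-c) := by
        have : -c = y * (- c / (4 * y)) * 2 ^ 2 := by field_simp; norm_num
        conv_rhs => rw [this]
        rw [map_mul, map_mul, quadraticChar_sq_one' (Ring.two_ne_zero hZ), mul_one]
      rw [e1, ← e2]
      push_cast
      ring
    rw [Finset.sum_congr rfl key, ← Finset.mul_sum] at hsplit
    have hs : ∑ y ∈ univ.erase (0 : ZMod p), ψ0 (y * c⁻¹) = -1 := by
      have h1 := AddChar.sum_mulShift (c⁻¹) P0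
      rw [if_neg (inv_ne_zero h0), ← Finset.add_sum_erase _ _ (mem_univ 0)] at h1
      simp only [zero_mul, AddChar.map_zero_eq_one, Nat.cast_zero] at h1
      linear_combination h1
    rw [hs] at hsplit
    have q1 : ((quadraticChar (ZMod p) (-c) : ℤ) : ℂ) ^ 2 = 1 := by
      exact_mod_cast quadraticChar_sq_one (neg_ne_zero.2 h0)
    have q2 : ((quadraticChar F a : ℤ) : ℂ) ^ 2 = 1 := by
      exact_mod_cast quadraticChar_sq_one ha
    have q3 : quadraticChar F (-1) = quadraticChar (ZMod p) (-1) := by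
      have := aux_char p m hp2 hmo F hcard (-1)
      simpa using this
    have q4 : ((quadraticChar (ZMod p) (-1) : ℤ) : ℂ) ^ 2 = 1 := by
      have h := quadraticChar_sq_one (F := ZMod p) (neg_ne_zero.2 one_ne_zero)
      rw [← Int.cast_pow, h, Int.cast_one]
    have G2 := aux_gauss_sq hF ψ P
    have g2 := aux_gauss_sq hZ ψ0 P0
    rw [← hG, hcard, q3] at G2
    rw [← hg, ZMod.card] at g2
    have : ((p : ℂ) ^ 2 * auxN p F a - p ^ m) ^ 2 = p ^ (m + 1) := by
      rw [hsplit]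
      calc _ = ((quadraticChar (ZMod p) (-c) : ℤ) : ℂ) ^ 2 * ((quadraticChar F a : ℤ) : ℂ) ^ 2 *
            G ^ 2 * g ^ 2 := by ring
        _ = ((quadraticChar (ZMod p) (-1) : ℤ) : ℂ) ^ 2 * p ^ (m + 1) := by
          rw [q1, q2, G2, g2]; push_cast; ring
        _ = _ := by rw [q4, one_mul]
    exact_mod_cast this

lemma aux_fiber (p m : ℕ) [Fact p.Prime] (hm : 1 ≤ m)
    (F : Type) [Field F] [Fintype F] [Algebra (ZMod p) F]
    (hcard : Fintype.card F = p ^ m) (f : F →ₗ[ZMod p] ZMod p) (hf : f ≠ 0) (t : ZMod p) :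
    #{x : F | f x = t} = p ^ (m - 1) := by
  have hs : Function.Surjective f := LinearMap.surjective hf
  have h1 : ∀ t, #{x : F | f x = t} = #{x : F | f x = 0} := by
    intro t
    obtain ⟨x0, rfl⟩ := hs t
    refine Finset.card_nbij' (fun x => x - x0) (fun x => x + x0) ?_ ?_ ?_ ?_
    · intro x hx; simp at hx ⊢; rw [hx, sub_self]
    · intro x hx; simp at hx ⊢; exact hx
    · intro x hx; simp
    · intro x hx; simp
  have h2 := Finset.card_eq_sum_card_fiberwise (f := f) (s := univ) (t := univ) (fun x _ => by simp)
  simp_rw [h1] at h2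
  rw [Finset.sum_const, Finset.card_univ, Finset.card_univ, ZMod.card, hcard, smul_eq_mul] at h2
  rw [h1]
  have hp : 0 < p := (Fact.out : p.Prime).pos
  obtain ⟨k, rfl⟩ : ∃ k, m = k + 1 := ⟨m - 1, by omega⟩
  rw [pow_succ', ] at h2
  simpa using (Nat.eq_of_mul_eq_mul_left hp h2).symm

lemma aux_transfer (p : ℕ) [Fact p.Prime]
    (F : Type) [Field F] [Fintype F] [Algebra (ZMod p) F]
    (Dt : Set F) (hDt0 : ∀ d ∈ Dt, d ≠ (0 : F))
    (hcover : {x : F | x ≠ 0 ∧ IsSquare (Algebra.trace (ZMod p) F x) ∧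
        Algebra.trace (ZMod p) F x ≠ 0}
      = {x : F | ∃ y : ZMod p, (IsSquare y ∧ y ≠ 0) ∧
          ∃ d ∈ Dt, x = algebraMap (ZMod p) F y * d})
    (hdistinct : ∀ d ∈ Dt, ∀ d' ∈ Dt, d ≠ d' →
      ¬ ∃ y : ZMod p, (IsSquare y ∧ y ≠ 0) ∧ d / d' = algebraMap (ZMod p) F y)
    (P : F → Prop) (hP : ∀ y : ZMod p, y ≠ 0 → ∀ x, P (algebraMap (ZMod p) F y * x) ↔ P x) :
    Set.ncard {x : F | x ∈ Dt ∧ P x} = Set.ncard {x : F | Algebra.trace (ZMod p) F x = 1 ∧ P x} := by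
  have trm : ∀ (y : ZMod p) (x : F), Algebra.trace (ZMod p) F (algebraMap (ZMod p) F y * x)
      = y * Algebra.trace (ZMod p) F x := by
    intro y x
    rw [← Algebra.smul_def, map_smul, smul_eq_mul]
  have hD : ∀ d ∈ Dt, IsSquare (Algebra.trace (ZMod p) F d) ∧ Algebra.trace (ZMod p) F d ≠ 0 := by
    intro d hd
    have : d ∈ {x : F | ∃ y : ZMod p, (IsSquare y ∧ y ≠ 0) ∧
          ∃ d ∈ Dt, x = algebraMap (ZMod p) F y * d} :=
      ⟨1, ⟨IsSquare.one, one_ne_zero⟩, d, hd, by simp⟩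
    rw [← hcover] at this
    exact this.2
  refine Set.ncard_congr (fun d _ => algebraMap (ZMod p) F (Algebra.trace (ZMod p) F d)⁻¹ * d) ?_ ?_ ?_
  · rintro d ⟨hd, hPd⟩
    refine ⟨?_, (hP _ (inv_ne_zero (hD d hd).2) d).2 hPd⟩
    rw [trm, inv_mul_cancel₀ (hD d hd).2]
  · rintro d d' ⟨hd, -⟩ ⟨hd', -⟩ h
    by_contra hne
    refine hdistinct d hd d' hd' hne ⟨Algebra.trace (ZMod p) F d * (Algebra.trace (ZMod p) F d')⁻¹,
      ⟨(hD d hd).1.mul (hD d' hd').1.inv, mul_ne_zero (hD d hd).2 (inv_ne_zero (hD d' hd').2)⟩, ?_⟩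
    have n1 : algebraMap (ZMod p) F (Algebra.trace (ZMod p) F d) ≠ 0 := (map_ne_zero _).2 (hD d hd).2
    have n2 : algebraMap (ZMod p) F (Algebra.trace (ZMod p) F d') ≠ 0 := (map_ne_zero _).2 (hD d' hd').2
    have n3 := hDt0 d' hd'
    simp only [map_inv₀, map_mul] at h ⊢
    field_simp at h ⊢
    linear_combination h
  · rintro x ⟨hx, hPx⟩
    have hx0 : x ≠ 0 := by rintro rfl; simp at hx
    have : x ∈ {x : F | x ≠ 0 ∧ IsSquare (Algebra.trace (ZMod p) F x) ∧
        Algebra.trace (ZMod p) F x ≠ 0} := ⟨hx0, by rw [hx]; exact IsSquare.one, by rw [hx]; exact one_ne_zero⟩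
    rw [hcover] at this
    obtain ⟨y, ⟨-, hy⟩, d, hd, rfl⟩ := this
    refine ⟨d, ⟨hd, (hP y hy d).1 hPx⟩, ?_⟩
    rw [trm] at hx
    rw [← eq_inv_of_mul_eq_one_left hx]

lemma aux_wt (p m : ℕ) [Fact p.Prime] (hm : 3 ≤ m)
    (F : Type) [Field F] [Fintype F] [Algebra (ZMod p) F]
    (hcard : Fintype.card F = p ^ m)
    (Dt : Set F) (hDt0 : ∀ d ∈ Dt, d ≠ (0 : F))
    (hcover : {x : F | x ≠ 0 ∧ IsSquare (Algebra.trace (ZMod p) F x) ∧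
        Algebra.trace (ZMod p) F x ≠ 0}
      = {x : F | ∃ y : ZMod p, (IsSquare y ∧ y ≠ 0) ∧
          ∃ d ∈ Dt, x = algebraMap (ZMod p) F y * d})
    (hdistinct : ∀ d ∈ Dt, ∀ d' ∈ Dt, d ≠ d' →
      ¬ ∃ y : ZMod p, (IsSquare y ∧ y ≠ 0) ∧ d / d' = algebraMap (ZMod p) F y) :
    Set.ncard Dt = p ^ (m - 1) ∧ ∀ a, wtT p F Dt a + auxN p F a = p ^ (m - 1) := by
  have htr : Algebra.trace (ZMod p) F ≠ 0 := Algebra.trace_ne_zero (ZMod p) F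
  have hT1 := aux_fiber p m (by omega) F hcard _ htr 1
  have trm : ∀ (y : ZMod p) (x : F), Algebra.trace (ZMod p) F (algebraMap (ZMod p) F y * x)
      = y * Algebra.trace (ZMod p) F x := by
    intro y x
    rw [← Algebra.smul_def, map_smul, smul_eq_mul]
  constructor
  · have := aux_transfer p F Dt hDt0 hcover hdistinct (fun _ => True) (by simp)
    simp only [and_true, Set.ofPred_mem_eq] at this
    rw [this, ← hT1, ← Set.ncard_coe_finset]
    simp
  · intro a
    have := aux_transfer p F Dt hDt0 hcover hdistinct
      (fun x => Algebra.trace (ZMod p) F (a * x ^ 2) ≠ 0) (by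
        intro y hy x
        have : a * (algebraMap (ZMod p) F y * x) ^ 2 = algebraMap (ZMod p) F (y ^ 2) * (a * x ^ 2) := by
          rw [map_pow]; ring
        rw [this, trm]
        simp [hy])
    rw [wtT, this, ← hT1, auxN]
    have h2 : {x : F | Algebra.trace (ZMod p) F x = 1 ∧ Algebra.trace (ZMod p) F (a * x ^ 2) ≠ 0} =
      (({x : F | Algebra.trace (ZMod p) F x = 1 ∧ ¬ Algebra.trace (ZMod p) F (a * x ^ 2) = 0} : Finset F) : Set F) := by
      simp
    rw [h2, Set.ncard_coe_finset, ← Finset.filter_filter, ← Finset.filter_filter, add_comm]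
    exact Finset.card_filter_add_card_filter_not _

lemma aux_sumN (p m : ℕ) [Fact p.Prime] (hm : 3 ≤ m)
    (F : Type) [Field F] [Fintype F] [Algebra (ZMod p) F]
    (hcard : Fintype.card F = p ^ m) : ∑ a : F, auxN p F a = p ^ (m - 1) * p ^ (m - 1) := by
  have htr : Algebra.trace (ZMod p) F ≠ 0 := Algebra.trace_ne_zero (ZMod p) F
  have hT1 := aux_fiber p m (by omega) F hcard _ htr 1
  simp only [auxN]
  simp_rw [← Finset.filter_filter, Finset.card_filter _ (Finset.filter _ _)]
  rw [Finset.sum_comm]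
  conv_rhs => rw [← hT1]
  rw [← smul_eq_mul, ← Finset.sum_const]
  refine Finset.sum_congr rfl fun x hx => ?_
  have hx : Algebra.trace (ZMod p) F x = 1 := by simpa using hx
  have hx0 : x ≠ 0 := by rintro rfl; simp at hx
  rw [← Finset.card_filter, hT1]
  refine aux_fiber p m (by omega) F hcard
    ((Algebra.trace (ZMod p) F).comp (LinearMap.mulRight (ZMod p) (x ^ 2))) ?_ 0
  intro h
  have := LinearMap.congr_fun h (x * (x ^ 2)⁻¹)
  simp [hx0, hx] at this

lemma aux_final (p k : ℕ) [Fact p.Prime] (hp2 : p ≠ 2)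
    (F : Type) [Field F] [Fintype F] [Algebra (ZMod p) F]
    (hcard : Fintype.card F = p ^ (2 * k + 3)) (w : F → ℕ)
    (hw : ∀ a, w a + auxN p F a = p ^ (2 * k + 2)) :
    #{a : F | w a = (p - 1) * p ^ (2 * k + 1)} = p ^ (2 * k + 2) - 1 ∧
    #{a : F | w a = (p - 1) * p ^ (2 * k + 1) + p ^ k}
      = (p - 1) / 2 * (p ^ (2 * k + 2) + p ^ (k + 1)) ∧
    #{a : F | w a = (p - 1) * p ^ (2 * k + 1) - p ^ k}
      = (p - 1) / 2 * (p ^ (2 * k + 2) - p ^ (k + 1)) ∧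
    (∀ a, w a = 0 ↔ a = 0) ∧
    (∀ a, w a = 0 ∨ w a = (p - 1) * p ^ (2 * k + 1) ∨ w a = (p - 1) * p ^ (2 * k + 1) + p ^ k ∨
      w a = (p - 1) * p ^ (2 * k + 1) - p ^ k) := by
  classical
  have htr : Algebra.trace (ZMod p) F ≠ 0 := Algebra.trace_ne_zero (ZMod p) F
  have hpp : p.Prime := Fact.out
  have hmo : Odd (2 * k + 3) := ⟨k + 1, by ring⟩
  obtain ⟨q, hq⟩ := hpp.odd_of_ne_two hp2
  have hq0 : 0 < q := by have := hpp.two_le; omega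
  have hp1 : p - 1 = 2 * q := by omega
  have hpz : (p : ℤ) = 2 * q + 1 := by exact_mod_cast hq
  have hpne : (p : ℤ) ≠ 0 := by exact_mod_cast hpp.ne_zero
  obtain ⟨E, hE⟩ : ∃ E, E = p ^ k := ⟨_, rfl⟩
  have hE0 : 0 < E := hE ▸ pow_pos hpp.pos k
  have e1 : p ^ (2 * k + 1) = p * E ^ 2 := by rw [hE]; ring
  have e2 : p ^ (2 * k + 2) = p ^ 2 * E ^ 2 := by rw [hE]; ring
  have e3 : p ^ (2 * k + 3) = p ^ 3 * E ^ 2 := by rw [hE]; ring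
  have e4 : p ^ (k + 1) = p * E := by rw [hE]; ring
  have hT1 := aux_fiber p (2 * k + 3) (by omega) F hcard _ htr 1
  have hT0 := aux_fiber p (2 * k + 3) (by omega) F hcard _ htr 0
  have hsum := aux_sumN p (2 * k + 3) (by omega) F hcard
  have hmain := aux_main p (2 * k + 3) hp2 hmo F hcard
  have e2' : p ^ (2 * k + 3 - 1) = p ^ 2 * E ^ 2 := e2
  rw [e2'] at hT1 hT0 hsum
  rw [e3] at hcard
  rw [hp1, show 2 * q / 2 = q by omega, e1, e2, e4, ← hE]
  simp_rw [e2] at hw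
  obtain ⟨W, hW⟩ : ∃ W, W = 2 * q * (p * E ^ 2) := ⟨_, rfl⟩
  rw [← hW]
  have hEW : E < W := by
    have h1 : E ≤ E ^ 2 := Nat.le_self_pow two_ne_zero E
    have h2 : 1 * 2 ≤ q * p := Nat.mul_le_mul hq0 hpp.two_le
    rw [hW]; nlinarith
  have hWz : (W : ℤ) = 2 * q * (p * E ^ 2) := by exact_mod_cast hW
  have hwz : ∀ a, (w a : ℤ) + auxN p F a = p ^ 2 * E ^ 2 := fun a => by exact_mod_cast hw a
  -- classification
  have w0 : w 0 = 0 := by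
    have h1 := hw 0
    have : auxN p F 0 = p ^ 2 * E ^ 2 := by rw [← hT1]; simp [auxN]
    omega
  have c0 : ∀ a, a ≠ 0 → Algebra.trace (ZMod p) F a⁻¹ = 0 → w a = W := by
    intro a ha h
    have h1 := (hmain a ha).1 h
    have h2 : (p : ℤ) ^ (2 * k + 3) = p ^ 2 * (p * E ^ 2) := by
      have : (p : ℤ) ^ (2 * k + 3) = p ^ 3 * E ^ 2 := by exact_mod_cast e3
      rw [this]; ring
    rw [h2] at h1
    have h3 := mul_left_cancel₀ (pow_ne_zero 2 hpne) h1
    have h4 := hwz a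
    have : (w a : ℤ) = W := by
      rw [hWz]
      have : (2 * q : ℤ) = p - 1 := by linarith
      rw [this]
      linear_combination h4 - h3
    exact_mod_cast this
  have c1 : ∀ a, a ≠ 0 → Algebra.trace (ZMod p) F a⁻¹ ≠ 0 → w a = W + E ∨ w a = W - E := by
    intro a ha h
    have h1 := (hmain a ha).2 h
    have h2 : (p : ℤ) ^ (2 * k + 3) = p ^ 3 * E ^ 2 := by exact_mod_cast e3
    have h2' : (p : ℤ) ^ (2 * k + 3 + 1) = p ^ 4 * E ^ 2 := by rw [pow_succ, h2]; ring
    rw [h2, h2'] at h1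
    have h3 : (p : ℤ) ^ 4 * ((auxN p F a : ℤ) - p * E ^ 2) ^ 2 = p ^ 4 * E ^ 2 := by
      rw [← h1]; ring
    have h3 := mul_left_cancel₀ (pow_ne_zero 4 hpne) h3
    have h4 := hwz a
    have h5 : (w a : ℤ) = W - ((auxN p F a : ℤ) - p * E ^ 2) := by
      rw [hWz]
      have : (2 * q : ℤ) = p - 1 := by linarith
      rw [this]
      linear_combination h4
    rcases sq_eq_sq_iff_eq_or_eq_neg.1 h3 with h6 | h6
    · right; rw [h6] at h5; omega
    · left; rw [h6] at h5; omega
  have hz : ∀ a, w a = 0 ↔ a = 0 := by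
    intro a
    constructor
    · intro h
      by_contra ha
      by_cases hc : Algebra.trace (ZMod p) F a⁻¹ = 0
      · have := c0 a ha hc; omega
      · have := c1 a ha hc; omega
    · rintro rfl; exact w0
  have hall : ∀ a, w a = 0 ∨ w a = W ∨ w a = W + E ∨ w a = W - E := by
    intro a
    by_cases ha : a = 0
    · left; rw [ha, w0]
    by_cases hc : Algebra.trace (ZMod p) F a⁻¹ = 0
    · right; left; exact c0 a ha hc
    · right; right; exact c1 a ha hc
  have n0 : #{a : F | w a = 0} = 1 := by
    rw [Finset.card_eq_one]; exact ⟨0, by ext a; simp [hz]⟩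
  have n1 : #{a : F | w a = W} + 1 = p ^ 2 * E ^ 2 := by
    have h1 : #{a : F | Algebra.trace (ZMod p) F a⁻¹ = 0} = p ^ 2 * E ^ 2 := by
      rw [← hT0]
      refine Finset.card_nbij' (fun x => x⁻¹) (fun x => x⁻¹) ?_ ?_ ?_ ?_ <;> intro x hx <;> simp_all
    have h2 : ({a : F | w a = W} : Finset F) =
        ({a : F | Algebra.trace (ZMod p) F a⁻¹ = 0} : Finset F).erase 0 := by
      ext a
      simp only [Finset.mem_filter, Finset.mem_univ, true_and, Finset.mem_erase]
      constructor
      · intro h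
        have ha : a ≠ 0 := fun ha => by rw [ha, w0] at h; omega
        refine ⟨ha, ?_⟩
        by_contra hc
        have := c1 a ha hc; omega
      · rintro ⟨ha, hc⟩; exact c0 a ha hc
    rw [h2, Finset.card_erase_add_one (by simp), h1]
  have s1 : #{a : F | w a = 0} + #{a : F | w a = W} + #{a : F | w a = W + E} + #{a : F | w a = W - E}
      = p ^ 3 * E ^ 2 := by
    rw [← hcard, ← Finset.card_univ, Finset.card_eq_sum_ones univ]
    simp only [Finset.card_filter]
    rw [← Finset.sum_add_distrib, ← Finset.sum_add_distrib, ← Finset.sum_add_distrib]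
    refine Finset.sum_congr rfl fun a _ => ?_
    have := hall a
    split_ifs <;> omega
  have s2 : W * #{a : F | w a = W} + (W + E) * #{a : F | w a = W + E} +
      (W - E) * #{a : F | w a = W - E} = ∑ a, w a := by
    simp only [Finset.card_filter, Finset.mul_sum]
    rw [← Finset.sum_add_distrib, ← Finset.sum_add_distrib]
    refine Finset.sum_congr rfl fun a _ => ?_
    have := hall a
    split_ifs <;> simp only [mul_one, mul_zero] <;> omega
  have s3 : ∑ a, w a + p ^ 2 * E ^ 2 * (p ^ 2 * E ^ 2) = p ^ 3 * E ^ 2 * (p ^ 2 * E ^ 2) := by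
    rw [← hsum, ← Finset.sum_add_distrib, Finset.sum_congr rfl fun a _ => hw a, Finset.sum_const,
      Finset.card_univ, hcard, smul_eq_mul]
  rw [n0] at s1
  rw [← s2] at s3
  refine ⟨by omega, ?_, ?_, hz, hall⟩
  all_goals
    generalize #{a : F | w a = W} = x1 at *
    generalize #{a : F | w a = W + E} = x2 at *
    generalize #{a : F | w a = W - E} = x3 at *
    have hEz : (E : ℤ) ≠ 0 := by exact_mod_cast hE0.ne'
    zify [hEW.le] at s1 s3 n1
    have t1 : (x2 : ℤ) + x3 = 2 * q * (p ^ 2 * E ^ 2) := by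
      linear_combination s1 - n1 + (p : ℤ) ^ 2 * E ^ 2 * hpz
    have t2 : (x2 : ℤ) - x3 = 2 * q * (p * E) := by
      apply mul_left_cancel₀ hEz
      rw [hWz] at s3
      have : (2 * q : ℤ) = p - 1 := by linarith
      rw [this] at s3 t1 ⊢
      linear_combination s3 - (p - 1) * (p * E ^ 2) * (n1 + t1)
  · have : (x2 : ℤ) = q * (p ^ 2 * E ^ 2 + p * E) := by linarith
    exact_mod_cast this
  · have hle : p * E ≤ p ^ 2 * E ^ 2 := by
      rw [← mul_pow]; exact Nat.le_self_pow two_ne_zero _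
    zify [hle]
    linarith

end auxlemmas

/-- `m ≥ 3` odd.  If `D̃ ⊆ F_r^*` satisfies `D = Sq·D̃` with `d/d' ∉ Sq` for
distinct `d, d' ∈ D̃`, then `|D̃| = p^{m-1}`, the punctured code `C_{D̃}` has the stated
weight distribution, no other weight occurs, and `C_{D̃}` has `p^m` codewords (so it is a
`[p^{m-1}, m]` three-weight linear code). -/
theorem stmt_10 (p m : ℕ) [Fact p.Prime] (hp2 : p ≠ 2) (hm : 3 ≤ m) (hmo : Odd m)
    (F : Type) [Field F] [Fintype F] [Algebra (ZMod p) F]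
    (hcard : Fintype.card F = p ^ m)
    (Dt : Set F) (hDt0 : ∀ d ∈ Dt, d ≠ (0 : F))
    (hcover : {x : F | x ≠ 0 ∧ IsSquare (Algebra.trace (ZMod p) F x) ∧
        Algebra.trace (ZMod p) F x ≠ 0}
      = {x : F | ∃ y : ZMod p, (IsSquare y ∧ y ≠ 0) ∧
          ∃ d ∈ Dt, x = algebraMap (ZMod p) F y * d})
    (hdistinct : ∀ d ∈ Dt, ∀ d' ∈ Dt, d ≠ d' →
      ¬ ∃ y : ZMod p, (IsSquare y ∧ y ≠ 0) ∧ d / d' = algebraMap (ZMod p) F y) :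
    Set.ncard Dt = p ^ (m - 1) ∧
    Set.ncard {a : F | wtT p F Dt a = (p - 1) * p ^ (m - 2)} = p ^ (m - 1) - 1 ∧
    Set.ncard {a : F | wtT p F Dt a = (p - 1) * p ^ (m - 2) + p ^ ((m - 3) / 2)}
      = (p - 1) / 2 * (p ^ (m - 1) + p ^ ((m - 1) / 2)) ∧
    Set.ncard {a : F | wtT p F Dt a = (p - 1) * p ^ (m - 2) - p ^ ((m - 3) / 2)}
      = (p - 1) / 2 * (p ^ (m - 1) - p ^ ((m - 1) / 2)) ∧
    Set.ncard {a : F | wtT p F Dt a = 0} = 1 ∧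
    (∀ a : F, wtT p F Dt a = 0 ∨
      wtT p F Dt a = (p - 1) * p ^ (m - 2) ∨
      wtT p F Dt a = (p - 1) * p ^ (m - 2) + p ^ ((m - 3) / 2) ∨
      wtT p F Dt a = (p - 1) * p ^ (m - 2) - p ^ ((m - 3) / 2)) ∧
    Set.ncard (Set.range (fun a : F => fun x : Dt =>
      Algebra.trace (ZMod p) F (a * (x : F) ^ 2))) = p ^ m := by
  obtain ⟨k, rfl⟩ : ∃ k, m = 2 * k + 3 := by
    obtain ⟨j, hj⟩ := hmo
    exact ⟨j - 1, by omega⟩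
  obtain ⟨hD, hw⟩ := aux_wt p (2 * k + 3) hm F hcard Dt hDt0 hcover hdistinct
  have r1 : 2 * k + 3 - 1 = 2 * k + 2 := by omega
  have r2 : 2 * k + 3 - 2 = 2 * k + 1 := by omega
  have r3 : (2 * k + 3 - 3) / 2 = k := by omega
  have r4 : (2 * k + 2) / 2 = k + 1 := by omega
  rw [r1] at hD hw
  rw [r1, r2, r3, r4]
  obtain ⟨h1, h2, h3, h4, h5⟩ := aux_final p k hp2 F hcard (wtT p F Dt) hw
  have conv : ∀ n : ℕ, Set.ncard {a : F | wtT p F Dt a = n} =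
      (Finset.univ.filter fun a : F => wtT p F Dt a = n).card := by
    intro n
    rw [← Set.ncard_coe_finset]
    simp
  refine ⟨hD, by rw [conv, h1], by rw [conv, h2], by rw [conv, h3], ?_, h5, ?_⟩
  · simp_rw [h4]
    simp
  · rw [Set.ncard_range_of_injective, Nat.card_eq_fintype_card, hcard]
    intro a b hab
    rw [← sub_eq_zero, ← h4, wtT]
    have : {x : F | x ∈ Dt ∧ Algebra.trace (ZMod p) F ((a - b) * x ^ 2) ≠ 0} = ∅ := by
      ext x
      simp only [Set.mem_ofPred_eq, Set.mem_empty_iff_false, iff_false, not_and, not_not]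
      intro hx
      have := congrFun hab ⟨x, hx⟩
      simp only at this
      rw [sub_mul, map_sub, this, sub_self]
    rw [this, Set.ncard_empty]
end

section
/- Let a ∈ F_r^* and ρ ∈ F_p^*. Then: (1) if m is odd and Tr(a^{−1}) = 0, N_0(ρ) = p^{m−2} + (−1)^{((p−1)/2)·((m−1)/2)} η(a) η̄(ρ) p^{(m−1)/2}; (2) if m is odd and Tr(a^{−1}) ≠ 0, N_0(ρ) = p^{m−2} − (−1)^{((p−1)/2)·((m−1)/2)} η(a) η̄(Tr(a^{−1})) p^{(m−3)/2}; (3) if m is even and Tr(a^{−1}) = 0, N_0(ρ) = p^{m−2} + (−1)^{((p−1)/2)·(m/2)} η(a) p^{(m−2)/2}; (4) if m is even and Tr(a^{−1}) ≠ 0, N_0(ρ) = p^{m−2} − (−1)^{((p−1)/2)·((m−2)/2)} η(a) η̄(ρ·Tr(a^{−1})) p^{(m−2)/2}. -/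
/-- `N_0(ρ) = #{x ∈ F_r : Tr(x) = 0 and Tr(a x²) = ρ}`. -/
noncomputable def Nzero (p : ℕ) (F : Type) [Field F] [Algebra (ZMod p) F]
    (a : F) (ρ : ZMod p) : ℕ :=
  Set.ncard {x : F | Algebra.trace (ZMod p) F x = 0 ∧
    Algebra.trace (ZMod p) F (a * x ^ 2) = ρ}

lemma aux_twist {K : Type*} [Field K] [Fintype K] [DecidableEq K]
    (ψ : AddChar K ℂ) (c : K) (hc : c ≠ 0) :
    ∑ y, (quadraticChar K y : ℂ) * ψ (c * y) =
      quadraticChar K c * ∑ y, (quadraticChar K y : ℂ) * ψ y := by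
  rw [Finset.mul_sum]
  refine Fintype.sum_equiv (Equiv.mulLeft₀ c hc) _ _ fun y => ?_
  change _ = _ * (((quadraticChar K (c * y) : ℤ) : ℂ) * ψ (c * y))
  simp only [map_mul, Int.cast_mul]
  have : (quadraticChar K c : ℂ) * quadraticChar K c = 1 := by
    have := quadraticChar_sq_one hc
    rw [← sq]; exact_mod_cast this
  rw [← mul_assoc, ← mul_assoc, this, one_mul]

lemma aux_quad {K : Type*} [Field K] [Fintype K] [DecidableEq K] (hK : ringChar K ≠ 2)
    (ψ : AddChar K ℂ) (hψ : ψ.IsPrimitive) (c : K) (hc : c ≠ 0) :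
    ∑ x, ψ (c * x ^ 2) =
      quadraticChar K c * ∑ y, (quadraticChar K y : ℂ) * ψ y := by
  rw [← aux_twist ψ c hc]
  have h1 : ∑ x : K, ψ (c * x ^ 2) = ∑ y : K, ∑ x : K with x ^ 2 = y, ψ (c * x ^ 2) := by
    rw [Finset.sum_fiberwise]
  have h2 : ∀ y : K, ∑ x : K with x ^ 2 = y, ψ (c * x ^ 2)
      = (quadraticChar K y + 1 : ℂ) * ψ (c * y) := by
    intro y
    rw [Finset.sum_congr rfl (g := fun _ => ψ (c * y))]
    · rw [Finset.sum_const, nsmul_eq_mul]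
      have := quadraticChar_card_sqrts hK y
      congr 1
      have h3 : ({x : K | x ^ 2 = y} : Set K).toFinset = Finset.univ.filter (fun x => x ^ 2 = y) := by
        ext; simp
      rw [h3] at this
      exact_mod_cast this
    · intro x hx
      simp at hx
      rw [hx]
  rw [h1, Finset.sum_congr rfl fun y _ => h2 y]
  simp_rw [add_mul, one_mul]
  rw [Finset.sum_add_distrib]
  have := AddChar.sum_mulShift c hψ
  simp only [hc, if_false] at this
  simp_rw [mul_comm c]
  rw [this]; simp

lemma aux_sq {K : Type*} [Field K] [Fintype K] [DecidableEq K] (hK : ringChar K ≠ 2)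
    (ψ : AddChar K ℂ) (hψ : ψ.IsPrimitive) :
    (∑ y, (quadraticChar K y : ℂ) * ψ y) ^ 2 = quadraticChar K (-1) * Fintype.card K := by
  have h := gaussSum_sq (χ := (quadraticChar K).ringHomComp (Int.castRingHom ℂ)) (ψ := ψ) ?_ ?_ hψ
  · simpa [gaussSum] using h
  · exact (MulChar.ringHomComp_ne_one_iff (Int.cast_injective)).2 (quadraticChar_ne_one hK)
  · exact (quadraticChar_isQuadratic K).comp _

lemma aux_disc (p m : ℕ) [Fact p.Prime] (F : Type) [Field F] [Finite F] [Algebra (ZMod p) F]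
    (hr : Module.finrank (ZMod p) F = m) (hp2 : p ≠ 2) (v : Module.Basis (Fin m) (ZMod p) F) :
    quadraticChar (ZMod p) (Algebra.discr (ZMod p) v) = (-1) ^ (m - 1) := by
  have hd := Algebra.discr_not_zero_of_basis (ZMod p) v
  have : CharP F p := charP_of_injective_algebraMap (algebraMap (ZMod p) F).injective p
  have : Fintype F := Fintype.ofFinite F
  let M : Matrix (Fin m) (Fin m) F := Matrix.of fun i j => v j ^ (p ^ (i : ℕ))
  have hM : algebraMap (ZMod p) F (Algebra.discr (ZMod p) v) = M.det ^ 2 := by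
    have h0 : M.det ^ 2 = (M.transpose * M).det := by
      rw [Matrix.det_mul, Matrix.det_transpose, sq]
    rw [Algebra.discr_def, RingHom.map_det, h0]
    congr 1
    ext i j
    simp only [RingHom.mapMatrix_apply, Matrix.map_apply, Algebra.traceMatrix_apply,
      Algebra.traceForm_apply, FiniteField.algebraMap_trace_eq_sum_pow, Matrix.mul_apply,
      Matrix.transpose_apply, Matrix.of_apply, M, hr, Nat.card_zmod, mul_pow]
    rw [Finset.sum_range]
  have hcF : Fintype.card F = p ^ m := by
    rw [Module.card_eq_pow_finrank (K := ZMod p), ZMod.card, hr]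
  have hfrob : M.det ^ p = (-1) ^ (m - 1) * M.det := by
    have h1 : M.det ^ p = ((frobenius F p).mapMatrix M).det := by
      rw [← RingHom.map_det, frobenius_def]
    have h2 : (frobenius F p).mapMatrix M = M.submatrix (finRotate m) id := by
      ext i j
      simp only [RingHom.mapMatrix_apply, Matrix.map_apply, Matrix.of_apply, M, frobenius_def, Matrix.submatrix_apply, id]
      rw [← pow_mul, ← pow_succ]
      cases m with
      | zero => exact i.elim0
      | succ n =>
        by_cases hi : i = Fin.last n
        · subst hi
          have := FiniteField.pow_card (v j)
          rw [hcF] at this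
          simp [this]
        · rw [coe_finRotate_of_ne_last hi]
    rw [h1, h2, Matrix.det_permute, sign_finRotate]
    simp
  have hM0 : M.det ≠ 0 := by
    intro h
    rw [h] at hM
    apply hd
    simpa using hM
  have h2F : (2 : ZMod p) ≠ 0 := by
    intro h
    have : ringChar (ZMod p) = 2 := by
      have := (CharP.cast_eq_zero_iff (ZMod p) p 2).1 (by exact_mod_cast h)
      exact absurd ((Nat.prime_dvd_prime_iff_eq Fact.out Nat.prime_two).1 this) hp2
    exact hp2 ((ZMod.ringChar_zmod_n p) ▸ this)
  have h2F' : (2 : F) ≠ 0 := by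
    intro h
    apply h2F
    apply (algebraMap (ZMod p) F).injective
    rw [map_ofNat, map_zero]; exact h
  have hpodd : Odd p := (Fact.out : p.Prime).odd_of_ne_two hp2
  rcases Nat.even_or_odd (m - 1) with he | ho
  · rw [he.neg_one_pow] at hfrob ⊢
    rw [one_mul] at hfrob
    obtain ⟨c, hc⟩ : ∃ c : ZMod p, algebraMap (ZMod p) F c = M.det := by
      have h4 := (Subfield.mem_bot_iff_pow_eq_self (F := F) (p := p)).2 hfrob
      have h5 : (⊥ : Subfield F) ≤ (algebraMap (ZMod p) F).fieldRange := bot_le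
      exact h5 h4
    rw [quadraticChar_one_iff_isSquare hd]
    refine ⟨c, (algebraMap (ZMod p) F).injective ?_⟩
    rw [hM, map_mul, hc, sq]
  · rw [ho.neg_one_pow] at hfrob ⊢
    rw [quadraticChar_neg_one_iff_not_isSquare]
    rintro ⟨c, hc⟩
    rw [hc, map_mul, ← sq, sq_eq_sq_iff_eq_or_eq_neg] at hM
    have hcp : (algebraMap (ZMod p) F c) ^ p = algebraMap (ZMod p) F c := by
      rw [← map_pow, ZMod.pow_card]
    have : M.det ^ p = M.det := by
      rcases hM with h | h
      · rw [← h, hcp]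
      · rw [← neg_eq_iff_eq_neg.2 h, hpodd.neg_pow, hcp]
    rw [hfrob] at this
    apply hM0
    have h3 : 2 * M.det = 0 := by linear_combination -this
    simpa [h2F'] using h3

lemma aux_sum {A : Type*} [AddCommMonoid A] {ι : Type*} (ψ : AddChar A ℂ) (s : Finset ι)
    (f : ι → A) : ψ (∑ i ∈ s, f i) = ∏ i ∈ s, ψ (f i) := by
  classical
  induction s using Finset.induction_on with
  | empty => simp
  | insert a s ha ih => rw [Finset.sum_insert ha, Finset.prod_insert ha, AddChar.map_add_eq_mul, ih]

lemma aux_form (p m : ℕ) [Fact p.Prime] (F : Type) [Field F] [Fintype F] [Algebra (ZMod p) F]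
    (hr : Module.finrank (ZMod p) F = m) (hp2 : p ≠ 2) (ψ : AddChar (ZMod p) ℂ)
    (hψ : ψ.IsPrimitive) (z : ZMod p) (hz : z ≠ 0) :
    ∑ x : F, ψ (z * Algebra.trace (ZMod p) F (x ^ 2)) =
      (quadraticChar (ZMod p) z : ℂ) ^ m * ((-1) ^ (m - 1) *
        (∑ y, (quadraticChar (ZMod p) y : ℂ) * ψ y) ^ m) := by
  have hch : ringChar (ZMod p) ≠ 2 := by rwa [ZMod.ringChar_zmod_n]
  have h2F : (2 : ZMod p) ≠ 0 := Ring.two_ne_zero hch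
  have : Invertible (2 : ZMod p) := invertibleOfNonzero h2F
  subst hr
  obtain ⟨v, hv⟩ := LinearMap.BilinForm.exists_orthogonal_basis
    (K := ZMod p) (V := F) (B := Algebra.traceForm (ZMod p) F)
    ⟨fun x y => by simp [Algebra.traceForm_apply, mul_comm]⟩
  have hort : ∀ i j, i ≠ j → Algebra.trace (ZMod p) F (v i * v j) = 0 := fun i j h => hv h
  have hdisc := aux_disc p _ F rfl hp2 v
  have hd := Algebra.discr_not_zero_of_basis (ZMod p) v
  have hdp : Algebra.discr (ZMod p) v = ∏ i, Algebra.trace (ZMod p) F (v i * v i) := by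
    rw [Algebra.discr_def, ← Matrix.det_diagonal]
    congr 1
    ext i j
    rw [Algebra.traceMatrix_apply, Algebra.traceForm_apply]
    by_cases h : i = j
    · subst h; simp
    · rw [Matrix.diagonal_apply_ne _ h, hort i j h]
  rw [hdp] at hdisc hd
  rw [Finset.prod_ne_zero_iff] at hd
  have htr : ∀ t : Fin (Module.finrank (ZMod p) F) → ZMod p,
      Algebra.trace (ZMod p) F ((v.equivFun.symm t) ^ 2) =
        ∑ i, Algebra.trace (ZMod p) F (v i * v i) * t i ^ 2 := by
    intro t
    rw [Module.Basis.equivFun_symm_apply, sq, Finset.sum_mul_sum, map_sum]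
    refine Finset.sum_congr rfl fun i _ => ?_
    rw [map_sum, Finset.sum_eq_single i]
    · rw [smul_mul_smul_comm, map_smul, smul_eq_mul]; ring
    · intro j _ hj
      rw [smul_mul_smul_comm, map_smul, hort i j hj.symm, smul_zero]
    · simp
  rw [← Equiv.sum_comp v.equivFun.symm.toEquiv]
  have h3 : ∀ t : Fin (Module.finrank (ZMod p) F) → ZMod p,
      ψ (z * Algebra.trace (ZMod p) F ((v.equivFun.symm.toEquiv t) ^ 2)) =
        ∏ i, ψ ((z * Algebra.trace (ZMod p) F (v i * v i)) * t i ^ 2) := by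
    intro t
    have := htr t
    rw [LinearEquiv.coe_toEquiv, this, Finset.mul_sum, aux_sum]
    simp_rw [mul_assoc]
  rw [Finset.sum_congr rfl fun t _ => h3 t, ← Fintype.prod_sum
    (f := fun i y => ψ ((z * Algebra.trace (ZMod p) F (v i * v i)) * y ^ 2))]
  rw [Finset.prod_congr rfl fun i _ => aux_quad hch ψ hψ _ (mul_ne_zero hz (hd i (Finset.mem_univ _)))]
  rw [Finset.prod_mul_distrib]
  simp only [map_mul (quadraticChar (ZMod p)) z, Int.cast_mul]
  rw [Finset.prod_mul_distrib]
  simp only [Finset.prod_const, Finset.card_univ, Fintype.card_fin]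
  rw [mul_assoc]
  congr 2
  rw [map_prod] at hdisc
  exact_mod_cast hdisc

lemma aux_U (p : ℕ) [Fact p.Prime] (ψ : AddChar (ZMod p) ℂ)
    (hψ : ψ.IsPrimitive) (ρ : ZMod p) (hρ : ρ ≠ 0) (k : ℕ) :
    ∑ z ∈ Finset.univ.erase (0 : ZMod p), (quadraticChar (ZMod p) z : ℂ) ^ k * ψ (-(z * ρ)) =
      if Even k then -1 else (quadraticChar (ZMod p) (-1) : ℂ) * quadraticChar (ZMod p) ρ *
        ∑ y, (quadraticChar (ZMod p) y : ℂ) * ψ y := by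
  have hsq : ∀ z : ZMod p, z ≠ 0 → (quadraticChar (ZMod p) z : ℂ) ^ 2 = 1 := by
    intro z hz
    exact_mod_cast quadraticChar_sq_one hz
  split_ifs with hk
  · obtain ⟨j, rfl⟩ := hk
    have h1 : ∀ z ∈ Finset.univ.erase (0 : ZMod p),
        (quadraticChar (ZMod p) z : ℂ) ^ (j + j) * ψ (-(z * ρ)) = ψ (z * (-ρ)) := by
      intro z hz
      rw [← two_mul, pow_mul, hsq z (Finset.ne_of_mem_erase hz), one_pow, one_mul, mul_neg]
    rw [Finset.sum_congr rfl h1]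
    have h2 := AddChar.sum_mulShift (-ρ) hψ
    rw [if_neg (neg_ne_zero.2 hρ)] at h2
    rw [← Finset.add_sum_erase _ _ (Finset.mem_univ (0 : ZMod p))] at h2
    simp only [zero_mul, AddChar.map_zero_eq_one, Nat.cast_zero] at h2
    linear_combination h2
  · rw [Nat.not_even_iff_odd] at hk
    obtain ⟨j, rfl⟩ := hk
    have h1 : ∀ z ∈ Finset.univ.erase (0 : ZMod p),
        (quadraticChar (ZMod p) z : ℂ) ^ (2 * j + 1) * ψ (-(z * ρ)) =
          (quadraticChar (ZMod p) z : ℂ) * ψ ((-1 * ρ) * z) := by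
      intro z hz
      rw [pow_succ, pow_mul, hsq z (Finset.ne_of_mem_erase hz), one_pow, one_mul]
      congr 2; ring
    rw [Finset.sum_congr rfl h1]
    have h2 := aux_twist ψ (-1 * ρ) (by simpa using hρ)
    rw [map_mul, Int.cast_mul] at h2
    rw [← h2, ← Finset.add_sum_erase _ _ (Finset.mem_univ (0 : ZMod p))]
    simp

lemma aux_W (p m : ℕ) [Fact p.Prime] (F : Type) [Field F] [Fintype F] [DecidableEq F]
    [Algebra (ZMod p) F]
    (hr : Module.finrank (ZMod p) F = m) (hp2 : p ≠ 2) (ψ : AddChar (ZMod p) ℂ)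
    (hψ : ψ.IsPrimitive) (a : F) (ha : a ≠ 0) (z : ZMod p) (hz : z ≠ 0) :
    ∑ y : ZMod p, ∑ x : F, ψ (z * Algebra.trace (ZMod p) F (a * x ^ 2)
        + y * Algebra.trace (ZMod p) F x) =
      (∑ y : ZMod p, ψ ((-Algebra.trace (ZMod p) F a⁻¹ * z) * y ^ 2)) *
      (quadraticChar F a * ((quadraticChar (ZMod p) z : ℂ) ^ m * ((-1) ^ (m - 1) *
        (∑ y, (quadraticChar (ZMod p) y : ℂ) * ψ y) ^ m))) := by
  have hch : ringChar (ZMod p) ≠ 2 := by rwa [ZMod.ringChar_zmod_n]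
  have h2 : (2 : ZMod p) ≠ 0 := Ring.two_ne_zero hch
  have : CharP F p := charP_of_injective_algebraMap (algebraMap (ZMod p) F).injective p
  have hchF : ringChar F ≠ 2 := by rwa [ringChar.eq F p] at *
  have h2F : (2 : F) ≠ 0 := Ring.two_ne_zero hchF
  let χ : AddChar F ℂ := ψ.compAddMonoidHom (Algebra.trace (ZMod p) F).toAddMonoidHom
  have hχa : ∀ x, χ x = ψ (Algebra.trace (ZMod p) F x) := fun x => rfl
  have hψ1 : ψ ≠ 1 := by
    have := hψ one_ne_zero
    rwa [AddChar.mulShift_one] at this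
  have hχ : χ.IsPrimitive := by
    apply AddChar.IsPrimitive.of_ne_one
    intro h
    apply hψ1
    ext t
    obtain ⟨x, rfl⟩ := Algebra.trace_surjective (ZMod p) F t
    rw [← hχa, h]; simp
  set Z : F := algebraMap (ZMod p) F z with hZ
  have hZ0 : Z ≠ 0 := by simpa [hZ] using hz
  have htrZ : ∀ (c : ZMod p) (x : F), Algebra.trace (ZMod p) F (algebraMap (ZMod p) F c * x)
      = c * Algebra.trace (ZMod p) F x := by
    intro c x
    rw [← Algebra.smul_def, map_smul, smul_eq_mul]
  have key : ∑ x, χ (Z * a * x ^ 2) = quadraticChar F a *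
      ((quadraticChar (ZMod p) z : ℂ) ^ m * ((-1) ^ (m - 1) *
        (∑ y, (quadraticChar (ZMod p) y : ℂ) * ψ y) ^ m)) := by
    rw [← aux_form p m F hr hp2 ψ hψ z hz, aux_quad hchF χ hχ _ (mul_ne_zero hZ0 ha)]
    have := aux_quad hchF χ hχ Z hZ0
    simp only [hχa, hZ, htrZ] at this
    rw [this, map_mul, Int.cast_mul]
    simp only [hχa]
    ring
  rw [← key]
  have hshift : ∀ y : ZMod p, ∑ x : F, ψ (z * Algebra.trace (ZMod p) F (a * x ^ 2)
        + y * Algebra.trace (ZMod p) F x) =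
      ψ ((-Algebra.trace (ZMod p) F a⁻¹ * z) * (y / (2 * z)) ^ 2) * ∑ x, χ (Z * a * x ^ 2) := by
    intro y
    rw [Finset.mul_sum]
    set Y : F := algebraMap (ZMod p) F y with hY
    refine Fintype.sum_equiv (Equiv.addRight (Y / (2 * Z * a))) _ _ fun x => ?_
    rw [hχa, ← AddChar.map_add_eq_mul]
    congr 1
    have e : Z * a * ((Equiv.addRight (Y / (2 * Z * a))) x) ^ 2
        = Z * (a * x ^ 2) + (Y * x + algebraMap (ZMod p) F (y ^ 2 / (4 * z)) * a⁻¹) := by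
      simp only [Equiv.coe_addRight, map_div₀, map_mul, map_pow, map_ofNat, ← hY, ← hZ]
      have h4 : (4 : F) ≠ 0 := by
        have : (4 : F) = 2 * 2 := by norm_num
        rw [this]; exact mul_ne_zero h2F h2F
      field_simp
      ring
    rw [e, map_add, map_add, hZ, hY, htrZ, htrZ, htrZ]
    have h4 : (4 : ZMod p) ≠ 0 := by
      have : (4 : ZMod p) = 2 * 2 := by norm_num
      rw [this]; exact mul_ne_zero h2 h2
    field_simp
    ring
  rw [Finset.sum_congr rfl fun y _ => hshift y, ← Finset.sum_mul]
  congr 1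
  exact Fintype.sum_equiv (Equiv.divRight₀ (2 * z) (mul_ne_zero h2 hz)) _ _ fun y => rfl

lemma aux_count (p m : ℕ) [Fact p.Prime] (F : Type) [Field F] [Fintype F] [DecidableEq F]
    [Algebra (ZMod p) F]
    (hcard : Fintype.card F = p ^ m) (ψ : AddChar (ZMod p) ℂ)
    (hψ : ψ.IsPrimitive) (a : F) (ρ : ZMod p) :
    (p : ℂ) ^ 2 * (Nzero p F a ρ : ℂ) = p ^ m + ∑ z ∈ Finset.univ.erase (0 : ZMod p),
      ψ (-(z * ρ)) * ∑ y : ZMod p, ∑ x : F, ψ (z * Algebra.trace (ZMod p) F (a * x ^ 2)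
        + y * Algebra.trace (ZMod p) F x) := by
  have hN : (Nzero p F a ρ : ℂ) = ∑ x : F, (if Algebra.trace (ZMod p) F x = 0 then (1 : ℂ) else 0) *
      (if Algebra.trace (ZMod p) F (a * x ^ 2) - ρ = 0 then (1 : ℂ) else 0) := by
    rw [Nzero, Set.ncard_eq_toFinset_card', Finset.cast_card, Set.toFinset_ofPred, Finset.sum_filter]
    refine Finset.sum_congr rfl fun x _ => ?_
    simp only [sub_eq_zero]
    split_ifs <;> simp_all
  have hind : ∀ b : ZMod p, (p : ℂ) * (if b = 0 then (1 : ℂ) else 0) = ∑ y, ψ (y * b) := by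
    intro b
    rw [AddChar.sum_mulShift b hψ, ZMod.card]
    split_ifs <;> simp
  have h1 : (p : ℂ) ^ 2 * (Nzero p F a ρ : ℂ) = ∑ z : ZMod p,
      ψ (-(z * ρ)) * ∑ y : ZMod p, ∑ x : F, ψ (z * Algebra.trace (ZMod p) F (a * x ^ 2)
        + y * Algebra.trace (ZMod p) F x) := by
    rw [hN, Finset.mul_sum]
    simp_rw [Finset.mul_sum]
    rw [Finset.sum_congr rfl fun z _ => Finset.sum_comm, Finset.sum_comm]
    refine Finset.sum_congr rfl fun x _ => ?_
    have : ∀ u v : ℂ, (p : ℂ) ^ 2 * (u * v) = (p * v) * (p * u) := by intros; ring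
    rw [this, hind, hind, Finset.sum_mul_sum]
    refine Finset.sum_congr rfl fun z _ => Finset.sum_congr rfl fun y _ => ?_
    rw [← AddChar.map_add_eq_mul, ← AddChar.map_add_eq_mul]
    congr 1; ring
  rw [h1, ← Finset.add_sum_erase _ _ (Finset.mem_univ (0 : ZMod p))]
  congr 1
  simp only [zero_mul, neg_zero, AddChar.map_zero_eq_one, one_mul, zero_add]
  rw [← Finset.add_sum_erase _ _ (Finset.mem_univ (0 : ZMod p))]
  rw [Finset.sum_eq_zero (s := Finset.univ.erase (0 : ZMod p))]
  · simp [hcard]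
  · intro y hy
    have hy0 := Finset.ne_of_mem_erase hy
    have hne : ψ.compAddMonoidHom ((Algebra.trace (ZMod p) F).toAddMonoidHom) ≠ 1 := by
      intro h
      have hψ1 := hψ one_ne_zero
      rw [AddChar.mulShift_one] at hψ1
      apply hψ1
      ext t
      obtain ⟨x, rfl⟩ := Algebra.trace_surjective (ZMod p) F t
      exact DFunLike.congr_fun h x
    have h3 := AddChar.sum_mulShift (algebraMap (ZMod p) F y) (AddChar.IsPrimitive.of_ne_one hne)
    rw [if_neg (by simpa using hy0), Nat.cast_zero] at h3
    rw [← h3]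
    refine Finset.sum_congr rfl fun x _ => ?_
    change _ = ψ (Algebra.trace (ZMod p) F (x * algebraMap (ZMod p) F y))
    rw [mul_comm x, ← Algebra.smul_def, map_smul, smul_eq_mul]

/-- Lemma on `N_0(ρ)`: the value of `N_0(ρ)` for `a ∈ F_r^*`,
`ρ ∈ F_p^*`, in the four cases according to the parity of `m` and whether
`Tr(a⁻¹)` vanishes.  Here `η` and `η̄` are the quadratic characters of `F_r` and
`F_p` respectively. -/
theorem stmt_11 (p m : ℕ) [Fact p.Prime] (hp2 : p ≠ 2) (hm : 2 ≤ m)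
    (F : Type) [Field F] [Fintype F] [DecidableEq F] [Algebra (ZMod p) F]
    (hcard : Fintype.card F = p ^ m)
    (a : F) (ha : a ≠ 0) (ρ : ZMod p) (hρ : ρ ≠ 0) :
    (Odd m → Algebra.trace (ZMod p) F a⁻¹ = 0 →
      (Nzero p F a ρ : ℤ) = p ^ (m - 2)
        + (-1) ^ ((p - 1) / 2 * ((m - 1) / 2)) * quadraticChar F a
          * quadraticChar (ZMod p) ρ * p ^ ((m - 1) / 2)) ∧
    (Odd m → Algebra.trace (ZMod p) F a⁻¹ ≠ 0 →
      (Nzero p F a ρ : ℤ) = p ^ (m - 2)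
        - (-1) ^ ((p - 1) / 2 * ((m - 1) / 2)) * quadraticChar F a
          * quadraticChar (ZMod p) (Algebra.trace (ZMod p) F a⁻¹) * p ^ ((m - 3) / 2)) ∧
    (Even m → Algebra.trace (ZMod p) F a⁻¹ = 0 →
      (Nzero p F a ρ : ℤ) = p ^ (m - 2)
        + (-1) ^ ((p - 1) / 2 * (m / 2)) * quadraticChar F a * p ^ ((m - 2) / 2)) ∧
    (Even m → Algebra.trace (ZMod p) F a⁻¹ ≠ 0 →
      (Nzero p F a ρ : ℤ) = p ^ (m - 2)
        - (-1) ^ ((p - 1) / 2 * ((m - 2) / 2)) * quadraticChar F a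
          * quadraticChar (ZMod p) (ρ * Algebra.trace (ZMod p) F a⁻¹)
          * p ^ ((m - 2) / 2)) := by
  have hch : ringChar (ZMod p) ≠ 2 := by rwa [ZMod.ringChar_zmod_n]
  have hpodd : Odd p := (Fact.out : p.Prime).odd_of_ne_two hp2
  have hp0 : (p : ℂ) ≠ 0 := Nat.cast_ne_zero.2 (Fact.out : p.Prime).ne_zero
  have hr : Module.finrank (ZMod p) F = m := by
    have h := Module.card_eq_pow_finrank (K := ZMod p) (V := F)
    rw [hcard, ZMod.card] at h
    exact (Nat.pow_right_injective (Fact.out : p.Prime).two_le h).symm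
  obtain ⟨ψ, hψ⟩ : ∃ ψ : AddChar (ZMod p) ℂ, ψ.IsPrimitive :=
    ⟨_, ZMod.isPrimitive_stdAddChar p⟩
  have hcount := aux_count p m F hcard ψ hψ a ρ
  have hW : ∀ z ∈ Finset.univ.erase (0 : ZMod p), _ := fun z hz =>
    congrArg (fun t => ψ (-(z * ρ)) * t)
      (aux_W p m F hr hp2 ψ hψ a ha z (Finset.ne_of_mem_erase hz))
  rw [Finset.sum_congr rfl hW] at hcount
  clear hW
  have hU := aux_U p ψ hψ ρ hρ
  have hg := aux_sq hch ψ hψ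
  have hquad := fun c hc => aux_quad hch ψ hψ c hc
  rw [ZMod.card] at hg
  have hε : quadraticChar (ZMod p) (-1) = (-1) ^ ((p - 1) / 2) := by
    rw [quadraticChar_neg_one hch, ZMod.card, ZMod.χ₄_eq_neg_one_pow (Nat.odd_iff.1 hpodd)]
    congr 1
    obtain ⟨k, rfl⟩ := hpodd
    omega
  have hε2 : (quadraticChar (ZMod p) (-1) : ℂ) ^ 2 = 1 := by
    exact_mod_cast quadraticChar_sq_one (F := ZMod p) (a := -1) (by simp)
  have hnegT : ∀ T : ZMod p, (quadraticChar (ZMod p) (-T) : ℂ)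
      = quadraticChar (ZMod p) (-1) * quadraticChar (ZMod p) T := by
    intro T
    rw [← neg_one_mul, map_mul, Int.cast_mul]
  simp only [pow_mul, ← hε]
  generalize quadraticChar (ZMod p) (-1) = ε at *
  generalize hgdef : (∑ y, (quadraticChar (ZMod p) y : ℂ) * ψ y) = g at *
  generalize Algebra.trace (ZMod p) F a⁻¹ = T at *
  have hT0 : T = 0 → (p : ℂ) ^ 2 * (Nzero p F a ρ : ℂ) = p ^ m + p * (quadraticChar F a *
      ((-1) ^ (m - 1) * g ^ m)) * (if Even m then -1 else (ε : ℂ) * quadraticChar (ZMod p) ρ * g) := by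
    intro hT
    rw [hcount, ← hU m, Finset.mul_sum]
    congr 1
    refine Finset.sum_congr rfl fun z _ => ?_
    simp only [hT, neg_zero, zero_mul, AddChar.map_zero_eq_one, Finset.sum_const,
      Finset.card_univ, ZMod.card, nsmul_eq_mul, mul_one]
    ring
  have hT1 : T ≠ 0 → (p : ℂ) ^ 2 * (Nzero p F a ρ : ℂ) = p ^ m +
      (quadraticChar (ZMod p) (-T) * g * (quadraticChar F a *
      ((-1) ^ (m - 1) * g ^ m))) *
        (if Even (m + 1) then -1 else (ε : ℂ) * quadraticChar (ZMod p) ρ * g) := by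
    intro hT
    rw [hcount, ← hU (m + 1), Finset.mul_sum]
    congr 1
    refine Finset.sum_congr rfl fun z hz => ?_
    rw [hquad _ (mul_ne_zero (neg_ne_zero.2 hT) (Finset.ne_of_mem_erase hz)), map_mul,
      Int.cast_mul]
    ring
  rw [hnegT] at hT1
  clear hcount hU hquad hgdef hnegT
  have hp2' : (p : ℂ) ^ 2 ≠ 0 := pow_ne_zero 2 hp0
  refine ⟨fun hmo hT => ?_, fun hmo hT => ?_, fun hmo hT => ?_, fun hmo hT => ?_⟩
  · have h := hT0 hT
    obtain ⟨n, rfl⟩ : ∃ n, m = 2 * n + 3 := by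
      obtain ⟨k, rfl⟩ := hmo; exact ⟨k - 1, by omega⟩
    rw [if_neg (Nat.not_even_iff_odd.2 hmo)] at h
    have e1 : 2 * n + 3 - 2 = 2 * n + 1 := by omega
    have e2 : (2 * n + 3 - 1) / 2 = n + 1 := by omega
    have e3 : 2 * n + 3 - 1 = 2 * (n + 1) := by omega
    rw [e1, e2]
    rw [e3, pow_mul (-1 : ℂ), neg_one_sq, one_pow] at h
    have hS : g ^ (2 * n + 3) * g = ε ^ n * p ^ n * p ^ 2 := by
      rw [← pow_succ, show 2 * n + 3 + 1 = 2 * (n + 2) by ring, pow_mul, hg]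
      linear_combination (ε : ℂ) ^ n * p ^ n * p ^ 2 * hε2
    have : (Nzero p F a ρ : ℂ) = p ^ (2 * n + 1) + ε ^ (n + 1) * quadraticChar F a
        * quadraticChar (ZMod p) ρ * p ^ (n + 1) := by
      apply mul_left_cancel₀ hp2'
      linear_combination h + p * quadraticChar F a * ε * quadraticChar (ZMod p) ρ * hS
    exact_mod_cast this
  · have h := hT1 hT
    obtain ⟨n, rfl⟩ : ∃ n, m = 2 * n + 3 := by
      obtain ⟨k, rfl⟩ := hmo; exact ⟨k - 1, by omega⟩
    rw [if_pos hmo.add_one] at h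
    have e1 : 2 * n + 3 - 2 = 2 * n + 1 := by omega
    have e2 : (2 * n + 3 - 1) / 2 = n + 1 := by omega
    have e3 : 2 * n + 3 - 1 = 2 * (n + 1) := by omega
    have e4 : (2 * n + 3 - 3) / 2 = n := by omega
    rw [e1, e2, e4]
    rw [e3, pow_mul (-1 : ℂ), neg_one_sq, one_pow] at h
    have hS : g ^ (2 * n + 3) * g = ε ^ n * p ^ n * p ^ 2 := by
      rw [← pow_succ, show 2 * n + 3 + 1 = 2 * (n + 2) by ring, pow_mul, hg]
      linear_combination (ε : ℂ) ^ n * p ^ n * p ^ 2 * hε2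
    have : (Nzero p F a ρ : ℂ) = p ^ (2 * n + 1) - ε ^ (n + 1) * quadraticChar F a
        * quadraticChar (ZMod p) T * p ^ n := by
      apply mul_left_cancel₀ hp2'
      linear_combination h - quadraticChar F a * ε * quadraticChar (ZMod p) T * hS
    exact_mod_cast this
  · have h := hT0 hT
    rw [if_pos hmo] at h
    obtain ⟨n, rfl⟩ : ∃ n, m = 2 * n + 2 := by
      obtain ⟨k, rfl⟩ := hmo; exact ⟨k - 1, by omega⟩
    have e1 : 2 * n + 2 - 2 = 2 * n := by omega
    have e2 : (2 * n + 2) / 2 = n + 1 := by omega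
    have e3 : 2 * n + 2 - 1 = 2 * n + 1 := by omega
    have e4 : (2 * n) / 2 = n := by omega
    rw [e1, e2, e4]
    rw [e3, pow_succ (-1 : ℂ), pow_mul (-1 : ℂ), neg_one_sq, one_pow] at h
    have hS : g ^ (2 * n + 2) = ε ^ n * ε * p ^ n * p := by
      rw [show 2 * n + 2 = 2 * (n + 1) by ring, pow_mul, hg]
      ring
    have : (Nzero p F a ρ : ℂ) = p ^ (2 * n) + ε ^ (n + 1) * quadraticChar F a * p ^ n := by
      apply mul_left_cancel₀ hp2'
      linear_combination h + p * quadraticChar F a * hS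
    exact_mod_cast this
  · have h := hT1 hT
    rw [if_neg (Nat.not_even_iff_odd.2 hmo.add_one)] at h
    obtain ⟨n, rfl⟩ : ∃ n, m = 2 * n + 2 := by
      obtain ⟨k, rfl⟩ := hmo; exact ⟨k - 1, by omega⟩
    have e1 : 2 * n + 2 - 2 = 2 * n := by omega
    have e3 : 2 * n + 2 - 1 = 2 * n + 1 := by omega
    have e4 : (2 * n) / 2 = n := by omega
    rw [e1, e4, map_mul]
    rw [e3, pow_succ (-1 : ℂ), pow_mul (-1 : ℂ), neg_one_sq, one_pow] at h
    have hS : g ^ (2 * n + 2) * g ^ 2 = ε ^ n * p ^ n * p ^ 2 := by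
      rw [← pow_add, show 2 * n + 2 + 2 = 2 * (n + 2) by ring, pow_mul, hg]
      linear_combination (ε : ℂ) ^ n * p ^ n * p ^ 2 * hε2
    have : (Nzero p F a ρ : ℂ) = p ^ (2 * n) - ε ^ n * quadraticChar F a
        * (quadraticChar (ZMod p) ρ * quadraticChar (ZMod p) T) * p ^ n := by
      apply mul_left_cancel₀ hp2'
      linear_combination h - quadraticChar F a * ε ^ 2 * quadraticChar (ZMod p) ρ *
        quadraticChar (ZMod p) T * hS - quadraticChar F a * quadraticChar (ZMod p) ρ *
        quadraticChar (ZMod p) T * (ε ^ n * p ^ n * p ^ 2) * hε2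
    exact_mod_cast this
end

section
/- Let a ∈ F_r^* and ρ ∈ F_p^*. Then: (1) if Tr(a^{−1}) = 0 (for m even or odd), N(ρ) + N_1(ρ) = p^{m−1} − p^{m−2}; (2) if m is even and Tr(a^{−1}) ≠ 0, N(ρ) + N_1(ρ) = p^{m−1} − p^{m−2} + η(a)·(−1)^{((p−1)/2)·(m/2)}·p^{(m−2)/2}·(1 + η̄(−ρ·Tr(a^{−1}))); (3) if m is odd and Tr(a^{−1}) ≠ 0, N(ρ) + N_1(ρ) = p^{m−1} − p^{m−2} + η(a)·(−1)^{((p−1)/2)·((m−1)/2)}·p^{(m−3)/2}·(η̄(ρ)·p + η̄(Tr(a^{−1}))). -/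
/-- `N(ρ) = #{x ∈ F_r : Tr(x) ∈ Sq and Tr(a x²) = ρ}`. -/
noncomputable def Nsq' (p : ℕ) (F : Type) [Field F] [Algebra (ZMod p) F]
    (a : F) (ρ : ZMod p) : ℕ :=
  Set.ncard {x : F | (IsSquare (Algebra.trace (ZMod p) F x) ∧
    Algebra.trace (ZMod p) F x ≠ 0) ∧ Algebra.trace (ZMod p) F (a * x ^ 2) = ρ}

/-- `N_1(ρ) = #{x ∈ F_r : Tr(x) ∈ Nsq and Tr(a x²) = ρ}`. -/
noncomputable def Nnsq (p : ℕ) (F : Type) [Field F] [Algebra (ZMod p) F]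
    (a : F) (ρ : ZMod p) : ℕ :=
  Set.ncard {x : F | ¬ IsSquare (Algebra.trace (ZMod p) F x) ∧
    Algebra.trace (ZMod p) F (a * x ^ 2) = ρ}



lemma aux_ringChar (p : ℕ) [Fact p.Prime] (hp2 : p ≠ 2) 
    (F : Type) [Field F] [Algebra (ZMod p) F] : ringChar F ≠ 2 := by
  have : CharP F p := charP_of_injective_algebraMap (algebraMap (ZMod p) F).injective p
  rw [ringChar.eq F p]; exact hp2

lemma aux_det (p m : ℕ) [Fact p.Prime] (hm : 2 ≤ m)
    (F : Type) [Field F] [Fintype F] [Algebra (ZMod p) F]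
    (hcard : Fintype.card F = p ^ m) (b : Fin m → F) :
    (Matrix.of fun i j : Fin m => b i ^ p ^ (j : ℕ)).det ^ p =
      (-1) ^ (m - 1) * (Matrix.of fun i j : Fin m => b i ^ p ^ (j : ℕ)).det := by
  have : CharP F p := charP_of_injective_algebraMap (algebraMap (ZMod p) F).injective p
  obtain ⟨n, rfl⟩ : ∃ n, m = n + 1 := ⟨m - 1, by omega⟩
  have h := Matrix.det_permute' (finRotate (n+1)) (Matrix.of fun i j : Fin (n+1) => b i ^ p ^ (j : ℕ))
  rw [sign_finRotate] at h
  have h2 := RingHom.map_det (frobenius F p) (Matrix.of fun i j : Fin (n+1) => b i ^ p ^ (j : ℕ))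
  rw [frobenius_def] at h2
  rw [h2]
  have : (frobenius F p).mapMatrix (Matrix.of fun i j : Fin (n+1) => b i ^ p ^ (j : ℕ))
     = (Matrix.of fun i j : Fin (n+1) => b i ^ p ^ (j : ℕ)).submatrix id (finRotate (n+1)) := by
    ext i j
    simp only [RingHom.mapMatrix_apply, Matrix.map_apply, Matrix.of_apply, Matrix.submatrix_apply, id, frobenius_def]
    rw [← pow_mul, ← pow_succ]
    rw [coe_finRotate]
    split_ifs with hj
    · subst hj
      simp only [Fin.val_last]
      rw [← hcard, FiniteField.pow_card]; simp
    · rfl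
  rw [this, h]
  simp

lemma aux_finrank (p m : ℕ) [Fact p.Prime] 
    (F : Type) [Field F] [Fintype F] [Algebra (ZMod p) F]
    (hcard : Fintype.card F = p ^ m) : Module.finrank (ZMod p) F = m := by
  have h := Module.card_eq_pow_finrank (K := ZMod p) (V := F)
  rw [hcard, ZMod.card] at h
  exact (Nat.pow_right_injective (Fact.out : p.Prime).two_le h).symm

lemma aux_basis (p m : ℕ) [Fact p.Prime] (hp2 : p ≠ 2) (hm : 2 ≤ m)
    (F : Type) [Field F] [Fintype F] [DecidableEq F] [Algebra (ZMod p) F]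
    (hcard : Fintype.card F = p ^ m) (a : F) (ha : a ≠ 0) :
    ∃ (b : Module.Basis (Fin m) (ZMod p) F) (w : Fin m → ZMod p),
      (∀ i j, Algebra.trace (ZMod p) F (a * (b i * b j)) = if i = j then w i else 0) ∧
      (∀ i, w i ≠ 0) ∧
      quadraticChar (ZMod p) (∏ i, w i) = (-1) ^ (m - 1) * quadraticChar F a := by
  have hfr := aux_finrank p m F hcard
  have hrF := aux_ringChar p hp2 F
  have hrp := aux_ringChar p hp2 (ZMod p)
  have h2 : (2 : ZMod p) ≠ 0 := Ring.two_ne_zero hrp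
  let _ : Invertible (2 : ZMod p) := invertibleOfNonzero h2
  let B : LinearMap.BilinForm (ZMod p) F :=
    (Algebra.traceForm (ZMod p) F).comp (LinearMap.mulLeft (ZMod p) a) LinearMap.id
  have hB : ∀ x y, B x y = Algebra.trace (ZMod p) F (a * (x * y)) := by
    intro x y
    simp [B, Algebra.traceForm_apply, mul_assoc]
  have hsymm : LinearMap.IsSymm B := ⟨fun x y => by
    simp only [hB, RingHom.id_apply]; rw [mul_comm x y]⟩
  obtain ⟨v, hv⟩ := LinearMap.BilinForm.exists_orthogonal_basis hsymm
  let b := v.reindex (finCongr hfr)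
  have hbo : ∀ i j, i ≠ j → Algebra.trace (ZMod p) F (a * (b i * b j)) = 0 := by
    intro i j hij
    rw [← hB]
    have := hv (i := (finCongr hfr).symm i) (j := (finCongr hfr).symm j) (by simpa using hij)
    simpa [b] using this
  let w : Fin m → ZMod p := fun i => Algebra.trace (ZMod p) F (a * (b i * b i))
  have hw : ∀ i j, Algebra.trace (ZMod p) F (a * (b i * b j)) = if i = j then w i else 0 := by
    intro i j
    split_ifs with h
    · subst h; rfl
    · exact hbo i j h
  have hw0 : ∀ i, w i ≠ 0 := by
    intro i hi
    obtain ⟨c, hc⟩ := Algebra.trace_surjective (ZMod p) F 1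
    have hz : (B (b i)) = 0 := by
      apply b.ext
      intro j
      rw [hB, hw]
      split_ifs <;> simp [hi]
    have := hB (b i) (c / (a * b i))
    rw [hz] at this
    have hbi : b i ≠ 0 := b.ne_zero i
    rw [show a * (b i * (c / (a * b i))) = c by field_simp, hc] at this
    simp at this
  refine ⟨b, w, hw, hw0, ?_⟩
  set M : Matrix (Fin m) (Fin m) F := Matrix.of fun i j : Fin m => b i ^ p ^ (j : ℕ) with hM
  have hd : M.det ^ p = (-1) ^ (m-1) * M.det := aux_det p m hm F hcard b
  have hmat : M * Matrix.diagonal (fun k : Fin m => a ^ p ^ (k : ℕ)) * M.transpose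
      = Matrix.diagonal (fun i => algebraMap (ZMod p) F (w i)) := by
    ext i j
    have := congrArg (algebraMap (ZMod p) F) (hw i j)
    rw [FiniteField.algebraMap_trace_eq_sum_pow, hfr, Nat.card_zmod, Finset.sum_range] at this
    rw [Matrix.mul_apply, Matrix.diagonal_apply]
    simp only [Matrix.mul_diagonal, Matrix.transpose_apply, hM, Matrix.of_apply]
    rw [apply_ite (algebraMap (ZMod p) F), map_zero] at this
    rw [← this]
    apply Finset.sum_congr rfl
    intro k _
    rw [mul_pow, mul_pow]; ring
  have hdet := congrArg Matrix.det hmat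
  rw [Matrix.det_mul, Matrix.det_mul, Matrix.det_transpose, Matrix.det_diagonal, Matrix.det_diagonal,
    ← map_prod, Finset.prod_pow_eq_pow_sum] at hdet
  have hW0 : ∏ i, w i ≠ 0 := Finset.prod_ne_zero_iff.mpr fun i _ => hw0 i
  have hd0 : M.det ≠ 0 := by
    intro h
    rw [h] at hdet
    simp only [zero_mul] at hdet
    exact hW0 ((map_eq_zero _).1 hdet.symm)
  have hpodd : p % 2 = 1 := (Fact.out : p.Prime).eq_two_or_odd.resolve_left hp2
  have hd1 : M.det ^ (2 * (p / 2)) = (-1) ^ (m-1) := by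
    have : M.det ^ p = M.det ^ (2 * (p/2)) * M.det := by
      rw [← pow_succ]; congr 1; omega
    rw [this] at hd
    exact mul_right_cancel₀ hd0 hd
  have hexp : (∑ k : Fin m, p ^ (k : ℕ)) * (p / 2) = p ^ m / 2 := by
    rw [← Finset.sum_range (fun k => p ^ k)]
    have h2 : (∑ k ∈ Finset.range m, p ^ k) * (p - 1) = p ^ m - 1 := by
      have h0 := geom_sum_mul_add (p - 1) m
      rw [Nat.sub_add_cancel (Fact.out : p.Prime).one_le] at h0
      omega
    have h3 : p - 1 = 2 * (p/2) := by omega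
    rw [h3] at h2
    have h4 : (∑ k ∈ Finset.range m, p ^ k) * (2 * (p/2)) = 2 * ((∑ k ∈ Finset.range m, p ^ k) * (p/2)) := by ring
    have h5 : p ^ m % 2 = 1 := by rw [Nat.pow_mod, hpodd]; simp
    omega
  apply Int.cast_injOn_of_ringChar_ne_two hrF
  · rcases quadraticChar_dichotomy hW0 with h | h <;> simp [h]
  · rcases quadraticChar_dichotomy ha with h | h <;> rcases neg_one_pow_eq_or ℤ (m-1) with h' | h' <;> simp [h, h']
  have e1 := quadraticChar_eq_pow_of_char_ne_two' hrp (∏ i, w i)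
  have e2 := quadraticChar_eq_pow_of_char_ne_two' hrF a
  have e3 := congrArg (algebraMap (ZMod p) F) e1
  rw [map_intCast, map_pow, ZMod.card, ← hdet] at e3
  rw [e3]
  push_cast
  rw [e2, hcard, ← hexp, ← hd1, mul_pow, mul_pow]
  ring

noncomputable abbrev chiC (p : ℕ) [Fact p.Prime] : MulChar (ZMod p) ℂ :=
  (quadraticChar (ZMod p)).ringHomComp (Int.castRingHom ℂ)

noncomputable abbrev psiC (p : ℕ) [Fact p.Prime] : AddChar (ZMod p) ℂ := ZMod.stdAddChar

noncomputable abbrev GC (p : ℕ) [Fact p.Prime] : ℂ := gaussSum (chiC p) (psiC p)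

lemma chi_sq (p : ℕ) [Fact p.Prime] {c : ZMod p} (hc : c ≠ 0) : chiC p c * chiC p c = 1 := by
  rcases quadraticChar_dichotomy hc with h | h <;> simp [MulChar.ringHomComp_apply, h]

lemma psi_prim (p : ℕ) [Fact p.Prime] : (psiC p).IsPrimitive := ZMod.isPrimitive_stdAddChar p

lemma GC_sq (p : ℕ) [Fact p.Prime] (hp2 : p ≠ 2) : GC p ^ 2 = chiC p (-1) * p := by
  have h := quadraticChar_ne_one (aux_ringChar p hp2 (ZMod p))
  have h1 : chiC p ≠ 1 := by
    rwa [Ne, MulChar.ringHomComp_eq_one_iff Int.cast_injective]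
  have h2 : (chiC p).IsQuadratic := (quadraticChar_isQuadratic (ZMod p)).comp _
  have := gaussSum_sq h1 h2 (psi_prim p)
  rwa [ZMod.card] at this

lemma sum_lin (p : ℕ) [Fact p.Prime] {c : ZMod p} (hc : c ≠ 0) :
    ∑ z, chiC p z * psiC p (c * z) = chiC p c * GC p := by
  have h := gaussSum_mulShift (chiC p) (psiC p) (Units.mk0 c hc)
  simp only [Units.val_mk0] at h
  rw [GC, ← h, ← mul_assoc, chi_sq p hc, one_mul]
  rfl

lemma sum_psi (p : ℕ) [Fact p.Prime] (c : ZMod p) :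
    ∑ z, psiC p (z * c) = if c = 0 then (p : ℂ) else 0 := by
  rw [AddChar.sum_mulShift c (psi_prim p), ZMod.card]
  split_ifs <;> simp

lemma sum_quad (p : ℕ) [Fact p.Prime] (hp2 : p ≠ 2) {c : ZMod p} (hc : c ≠ 0) :
    ∑ t, psiC p (c * t ^ 2) = chiC p c * GC p := by
  rw [← sum_lin p hc, ← Finset.sum_fiberwise (s := Finset.univ) (g := fun t : ZMod p => t ^ 2)]
  have h0 : ∑ z, psiC p (c * z) = 0 := by
    have := sum_psi p c
    rw [if_neg hc] at this
    rw [← this]; simp_rw [mul_comm c]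
  rw [← add_zero (∑ z, chiC p z * psiC p (c * z)), ← h0, ← Finset.sum_add_distrib]
  apply Finset.sum_congr rfl
  intro s _
  have h1 : ∀ t ∈ Finset.univ.filter (fun t : ZMod p => t ^ 2 = s), psiC p (c * t ^ 2) = psiC p (c * s) := by
    intro t ht
    rw [(Finset.mem_filter.1 ht).2]
  rw [Finset.sum_congr rfl h1, Finset.sum_const]
  have h2 := quadraticChar_card_sqrts (aux_ringChar p hp2 (ZMod p)) s
  have h3 : ({x : ZMod p | x ^ 2 = s} : Set (ZMod p)).toFinset = Finset.univ.filter (fun t : ZMod p => t ^ 2 = s) := by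
    ext; simp
  rw [h3] at h2
  have h4 := congrArg (Int.cast : ℤ → ℂ) h2
  push_cast at h4
  rw [nsmul_eq_mul, h4, MulChar.ringHomComp_apply]
  simp only [eq_intCast]
  ring

lemma psi_sum (p : ℕ) [Fact p.Prime] {ι : Type} [DecidableEq ι] (s : Finset ι) (f : ι → ZMod p) :
    psiC p (∑ i ∈ s, f i) = ∏ i ∈ s, psiC p (f i) := by
  induction s using Finset.induction_on with
  | empty => simp
  | insert i s hi ih => rw [Finset.sum_insert hi, Finset.prod_insert hi, AddChar.map_add_eq_mul, ih]

lemma sum_form (p m : ℕ) [Fact p.Prime] (hp2 : p ≠ 2) (hm : 2 ≤ m)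
    (F : Type) [Field F] [Fintype F] [DecidableEq F] [Algebra (ZMod p) F]
    (hcard : Fintype.card F = p ^ m) (a : F) (ha : a ≠ 0) (z : ZMod p) (hz : z ≠ 0) :
    ∑ x : F, psiC p (z * Algebra.trace (ZMod p) F (a * x ^ 2)) =
      chiC p z ^ m * ((-1) ^ (m - 1) * (quadraticChar F a : ℂ) * GC p ^ m) := by
  obtain ⟨b, w, hw, hw0, hq⟩ := aux_basis p m hp2 hm F hcard a ha
  rw [← b.equivFun.symm.toEquiv.sum_comp]
  have hx : ∀ t : Fin m → ZMod p, psiC p (z * Algebra.trace (ZMod p) F (a * (b.equivFun.symm.toEquiv t) ^ 2))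
      = ∏ i, psiC p (z * w i * (t i) ^ 2) := by
    intro t
    rw [← psi_sum]
    congr 1
    have : b.equivFun.symm.toEquiv t = ∑ i, t i • b i := b.equivFun_symm_apply t
    rw [this, sq, Finset.sum_mul_sum, Finset.mul_sum, map_sum, Finset.mul_sum]
    apply Finset.sum_congr rfl
    intro i _
    rw [Finset.mul_sum, map_sum, Finset.sum_eq_single i]
    · rw [smul_mul_smul_comm, mul_smul_comm, map_smul, hw, if_pos rfl, smul_eq_mul]; ring
    · intro j _ hj
      rw [smul_mul_smul_comm, mul_smul_comm, map_smul, hw, if_neg (Ne.symm hj), smul_zero]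
    · simp
  simp_rw [hx]
  rw [← Fintype.prod_sum (fun i (s : ZMod p) => psiC p (z * w i * s ^ 2))]
  rw [Finset.prod_congr rfl (fun i _ => sum_quad p hp2 (mul_ne_zero hz (hw0 i)))]
  simp_rw [map_mul]
  rw [Finset.prod_mul_distrib, Finset.prod_mul_distrib, ← map_prod (chiC p) w]
  have : chiC p (∏ i, w i) = (-1) ^ (m - 1) * (quadraticChar F a : ℂ) := by
    rw [MulChar.ringHomComp_apply, hq]; simp
  rw [this]
  simp
  ring

lemma sum_full (p m : ℕ) [Fact p.Prime] (hp2 : p ≠ 2) (hm : 2 ≤ m)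
    (F : Type) [Field F] [Fintype F] [DecidableEq F] [Algebra (ZMod p) F]
    (hcard : Fintype.card F = p ^ m) (a : F) (ha : a ≠ 0) (z : ZMod p) (hz : z ≠ 0) (y : ZMod p) :
    ∑ x : F, psiC p (z * Algebra.trace (ZMod p) F (a * x ^ 2) + y * Algebra.trace (ZMod p) F x) =
      psiC p ((-(Algebra.trace (ZMod p) F a⁻¹) / (4 * z)) * y ^ 2) * (chiC p z ^ m *
        ((-1) ^ (m - 1) * (quadraticChar F a : ℂ) * GC p ^ m)) := by
  rw [← sum_form p m hp2 hm F hcard a ha z hz, Finset.mul_sum]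
  have h2 : (2 : ZMod p) ≠ 0 := Ring.two_ne_zero (aux_ringChar p hp2 (ZMod p))
  have h4 : (4 : ZMod p) ≠ 0 := by
    rw [show (4 : ZMod p) = 2 * 2 by norm_num]; exact mul_ne_zero h2 h2
  rw [← (Equiv.subRight ((y / (2 * z)) • a⁻¹)).sum_comp]
  apply Finset.sum_congr rfl
  intro x _
  rw [← AddChar.map_add_eq_mul, Equiv.subRight_apply]
  congr 1
  have e : a * (x - (y / (2 * z)) • a⁻¹) ^ 2 = a * x ^ 2 - (2 * (y / (2 * z))) • x + (y / (2 * z)) ^ 2 • a⁻¹ := by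
    simp only [Algebra.smul_def, map_mul, map_pow, map_ofNat]
    field_simp
    ring
  rw [e, map_add, map_sub, map_sub, map_smul, map_smul, map_smul]
  simp only [smul_eq_mul]
  field_simp
  ring

lemma chi_pow_even (p k : ℕ) [Fact p.Prime] (hk : Even k) {c : ZMod p} (hc : c ≠ 0) :
    chiC p c ^ k = 1 := by
  obtain ⟨j, rfl⟩ := hk
  rw [pow_add, ← mul_pow, chi_sq p hc, one_pow]

lemma sum_pow_even (p k : ℕ) [Fact p.Prime] (hk : Even k) (hk0 : k ≠ 0) {c : ZMod p} (hc : c ≠ 0) :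
    ∑ z, psiC p (c * z) * chiC p z ^ k = -1 := by
  have h0 : ∑ z, psiC p (c * z) = 0 := by
    have := sum_psi p c
    rw [if_neg hc] at this
    rw [← this]; simp_rw [mul_comm c]
  have : ∀ z, psiC p (c * z) * chiC p z ^ k = psiC p (c * z) - if z = 0 then 1 else 0 := by
    intro z
    by_cases hz : z = 0
    · subst hz
      rw [MulChar.map_zero, zero_pow hk0]; simp
    · rw [chi_pow_even p k hk hz, if_neg hz]; simp
  simp_rw [this]
  rw [Finset.sum_sub_distrib, h0]; simp

lemma sum_pow_odd (p k : ℕ) [Fact p.Prime] (hk : Odd k) {c : ZMod p} (hc : c ≠ 0) :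
    ∑ z, psiC p (c * z) * chiC p z ^ k = chiC p c * GC p := by
  rw [← sum_lin p hc]
  apply Finset.sum_congr rfl
  intro z _
  obtain ⟨j, rfl⟩ := hk
  by_cases hz : z = 0
  · subst hz
    rw [MulChar.map_zero, zero_pow (by omega)]; simp
  · rw [pow_succ, chi_pow_even p _ (even_two_mul j) hz]; ring

lemma sum_trace (p : ℕ) [Fact p.Prime] 
    (F : Type) [Field F] [Fintype F] [Algebra (ZMod p) F] (y : ZMod p) (hy : y ≠ 0) :
    ∑ x : F, psiC p (y * Algebra.trace (ZMod p) F x) = 0 := by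
  let φ : AddChar F ℂ := (AddChar.mulShift (psiC p) y).compAddMonoidHom (Algebra.trace (ZMod p) F).toAddMonoidHom
  have hφ : φ ≠ 1 := by
    intro h
    apply psi_prim p hy
    ext t
    obtain ⟨c, rfl⟩ := Algebra.trace_surjective (ZMod p) F t
    exact DFunLike.congr_fun h c
  exact AddChar.sum_eq_zero_of_ne_one hφ

lemma count_tot (p m : ℕ) [Fact p.Prime] (hp2 : p ≠ 2) (hm : 2 ≤ m)
    (F : Type) [Field F] [Fintype F] [DecidableEq F] [Algebra (ZMod p) F]
    (hcard : Fintype.card F = p ^ m) (a : F) (ha : a ≠ 0) (ρ : ZMod p) :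
    (p : ℂ) * (Finset.univ.filter (fun x : F => Algebra.trace (ZMod p) F (a * x ^ 2) = ρ)).card =
      p ^ m + ((-1) ^ (m - 1) * (quadraticChar F a : ℂ) * GC p ^ m) *
        ∑ z, psiC p (-ρ * z) * chiC p z ^ m := by
  have h1 : (p : ℂ) * (Finset.univ.filter (fun x : F => Algebra.trace (ZMod p) F (a * x ^ 2) = ρ)).card
      = ∑ x : F, ∑ z, psiC p (z * (Algebra.trace (ZMod p) F (a * x ^ 2) - ρ)) := by
    simp_rw [sum_psi, sub_eq_zero]
    rw [Finset.sum_ite]; simp [mul_comm]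
  have h2 : (p : ℂ) ^ m = ∑ z : ZMod p, if z = 0 then (p : ℂ) ^ m else 0 := by simp
  rw [h1, Finset.sum_comm, h2, Finset.mul_sum, ← Finset.sum_add_distrib]
  apply Finset.sum_congr rfl
  intro z _
  by_cases hz : z = 0
  · subst hz
    rw [MulChar.map_zero, zero_pow (by omega)]; simp [hcard]
  · rw [if_neg hz]
    have := sum_form p m hp2 hm F hcard a ha z hz
    have e : ∀ x : F, psiC p (z * (Algebra.trace (ZMod p) F (a * x ^ 2) - ρ)) =
        psiC p (-ρ * z) * psiC p (z * Algebra.trace (ZMod p) F (a * x ^ 2)) := by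
      intro x
      rw [← AddChar.map_add_eq_mul]; congr 1; ring
    simp_rw [e]
    rw [← Finset.mul_sum, this]; ring

lemma count_zero (p m : ℕ) [Fact p.Prime] (hp2 : p ≠ 2) (hm : 2 ≤ m)
    (F : Type) [Field F] [Fintype F] [DecidableEq F] [Algebra (ZMod p) F]
    (hcard : Fintype.card F = p ^ m) (a : F) (ha : a ≠ 0) (ρ : ZMod p) :
    (p : ℂ) ^ 2 * (Finset.univ.filter (fun x : F => Algebra.trace (ZMod p) F (a * x ^ 2) = ρ ∧
        Algebra.trace (ZMod p) F x = 0)).card =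
      p ^ m + ((-1) ^ (m - 1) * (quadraticChar F a : ℂ) * GC p ^ m) *
        ∑ z, psiC p (-ρ * z) * chiC p z ^ m *
          ∑ y, psiC p ((-(Algebra.trace (ZMod p) F a⁻¹) / (4 * z)) * y ^ 2) := by
  have h1 : (p : ℂ) ^ 2 * (Finset.univ.filter (fun x : F => Algebra.trace (ZMod p) F (a * x ^ 2) = ρ ∧
        Algebra.trace (ZMod p) F x = 0)).card
      = ∑ x : F, ∑ z, ∑ y, psiC p (z * (Algebra.trace (ZMod p) F (a * x ^ 2) - ρ)) *
          psiC p (y * Algebra.trace (ZMod p) F x) := by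
    simp_rw [← Finset.mul_sum, ← Finset.sum_mul, sum_psi, sub_eq_zero]
    rw [Finset.card_filter]
    push_cast
    rw [Finset.mul_sum]
    apply Finset.sum_congr rfl
    intro x _
    by_cases h : Algebra.trace (ZMod p) F (a * x ^ 2) = ρ <;>
      by_cases h' : Algebra.trace (ZMod p) F x = 0 <;> simp [h, h', sq]
  have h2 : (p : ℂ) ^ m = ∑ z : ZMod p, if z = 0 then (p : ℂ) ^ m else 0 := by simp
  rw [h1, Finset.sum_comm, h2, Finset.mul_sum, ← Finset.sum_add_distrib]
  apply Finset.sum_congr rfl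
  intro z _
  rw [Finset.sum_comm]
  by_cases hz : z = 0
  · subst hz
    rw [MulChar.map_zero, zero_pow (by omega), Finset.sum_eq_single 0]
    · simp [hcard]
    · intro y _ hy
      simpa using sum_trace p F y hy
    · simp
  · rw [if_neg hz]
    rw [Finset.mul_sum, Finset.mul_sum, zero_add]
    apply Finset.sum_congr rfl
    intro y _
    have := sum_full p m hp2 hm F hcard a ha z hz y
    have e : ∀ x : F, psiC p (z * (Algebra.trace (ZMod p) F (a * x ^ 2) - ρ)) *
          psiC p (y * Algebra.trace (ZMod p) F x) =
        psiC p (-ρ * z) * psiC p (z * Algebra.trace (ZMod p) F (a * x ^ 2) + y * Algebra.trace (ZMod p) F x) := by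
      intro x
      rw [← AddChar.map_add_eq_mul, ← AddChar.map_add_eq_mul]; congr 1; ring
    simp_rw [e]
    rw [← Finset.mul_sum, this]; ring

lemma sum_zero_ne (p m : ℕ) [Fact p.Prime] (hp2 : p ≠ 2) (hm : 2 ≤ m) (ρ T : ZMod p) (hT : T ≠ 0) :
    ∑ z, psiC p (-ρ * z) * chiC p z ^ m * ∑ y, psiC p ((-T / (4 * z)) * y ^ 2) =
    chiC p (-T) * GC p * ∑ z, psiC p (-ρ * z) * chiC p z ^ (m + 1) := by
  rw [Finset.mul_sum]
  apply Finset.sum_congr rfl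
  intro z _
  by_cases hz : z = 0
  · subst hz
    rw [MulChar.map_zero, zero_pow (by omega), zero_pow (by omega)]; simp
  · have h2 : (2 : ZMod p) ≠ 0 := Ring.two_ne_zero (aux_ringChar p hp2 (ZMod p))
    have h4 : (4 : ZMod p) = 2 * 2 := by norm_num
    have h40 : (4 : ZMod p) ≠ 0 := by rw [h4]; exact mul_ne_zero h2 h2
    have hne : -T / (4 * z) ≠ 0 := div_ne_zero (neg_ne_zero.2 hT) (mul_ne_zero h40 hz)
    rw [sum_quad p hp2 hne]
    have e : chiC p (-T / (4 * z)) = chiC p (-T) * chiC p z := by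
      have h5 : chiC p (-T / (4 * z)) * chiC p (4 * z) = chiC p (-T) := by
        rw [← map_mul]; congr 1; field_simp
      rw [← h5, mul_assoc, map_mul (chiC p) 4 z, mul_assoc (chiC p 4), chi_sq p hz, h4, map_mul,
        chi_sq p h2]; ring
    rw [e]; ring

lemma count_diff (p : ℕ) [Fact p.Prime] 
    (F : Type) [Field F] [Fintype F] [DecidableEq F] [Algebra (ZMod p) F]
    (a : F) (ρ : ZMod p) :
    ((Nsq' p F a ρ + Nnsq p F a ρ : ℕ) : ℂ) = 
    ((Finset.univ.filter (fun x : F => Algebra.trace (ZMod p) F (a * x ^ 2) = ρ)).card : ℂ) -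
    (Finset.univ.filter (fun x : F => Algebra.trace (ZMod p) F (a * x ^ 2) = ρ ∧
        Algebra.trace (ZMod p) F x = 0)).card := by
  classical
  rw [eq_sub_iff_add_eq]
  norm_cast
  unfold Nsq' Nnsq
  rw [Set.ncard_eq_toFinset_card', Set.ncard_eq_toFinset_card', ← Finset.card_union_of_disjoint,
    ← Finset.card_union_of_disjoint]
  · congr 1
    ext x
    simp only [Finset.mem_union, Set.mem_toFinset, Set.mem_setOf_eq, Finset.mem_filter, Finset.mem_univ, true_and]
    tauto
  · rw [Finset.disjoint_left]
    intro x
    simp only [Finset.mem_union, Set.mem_toFinset, Set.mem_setOf_eq, Finset.mem_filter, Finset.mem_univ, true_and]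
    rintro (h | h) h'
    · exact h.1.2 h'.2
    · apply h.1; rw [h'.2]; exact IsSquare.zero
  · rw [Finset.disjoint_left]
    intro x
    simp only [Set.mem_toFinset, Set.mem_setOf_eq]
    tauto
 
/-- Lemma on `N(ρ) + N_1(ρ)`: the value of `N(ρ) + N_1(ρ)` for
`a ∈ F_r^*`, `ρ ∈ F_p^*`.  Here `η` and `η̄` are the quadratic characters of `F_r`
and `F_p` respectively. -/
theorem stmt_12 (p m : ℕ) [Fact p.Prime] (hp2 : p ≠ 2) (hm : 2 ≤ m)
    (F : Type) [Field F] [Fintype F] [DecidableEq F] [Algebra (ZMod p) F]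
    (hcard : Fintype.card F = p ^ m)
    (a : F) (ha : a ≠ 0) (ρ : ZMod p) (hρ : ρ ≠ 0) :
    (Algebra.trace (ZMod p) F a⁻¹ = 0 →
      (Nsq' p F a ρ : ℤ) + Nnsq p F a ρ = p ^ (m - 1) - p ^ (m - 2)) ∧
    (Even m → Algebra.trace (ZMod p) F a⁻¹ ≠ 0 →
      (Nsq' p F a ρ : ℤ) + Nnsq p F a ρ = p ^ (m - 1) - p ^ (m - 2)
        + quadraticChar F a * (-1) ^ ((p - 1) / 2 * (m / 2)) * p ^ ((m - 2) / 2)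
          * (1 + quadraticChar (ZMod p) (-ρ * Algebra.trace (ZMod p) F a⁻¹))) ∧
    (Odd m → Algebra.trace (ZMod p) F a⁻¹ ≠ 0 →
      (Nsq' p F a ρ : ℤ) + Nnsq p F a ρ = p ^ (m - 1) - p ^ (m - 2)
        + quadraticChar F a * (-1) ^ ((p - 1) / 2 * ((m - 1) / 2)) * p ^ ((m - 3) / 2)
          * (quadraticChar (ZMod p) ρ * p
            + quadraticChar (ZMod p) (Algebra.trace (ZMod p) F a⁻¹))) := by
  have hp0 : (p : ℂ) ≠ 0 := Nat.cast_ne_zero.2 (Fact.out : p.Prime).ne_zero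
  have hpodd : p % 2 = 1 := (Fact.out : p.Prime).eq_two_or_odd.resolve_left hp2
  have hD := count_diff p F a ρ
  have hA := count_tot p m hp2 hm F hcard a ha ρ
  have hB := count_zero p m hp2 hm F hcard a ha ρ
  have hρ' : -ρ ≠ 0 := neg_ne_zero.2 hρ
  have hneg : chiC p (-1) = (-1) ^ ((p - 1) / 2) := by
    rw [MulChar.ringHomComp_apply, quadraticChar_neg_one (aux_ringChar p hp2 (ZMod p)), ZMod.card,
      ZMod.χ₄_eq_neg_one_pow hpodd, show (p - 1) / 2 = p / 2 by omega]
    simp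
  have hG : GC p ^ 2 = (-1) ^ ((p - 1) / 2) * p := by rw [GC_sq p hp2, hneg]
  have hε : ((-1 : ℂ) ^ ((p - 1) / 2)) * (-1) ^ ((p - 1) / 2) = 1 := by
    rw [← mul_pow]; simp
  have hchi : ∀ c, ((quadraticChar (ZMod p) c : ℤ) : ℂ) = chiC p c := fun c => by
    rw [MulChar.ringHomComp_apply]; simp
  have hmneg : ∀ c, chiC p (-c) = (-1) ^ ((p - 1) / 2) * chiC p c := fun c => by
    rw [← hneg, ← map_mul, neg_one_mul]
  set A : ℂ := ((Finset.univ.filter (fun x : F => Algebra.trace (ZMod p) F (a * x ^ 2) = ρ)).card : ℂ)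
  set B : ℂ := ((Finset.univ.filter (fun x : F => Algebra.trace (ZMod p) F (a * x ^ 2) = ρ ∧
        Algebra.trace (ZMod p) F x = 0)).card : ℂ)
  set T := Algebra.trace (ZMod p) F a⁻¹
  set η : ℤ := quadraticChar F a
  push_cast at hD
  refine ⟨fun hT => ?_, fun hev hT => ?_, fun hodd hT => ?_⟩
  · rw [← Int.cast_inj (α := ℂ)]
    push_cast
    rw [hD]
    rw [hT] at hB
    simp only [neg_zero, zero_div, zero_mul, AddChar.map_zero_eq_one, Finset.sum_const, Finset.card_univ,
      ZMod.card, nsmul_eq_mul, mul_one] at hB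
    rw [← Finset.sum_mul] at hB
    obtain ⟨n, rfl⟩ : ∃ n, m = n + 2 := ⟨m - 2, by omega⟩
    rw [show n + 2 - 1 = n + 1 by omega, show n + 2 - 2 = n by omega] at *
    apply mul_left_cancel₀ (pow_ne_zero 2 hp0)
    linear_combination (p : ℂ) * hA - hB
  · rw [← Int.cast_inj (α := ℂ)]
    push_cast
    rw [hD, hchi]
    rw [sum_zero_ne p m hp2 hm ρ T hT, sum_pow_odd p (m + 1) hev.add_one hρ'] at hB
    rw [sum_pow_even p m hev (by omega) hρ'] at hA
    rw [map_mul, hmneg]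
    rw [hmneg, hmneg] at hB
    obtain ⟨n, hn⟩ : ∃ n, m = 2 * n + 2 := by
      obtain ⟨j, hj⟩ := hev
      exact ⟨j - 1, by omega⟩
    subst hn
    rw [show 2 * n + 2 - 1 = 2 * n + 1 by omega] at *
    rw [show 2 * n + 2 - 2 = 2 * n by omega, show (2 * n + 2) / 2 = n + 1 by omega,
      show 2 * n / 2 = n by omega]
    have hGm : GC p ^ (2 * n + 2) = ((-1) ^ ((p - 1) / 2)) ^ (n + 1) * p ^ (n + 1) := by
      rw [show 2 * n + 2 = 2 * (n + 1) by ring, pow_mul, hG, mul_pow]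
    have hs : (-1 : ℂ) ^ (2 * n + 1) = -1 := Odd.neg_one_pow ⟨n, rfl⟩
    rw [hGm, hs] at hA hB
    rw [pow_mul (-1 : ℂ)]
    set ε : ℂ := (-1) ^ ((p - 1) / 2)
    apply mul_left_cancel₀ (pow_ne_zero 2 hp0)
    linear_combination (p : ℂ) * hA - hB + (η * ε ^ (n + 1) * p ^ (n + 1) * (ε * chiC p T) * (ε * chiC p ρ)) * hG
      + (η * ε ^ (n + 1) * p ^ (n + 2) * ε * chiC p T * chiC p ρ) * hε
  · rw [← Int.cast_inj (α := ℂ)]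
    push_cast
    rw [hD, hchi, hchi]
    rw [sum_zero_ne p m hp2 hm ρ T hT, sum_pow_even p (m + 1) hodd.add_one (by omega) hρ'] at hB
    rw [sum_pow_odd p m hodd hρ'] at hA
    rw [hmneg] at hA hB
    obtain ⟨n, hn⟩ : ∃ n, m = 2 * n + 3 := by
      obtain ⟨j, hj⟩ := hodd
      exact ⟨j - 1, by omega⟩
    subst hn
    rw [show 2 * n + 3 - 1 = 2 * n + 2 by omega] at *
    rw [show 2 * n + 3 - 2 = 2 * n + 1 by omega, show (2 * n + 2) / 2 = n + 1 by omega,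
      show (2 * n + 3 - 3) / 2 = n by omega]
    have hGm : GC p ^ (2 * n + 3) * GC p = ((-1) ^ ((p - 1) / 2)) ^ (n + 2) * p ^ (n + 2) := by
      rw [← pow_succ, show 2 * n + 3 + 1 = 2 * (n + 2) by ring, pow_mul, hG, mul_pow]
    have hs : (-1 : ℂ) ^ (2 * n + 2) = 1 := Even.neg_one_pow ⟨n + 1, by ring⟩
    rw [hs] at hA hB
    rw [pow_mul (-1 : ℂ)]
    set ε : ℂ := (-1) ^ ((p - 1) / 2)
    apply mul_left_cancel₀ (pow_ne_zero 2 hp0)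
    linear_combination (p : ℂ) * hA - hB + (η * ε * (p * chiC p ρ + chiC p T)) * hGm
      + (η * ε ^ (n + 1) * p ^ (n + 2) * (p * chiC p ρ + chiC p T)) * hε
end
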